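/- Let B ⊂ ℝ^d (d ≥ 1) be an open Euclidean ball and let G be the semilinear operator defined in the context. Then there exist λ_B ∈ ℝ and a function ψ that is C² on B and continuous on the closed ball B̄, with ψ > 0 in B and ψ = 0 on ∂B, such that Gψ = λ_B ψ in B. Moreover ψ is unique up to multiplication by a positive scalar: if (λ_B, ψ') is another such pair with the same λ_B, ψ' ∈ C²(B) ∩ C(B̄), ψ' > 0 in B, ψ' = 0 on ∂B and Gψ' = λ_B ψ' in B, then ψ' = t ψ for some t > 0. (Classical-solution rendering of Theorem 3.1 on a ball.) -/

import Mathlib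

open Metric Set MeasureTheory

noncomputable def sdv {d : ℕ} (φ : EuclideanSpace ℝ (Fin d) → ℝ)
    (x : EuclideanSpace ℝ (Fin d)) (i j : Fin d) : ℝ :=
  fderiv ℝ (fun y => fderiv ℝ φ y (EuclideanSpace.single j 1)) x (EuclideanSpace.single i 1)

/-- The semilinear operator
`Gφ(x) = Σ_{i,j} a_{ij}(x) ∂²φ/∂x_i∂x_j(x) + inf_{u∈U} (b(x,u)·∇φ(x) + r(x,u) φ(x))`. -/
noncomputable def Gop {d : ℕ} {U : Type*}
    (a : EuclideanSpace ℝ (Fin d) → Matrix (Fin d) (Fin d) ℝ)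
    (b : EuclideanSpace ℝ (Fin d) → U → EuclideanSpace ℝ (Fin d))
    (r : EuclideanSpace ℝ (Fin d) → U → ℝ)
    (φ : EuclideanSpace ℝ (Fin d) → ℝ) (x : EuclideanSpace ℝ (Fin d)) : ℝ :=
  (∑ i, ∑ j, a x i j * sdv φ x i j)
    + ⨅ u : U, ((inner ℝ (b x u) (gradient φ x) : ℝ) + r x u * φ x)

/-- The quadratic form `zᵀ A z`. -/
noncomputable def quadForm {d : ℕ}
    (A : Matrix (Fin d) (Fin d) ℝ) (z : EuclideanSpace ℝ (Fin d)) : ℝ :=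
  ∑ i, ∑ j, z i * A i j * z j

namespace DPE
open Filter Topology
set_option linter.all false
open scoped ContDiff NNReal
variable {d : ℕ}
local notation "EE" => EuclideanSpace ℝ (Fin d)
local notation "EL" => EuclideanSpace ℝ (Fin d) →L[ℝ] ℝ
local notation "EB" => EuclideanSpace ℝ (Fin d) →L[ℝ] EuclideanSpace ℝ (Fin d) →L[ℝ] ℝ
local notation "MM" => Matrix (Fin d) (Fin d) ℝ
local notation:max "N(" x ")" => norm x
local notation "Df" => fderiv ℝ
local notation "pv" => (by positivity)
local notation "lna" => (by linarith)
local notation "nnu" => (by norm_num)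
local notation "smp" => (by simp)
lemma mll {a b c : ℝ} (h : b ≤ c) (k : 0 ≤ a) : a * b ≤ a * c := mul_le_mul_of_nonneg_left h k
lemma mlr {a b c : ℝ} (h : b ≤ c) (k : 0 ≤ a) : b * a ≤ c * a := mul_le_mul_of_nonneg_right h k
lemma nea (r : ℝ) : N(r) = |r| := rfl
lemma ldi {a b c : ℝ} (h : 0 < c) : a ≤ b / c ↔ a * c ≤ b := le_div_iff₀ h
noncomputable scoped instance j1 : NormedSpace ℝ EL := inferInstance
noncomputable scoped instance j2 : NormedSpace ℝ EB := inferInstance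
scoped instance j3 : ContinuousSMul ℝ EE := inferInstance
scoped instance j4 : ContinuousSMul ℝ EL := inferInstance
scoped instance j5 : T2Space EE := inferInstance
scoped instance j6 : T2Space EL := inferInstance
scoped instance j7 : T2Space EB := inferInstance
noncomputable scoped instance j8 : NormedSpace ℝ EE := inferInstance
noncomputable scoped instance k1 : NormedAddCommGroup EL := inferInstance
noncomputable scoped instance k2 : NormedAddCommGroup EB := inferInstance
noncomputable scoped instance k3 : Norm EL := inferInstance
noncomputable scoped instance k4 : Norm EB := inferInstance
noncomputable scoped instance k5 : SeminormedAddGroup EL := inferInstance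
noncomputable scoped instance k6 : SeminormedAddGroup EB := inferInstance
noncomputable scoped instance k7 : NormedAddGroup EB := inferInstance
noncomputable scoped instance k8 : MeasureSpace EE := inferInstance
scoped instance k9 : ProperSpace EE := inferInstance
scoped instance k10 : ContinuousAdd EE := inferInstance
noncomputable scoped instance k11 : SeminormedAddCommGroup EB := inferInstance
section
variable {F E : Type*} [NormedAddCommGroup F] [NormedSpace ℝ F] [NormedAddCommGroup E] [NormedSpace ℝ E]
lemma csub : ContinuousSub (F →L[ℝ] E) := inferInstance
lemma cadd : ContinuousAdd (F →L[ℝ] E) := inferInstance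
lemma csm : ContinuousSMul ℝ (F →L[ℝ] E) := inferInstance
lemma nsc : NormSMulClass ℝ (F →L[ℝ] E) := inferInstance
lemma lim_n {f : ℕ → F →L[ℝ] E} {l : F →L[ℝ] E} {G : Filter ℕ} [G.NeBot] {c B : ℝ} (h : Tendsto f G (𝓝 l)) (hb : ∀ k, N(f k) * c ≤ B) : N(l) * c ≤ B :=
  le_of_tendsto ((h.norm).mul_const c) (Eventually.of_forall hb)
lemma lim_ns {f g : ℕ → F →L[ℝ] E} {l m : F →L[ℝ] E} {G : Filter ℕ} [G.NeBot] {c B : ℝ} (h : Tendsto f G (𝓝 l)) (h' : Tendsto g G (𝓝 m))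
    (hb : ∀ k, N(f k - g k) * c ≤ B) : N(l - m) * c ≤ B :=
  le_of_tendsto (((h.sub h').norm).mul_const c) (Eventually.of_forall hb)
lemma cont_of_holder {x : F} {f : F → F →L[ℝ] E} {c r : ℝ} (hr : 0 < r) (h : ∀ y, N(y - x) ≤ r → N(f y - f x) ≤ c * √N(y - x)) : ContinuousAt f x := by
  rw [ContinuousAt, tendsto_iff_norm_sub_tendsto_zero]
  refine squeeze_zero' (g := fun y => c * √N(y - x)) (Eventually.of_forall fun _ => norm_nonneg _) ?_ ?_
  · filter_upwards [closedBall_mem_nhds x hr] with y hy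
    exact h y (by simpa [dist_eq_norm] using hy)
  · have := (by fun_prop : Continuous fun y : F => c * √N(y - x)).tendsto x
    simpa using this
lemma fdb [FiniteDimensional ℝ F] [FiniteDimensional ℝ E] : ProperSpace (F →L[ℝ] E) := FiniteDimensional.proper_real (F →L[ℝ] E)
lemma smsb (c : ℝ) (M N : F →L[ℝ] E) : c • (M - N) = c • M - c • N := smul_sub c M N
end
scoped instance i1 : ContinuousSub EB := csub
scoped instance i2 : ContinuousAdd EB := cadd
scoped instance i3 : ContinuousSMul ℝ EB := csm
scoped instance i6 : ProperSpace EL := fdb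
scoped instance i5 : ProperSpace EB := fdb
scoped instance i4 : NormSMulClass ℝ EB := nsc
noncomputable def D2 (u : EE → ℝ) (x : EE) : EB :=
  Df (Df u) x
noncomputable abbrev ee (i : Fin d) : EE := EuclideanSpace.single i 1
noncomputable def tr (A : MM) (M : EB) : ℝ :=
  ∑ i, ∑ j, A i j * M (ee i) (ee j)
noncomputable def lap (u : EE → ℝ) (x : EE) : ℝ := ∑ i, D2 u x (ee i) (ee i)
noncomputable def pd (ξ : EE) (f : EE → ℝ) : EE → ℝ := fun z => Df f z ξ
structure Ker (k : EE → ℝ) : Prop where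
  smooth : ContDiff ℝ ∞ k
  supp : ∀ z, 1 < N(z) → k z = 0
lemma Ker.cs {k : EE → ℝ} (h : Ker k) : HasCompactSupport k :=
  HasCompactSupport.intro (isCompact_closedBall 0 1) fun z hz => h.supp z (by simpa using hz)
lemma Ker.cd {k : EE → ℝ} (h : Ker k) (n : ℕ) : ContDiff ℝ n k := h.smooth.of_le (by exact_mod_cast le_top)
lemma Ker.pd {k : EE → ℝ} (h : Ker k) (ξ : EE) : Ker (pd ξ k) where
  smooth := (h.smooth.fderiv_right (m := ∞) smp).clm_apply contDiff_const
  supp z hz := by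
    have : k =ᶠ[𝓝 z] fun _ => 0 := by
      filter_upwards [(isOpen_lt continuous_const continuous_norm).mem_nhds hz] with y hy
      exact h.supp y hy
    simp [DPE.pd, this.fderiv_eq]
lemma Ker.integrable {k : EE → ℝ} (h : Ker k) {g : EE → ℝ} (hg : Continuous g) :
    Integrable (fun z => k z * g z) :=
  (h.smooth.continuous.mul hg).integrable_of_hasCompactSupport (h.cs.mul_right)
lemma pd_comm {k : EE → ℝ} (h : ContDiff ℝ 2 k) (ξ η : EE) : pd ξ (pd η k) = pd η (pd ξ k) := by
  funext z
  have h1 : Differentiable ℝ (Df k) := (h.fderiv_right (m := 1) nnu).differentiable nnu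
  have key : ∀ a b : EE, pd a (pd b k) z = Df (Df k) z a b := fun a b => by
    unfold pd
    rw [fderiv_clm_apply (h1 z) (by fun_prop)]; simp
  rw [key, key]
  exact (h.contDiffAt.isSymmSndFDerivAt smp).eq ξ η
lemma pd_pd {k : EE → ℝ} (h : ContDiff ℝ 2 k) (ξ η z : EE) : pd ξ (pd η k) z = D2 k z ξ η := by
  have h1 : Differentiable ℝ (Df k) := (h.fderiv_right (m := 1) nnu).differentiable nnu
  unfold pd D2
  rw [fderiv_clm_apply (h1 z) (by fun_prop)]; simp
lemma D2_symm {k : EE → ℝ} {z : EE} (h : ContDiffAt ℝ 2 k z) (ξ η : EE) :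
    D2 k z ξ η = D2 k z η ξ := (h.isSymmSndFDerivAt smp).eq ξ η
lemma Ker.ibp {k : EE → ℝ} (h : Ker k) {V : EE → ℝ} (hV : ContDiff ℝ 1 V) (ξ : EE) :
    ∫ z, k z * DPE.pd ξ V z = - ∫ z, DPE.pd ξ k z * V z := by
  have hc : Continuous (DPE.pd ξ V) := by
    unfold DPE.pd; exact (hV.continuous_fderiv nnu).clm_apply continuous_const
  exact integral_mul_fderiv_eq_neg_fderiv_mul_of_integrable
    ((h.pd ξ).integrable hV.continuous) (h.integrable hc) (h.integrable hV.continuous)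
    (fun x _ => h.smooth.differentiable smp x) (fun x _ => hV.differentiable nnu x)
lemma contDiff_pd {V : EE → ℝ} {n : ℕ} (hV : ContDiff ℝ (n+1) V) (ξ : EE) : ContDiff ℝ n (pd ξ V) := by
  unfold pd; exact (hV.fderiv_right (m := n) nnu).clm_apply contDiff_const
lemma Ker.ibp2 {k : EE → ℝ} (h : Ker k) {V : EE → ℝ} (hV : ContDiff ℝ 2 V) (ξ η : EE) :
    ∫ z, k z * D2 V z ξ η = ∫ z, DPE.pd η (DPE.pd ξ k) z * V z := by
  have h1 : ContDiff ℝ 1 (DPE.pd η V) := contDiff_pd (n := 1) (by exact_mod_cast hV) η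
  simp_rw [← pd_pd hV]
  rw [h.ibp h1, (h.pd ξ).ibp (hV.of_le nnu)]; simp
lemma sum_ee (z : EE) : ∑ i, z i • ee i = z := by
  simpa [EuclideanSpace.basisFun_apply] using (EuclideanSpace.basisFun (Fin d) ℝ).sum_repr z
lemma pd_lin (f : EE → ℝ) (z ξ : EE) : Df f z ξ = ∑ i, ξ i * pd (ee i) f z := by
  conv_lhs => rw [← sum_ee ξ]
  simp [pd]
def Pair (j : ℕ) (k m : EE → ℝ) : Prop :=
  ∀ z, lap m z = - Df k z z - (d + j) * k z
lemma Pair.pd {j : ℕ} {k m : EE → ℝ} (hk : Ker k) (hm : Ker m) (h : Pair j k m) (ξ : EE) :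
    Pair (j+1) (pd ξ k) (pd ξ m) := by
  intro z
  have hle : ∀ {f : EE → ℝ}, Ker f → ∀ n : ℕ, ContDiff ℝ n f := fun hf n => hf.smooth.of_le (by exact_mod_cast le_top)
  have e1 : lap (DPE.pd ξ m) z = Df (lap m) z ξ := by
    have : lap m = fun z => ∑ i, DPE.pd (ee i) (DPE.pd (ee i) m) z := by
      funext z; simp [lap, pd_pd (hle hm 2)]
    rw [this, fderiv_fun_sum (fun i _ => ((hm.pd _).pd _).smooth.differentiable smp z)]
    simp only [lap, ContinuousLinearMap.coe_sum', Finset.sum_apply]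
    refine Finset.sum_congr rfl fun i _ => ?_
    rw [← pd_pd (hle (hm.pd ξ) 2), pd_comm (hle hm 2) (ee i) ξ, pd_comm (hle (hm.pd _) 2)]; rfl
  have hdk : Differentiable ℝ (Df k) := ((hle hk 2).fderiv_right (m := 1) nnu).differentiable nnu
  have e2 : lap m = fun z => - Df k z z - (d + j) * k z := funext h
  have e3 : HasFDerivAt (fun z => - Df k z z - (d + j) * k z)
     (-((Df k z).comp (ContinuousLinearMap.id ℝ _) + (Df (Df k) z).flip z) - ((d:ℝ)+j) • Df k z) z :=
    (((hdk z).hasFDerivAt.clm_apply (hasFDerivAt_id z)).neg).sub (((hle hk 1).differentiable nnu z).hasFDerivAt.const_mul _)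
  rw [e1, e2, e3.fderiv]
  have e4 : Df (DPE.pd ξ k) z z = Df (Df k) z z ξ := by
    have := pd_pd (hle hk 2) z ξ z
    simpa [DPE.pd, D2] using this
  have e5 := D2_symm (hle hk 2).contDiffAt z ξ (z := z)
  simp only [D2] at e5
  rw [e4, e5]; simp [DPE.pd]; ring
lemma Ker.hasDerivAt_avg {k : EE → ℝ} (h : Ker k) {U : EE → ℝ} (hU : ContDiff ℝ 1 U) (x : EE) (t : ℝ) :
    HasDerivAt (fun t : ℝ => ∫ z, k z * U (x + t • z)) (∫ z, k z * Df U (x + t • z) z) t := by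
  have hfd : Continuous (Df U) := hU.continuous_fderiv nnu
  obtain ⟨M, hM⟩ := (isCompact_closedBall x (|t| + 1)).exists_bound_of_continuousOn hfd.continuousOn
  refine (hasDerivAt_integral_of_dominated_loc_of_deriv_le (bound := fun z => |k z| * M)
    (F := fun t z => k z * U (x + t • z)) (F' := fun t z => k z * Df U (x + t • z) z)
    (ball_mem_nhds t one_pos) ?_ ?_ ?_ ?_ ?_ ?_).2
  · exact Filter.Eventually.of_forall fun s => ((h.integrable (hU.continuous.comp (by fun_prop))).aestronglyMeasurable)
  · exact h.integrable (hU.continuous.comp (by fun_prop))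
  · exact (h.integrable ((hfd.comp (by fun_prop : Continuous fun z : EE => x + t • z)).clm_apply continuous_id)).aestronglyMeasurable
  · refine Filter.Eventually.of_forall fun z s hs => ?_
    rw [norm_mul, nea]
    rcases lt_or_ge 1 N(z) with hz | hz
    · simp [h.supp z hz]
    · gcongr
      have hs' : |s| ≤ |t| + 1 := by
        have := abs_sub_abs_le_abs_sub s t
        rw [mem_ball, Real.dist_eq] at hs; linarith
      have : N(Df U (x + s • z)) ≤ M := hM _ (by
        simp only [mem_closedBall, dist_self_add_left, norm_smul, nea]
        nlinarith only [hs', hz, norm_nonneg z, abs_nonneg s])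
      calc _ ≤ N(Df U (x + s • z)) * N(z) := ContinuousLinearMap.le_opNorm _ _
        _ ≤ M * 1 := by gcongr; exact (norm_nonneg _).trans this
        _ = M := mul_one _
  · exact (h.smooth.continuous.abs.mul continuous_const).integrable_of_hasCompactSupport
      (h.cs.abs.mul_right)
  · refine Filter.Eventually.of_forall fun z s _ => ?_
    have h1 : HasDerivAt (fun s : ℝ => x + s • z) z s := by
      simpa using ((hasDerivAt_id s).smul_const z).const_add x
    exact ((hU.differentiable nnu _).hasFDerivAt.comp_hasDerivAt s h1).const_mul _
lemma fderiv_aff {U : EE → ℝ} {x : EE} (L : EE →L[ℝ] EE) {z : EE}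
    (hU : DifferentiableAt ℝ U (x + L z)) :
    Df (fun z => U (x + L z)) z = (Df U (x + L z)).comp L := by
  have : HasFDerivAt (fun z => x + L z) L z := by simpa using L.hasFDerivAt.const_add x
  exact (hU.hasFDerivAt.comp z this).fderiv
lemma D2_aff {U : EE → ℝ} {x : EE} (L : EE →L[ℝ] EE) {z : EE}
    (hU : ContDiffAt ℝ 2 U (x + L z)) (ξ η : EE) :
    D2 (fun z => U (x + L z)) z ξ η = D2 U (x + L z) (L ξ) (L η) := by
  have hL : HasFDerivAt (fun z => x + L z) L z := by simpa using L.hasFDerivAt.const_add x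
  have e : Df (fun z => U (x + L z)) =ᶠ[𝓝 z] fun z => (Df U (x + L z)).comp L := by
    have := hL.continuousAt.eventually ((hU.eventually smp))
    filter_upwards [this] with y hy
    exact fderiv_aff L (hy.differentiableAt nnu)
  have h2 : DifferentiableAt ℝ (Df U) (x + L z) :=
    (hU.fderiv_right (m := 1) nnu).differentiableAt nnu
  have h3 : HasFDerivAt (fun z => (Df U (x + L z))) ((D2 U (x + L z)).comp L) z :=
    h2.hasFDerivAt.comp z hL
  have h4 := h3.clm_comp (hasFDerivAt_const L z)
  unfold D2; rw [e.fderiv_eq, h4.fderiv]; simp [D2]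
lemma smul_id_apply (t : ℝ) (z : EE) : (t • ContinuousLinearMap.id ℝ EE) z = t • z := by simp
lemma D2_smul {U : EE → ℝ} {x : EE} (t : ℝ) {z : EE}
    (hU : ContDiffAt ℝ 2 U (x + t • z)) (ξ η : EE) :
    D2 (fun z => U (x + t • z)) z ξ η = t ^ 2 * D2 U (x + t • z) ξ η := by
  have := D2_aff (U := U) (x := x) (t • ContinuousLinearMap.id ℝ EE) (z := z) (by simpa using hU) ξ η
  simp only [smul_id_apply] at this
  rw [this]; simp; ring
lemma fderiv_smulx {U : EE → ℝ} {x : EE} (t : ℝ) {z : EE}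
    (hU : DifferentiableAt ℝ U (x + t • z)) (ξ : EE) :
    Df (fun z => U (x + t • z)) z ξ = t * Df U (x + t • z) ξ := by
  have := fderiv_aff (U := U) (x := x) (t • ContinuousLinearMap.id ℝ EE) (z := z) (by simpa using hU)
  simp only [smul_id_apply] at this
  rw [this]; simp
lemma cont_D2 {U : EE → ℝ} (hU : ContDiff ℝ 2 U) : Continuous (D2 U) :=
  (hU.fderiv_right (m := 1) nnu).continuous_fderiv nnu
lemma Ker.lemmaK {j : ℕ} {k m : EE → ℝ} (hk : Ker k) (hm : Ker m) (hp : Pair j k m)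
    {U : EE → ℝ} (hU : ContDiff ℝ 2 U) (x : EE) {t : ℝ} (ht : 0 < t) :
    HasDerivAt (fun t : ℝ => (t ^ j)⁻¹ * ∫ z, k z * U (x + t • z))
      (t * (t ^ j)⁻¹ * ∫ z, m z * lap U (x + t • z)) t := by
  set V : EE → ℝ := fun z => U (x + t • z) with hV
  have cV : ContDiff ℝ 2 V := hU.comp (by fun_prop)
  have cV1 : ContDiff ℝ 1 V := cV.of_le nnu
  have i0 : ∀ i : Fin d, Ker (fun z : EE => z i * k z) := fun i =>
    ⟨(by fun_prop : ContDiff ℝ ∞ fun z : EE => z i).mul hk.smooth, fun z hz => by simp [hk.supp z hz]⟩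
  have hpi : ∀ (i : Fin d) z, DPE.pd (ee i) (fun z : EE => z i * k z) z = k z + z i * DPE.pd (ee i) k z := by
    intro i z
    have h1 : HasFDerivAt (fun z : EE => z i) (EuclideanSpace.proj i : EL) z :=
      (EuclideanSpace.proj i : EL).hasFDerivAt
    have := (h1.fun_mul (hk.smooth.differentiable smp z).hasFDerivAt).fderiv
    simp only [DPE.pd]; rw [this]; simp [ee]; ring
  have cpd : ∀ i : Fin d, Continuous (DPE.pd (ee i) V) := fun i => (contDiff_pd (n := 1) (by exact_mod_cast cV) _).continuous
  have e1 : t * ∫ z, k z * Df U (x + t • z) z = - ∫ z, (Df k z z + d * k z) * V z := by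
    calc t * ∫ z, k z * Df U (x + t • z) z = ∫ z, ∑ i : Fin d, (z i * k z) * DPE.pd (ee i) V z := by
          rw [← integral_const_mul]; congr 1; funext z
          have h1 : Df V z z = _ := fderiv_smulx t (hU.differentiable nnu _) z
          have h2 := pd_lin V z z
          rw [h1] at h2
          rw [mul_left_comm, h2, Finset.mul_sum]; exact Finset.sum_congr rfl fun i _ => by ring
      _ = ∑ i : Fin d, ∫ z, (z i * k z) * DPE.pd (ee i) V z :=
          integral_finsetSum _ fun i _ => (i0 i).integrable (cpd i)
      _ = ∑ i : Fin d, - ∫ z, (k z + z i * DPE.pd (ee i) k z) * V z := by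
          refine Finset.sum_congr rfl fun i _ => ?_
          rw [(i0 i).ibp cV1]; simp_rw [hpi]
      _ = _ := by
          rw [Finset.sum_neg_distrib, ← integral_finsetSum]
          · congr 2; funext z
            rw [pd_lin k z z, ← Finset.sum_mul, Finset.sum_add_distrib]
            simp only [Finset.sum_const, Finset.card_univ, Fintype.card_fin, nsmul_eq_mul]; ring
          · intro i _
            simp_rw [← hpi]
            exact ((i0 i).pd _).integrable cV.continuous
  have e2 : t ^ 2 * ∫ z, m z * lap U (x + t • z) = ∫ z, lap m z * V z := by
    calc t ^ 2 * ∫ z, m z * lap U (x + t • z) = ∫ z, ∑ i : Fin d, m z * D2 V z (ee i) (ee i) := by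
          rw [← integral_const_mul]; congr 1; funext z
          rw [mul_left_comm, lap, Finset.mul_sum, Finset.mul_sum]
          exact Finset.sum_congr rfl fun i _ => by rw [hV, D2_smul t hU.contDiffAt]
      _ = ∑ i : Fin d, ∫ z, m z * D2 V z (ee i) (ee i) :=
          integral_finsetSum _ fun i _ => hm.integrable (((cont_D2 cV).clm_apply continuous_const).clm_apply continuous_const)
      _ = ∑ i : Fin d, ∫ z, DPE.pd (ee i) (DPE.pd (ee i) m) z * V z := by simp_rw [hm.ibp2 cV]
      _ = _ := by
          rw [← integral_finsetSum _ fun i _ => ((hm.pd _).pd _).integrable cV.continuous]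
          congr 1; funext z
          rw [← Finset.sum_mul, lap]
          simp_rw [pd_pd (hm.cd 2)]
  have e3 : ∫ z, lap m z * V z = -(∫ z, (Df k z z + d * k z) * V z) - j * ∫ z, k z * V z := by
    have ik := hk.integrable cV.continuous
    have i1 : Integrable fun z => (Df k z z + d * k z) * V z := by
      have c1 : Continuous fun z => Df k z z :=
        (hk.smooth.continuous_fderiv smp).clm_apply continuous_id
      refine Continuous.integrable_of_hasCompactSupport
        ((c1.add (continuous_const.mul hk.smooth.continuous)).mul cV.continuous) ?_
      refine HasCompactSupport.intro (isCompact_closedBall 0 1) fun z hz => ?_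
      have hz' : 1 < N(z) := by simpa using hz
      simp [hk.supp z hz', (hk.pd z).supp z hz', show Df k z z = 0 from (hk.pd z).supp z hz']
    rw [← integral_const_mul, ← integral_neg, ← integral_sub (f := fun z => -((Df k z z + d * k z) * V z)) i1.neg (ik.const_mul _)]
    congr 1; funext z; rw [hp z]; ring
  have h0 := hk.hasDerivAt_avg (hU.of_le nnu) x t
  have h1 : HasDerivAt (fun t : ℝ => (t ^ j)⁻¹) (-(j * t ^ (j-1)) / (t ^ j) ^ 2) t := (hasDerivAt_pow j t).inv pv
  refine (h1.mul h0).congr_deriv ?_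
  have e4 : ∫ z, k z * Df U (x + t • z) z = t⁻¹ * -(∫ z, (Df k z z + d * k z) * V z) := by
    rw [← e1]; field_simp
  have e5 : ∫ z, m z * lap U (x + t • z) = (t^2)⁻¹ * ∫ z, lap m z * V z := by rw [← e2]; field_simp
  rw [e4, e5, e3]
  rcases j with _ | j
  · simp; (clear * - ht; field_simp)
  · simp only [Nat.add_sub_cancel]; push_cast; field_simp; ring
section
lemma exists_kernel (hd : 1 ≤ d) : ∃ φ Ψ : EE → ℝ, Ker φ ∧ Ker Ψ ∧ Pair 0 φ Ψ ∧ (∀ z, 0 ≤ φ z) ∧ ∫ z, φ z = 1 := by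
  set st := Real.smoothTransition
  have hst : ContDiff ℝ ∞ st := Real.smoothTransition.contDiff
  have hst' : ContDiff ℝ ∞ (deriv st) := ((contDiff_infty_iff_deriv (𝕜 := ℝ)).1 hst).2
  set φ : EE → ℝ := fun z => deriv st (1 - N(z) ^ 2) with hφ
  set Ψ : EE → ℝ := fun z => (1/2) * st (1 - N(z) ^ 2) with hΨ
  have hn : ContDiff ℝ ∞ fun z : EE => 1 - N(z) ^ 2 := contDiff_const.sub (contDiff_norm_sq ℝ)
  have k1 : Ker φ := ⟨hst'.comp hn, fun z hz => by
    have : st =ᶠ[𝓝 (1 - N(z) ^ 2)] fun _ => 0 := by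
      filter_upwards [Iio_mem_nhds (show 1 - N(z)^2 < 0 by nlinarith only [hz])] with y hy
      exact Real.smoothTransition.zero_of_nonpos (le_of_lt hy)
    simp [hφ, this.deriv_eq]⟩
  have k2 : Ker Ψ := ⟨contDiff_const.mul (hst.comp hn), fun z hz => by
    have : st (1 - N(z) ^ 2) = 0 := Real.smoothTransition.zero_of_nonpos (by nlinarith only [hz])
    simp [hΨ, this]⟩
  have hD : ∀ z ξ : EE, DPE.pd ξ Ψ z = -(inner ℝ z ξ * φ z) := by
    intro z ξ
    have h1 : HasFDerivAt (fun z : EE => 1 - N(z) ^ 2) (-(2 • innerSL ℝ z)) z := by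
      simpa using (hasStrictFDerivAt_norm_sq z).hasFDerivAt.const_sub 1
    have h2 := (((hst.differentiable smp _).hasDerivAt.comp_hasFDerivAt z h1).const_mul (1/2)).fderiv
    simp only [DPE.pd]; erw [h2]; simp [hφ]; ring
  have hp : Pair 0 φ Ψ := by
    intro z
    have e : ∀ i : Fin d, D2 Ψ z (ee i) (ee i) = -(φ z + z i * DPE.pd (ee i) φ z) := by
      intro i
      rw [← pd_pd (k2.cd 2)]
      have h0 : DPE.pd (ee i) Ψ = fun z => -(z i * φ z) := by
        funext z; rw [hD]; simp [ee, EuclideanSpace.inner_single_right]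
      have h1 : HasFDerivAt (fun z : EE => z i) (EuclideanSpace.proj i : EL) z :=
        (EuclideanSpace.proj i : EL).hasFDerivAt
      have := (h1.fun_mul (k1.smooth.differentiable smp z).hasFDerivAt).fun_neg.fderiv
      rw [h0]; simp only [DPE.pd]; rw [this]; simp [ee]; ring
    rw [lap, pd_lin φ z z]; simp_rw [e]
    rw [Finset.sum_neg_distrib, Finset.sum_add_distrib]; simp; ring
  have hnn : ∀ z, 0 ≤ φ z := fun z => Real.smoothTransition.monotone.deriv_nonneg
  have hpos : 0 < ∫ z, φ z := by
    obtain ⟨c, hc, hc'⟩ := exists_deriv_eq_slope st (zero_lt_one) hst.continuous.continuousOn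
      (hst.differentiable smp).differentiableOn
    refine k1.smooth.continuous.integral_pos_of_hasCompactSupport_nonneg_nonzero k1.cs hnn
      (x := (√(1-c)) • ee ⟨0, hd⟩) ?_
    have : N((√(1-c)) • ee (⟨0, hd⟩ : Fin d)) ^ 2 = 1 - c := by
      rw [norm_smul, mul_pow, nea, sq_abs, Real.sq_sqrt (by linarith [hc.2])]; simp
    simp only [hφ]; rw [this, sub_sub_cancel, hc']
    simp [st, Real.smoothTransition.zero, Real.smoothTransition.one]
  set c := ∫ z, φ z
  refine ⟨fun z => c⁻¹ * φ z, fun z => c⁻¹ * Ψ z, ⟨contDiff_const.mul k1.smooth, fun z hz => by simp [k1.supp z hz]⟩,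
    ⟨contDiff_const.mul k2.smooth, fun z hz => by simp [k2.supp z hz]⟩, ?_, fun z => mul_nonneg pv (hnn z), ?_⟩
  · intro z
    have h1 : ∀ {k : EE → ℝ}, Ker k → Df (fun z => c⁻¹ * k z) = fun z => c⁻¹ • Df k z := fun hk =>
      funext fun z => fderiv_const_mul (hk.smooth.differentiable smp z) _
    have h2 : D2 (fun z => c⁻¹ * Ψ z) z = c⁻¹ • D2 Ψ z := by
      unfold D2; rw [h1 k2]
      exact fderiv_fun_const_smul (((k2.cd 2).fderiv_right (m := 1) nnu).differentiable nnu z) _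
    have := hp z
    simp only [lap] at this ⊢
    simp only [h2, h1 k1, smul_apply, smul_eq_mul, ← Finset.mul_sum, this]; ring
  · rw [integral_const_mul]; exact inv_mul_cancel₀ hpos.ne'
lemma Ker.bd {k : EE → ℝ} (h : Ker k) {g : EE → ℝ} {N : ℝ} (hg : ∀ z, N(z) ≤ 1 → |g z| ≤ N) :
    |∫ z, k z * g z| ≤ (∫ z, |k z|) * N := by
  rw [← integral_mul_const]
  rw [← nea]
  refine norm_integral_le_of_norm_le ((h.smooth.continuous.integrable_of_hasCompactSupport (μ := volume) h.cs).abs.mul_const N) (.of_forall fun z => ?_)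
  rw [norm_mul, nea]
  rcases lt_or_ge 1 N(z) with hz | hz
  · simp [h.supp z hz]
  · gcongr; exact hg z hz
lemma Ker.int_pd {k : EE → ℝ} (h : Ker k) (ξ : EE) : ∫ z, DPE.pd ξ k z = 0 := by
  have := h.ibp (V := fun _ => 1) contDiff_const ξ
  simp [DPE.pd] at this; exact this
lemma Ker.tendsto {k : EE → ℝ} (h : Ker k) {g : EE → ℝ} (hg : Continuous g) (x : EE) :
    Tendsto (fun t : ℝ => ∫ z, k z * g (x + t • z)) (𝓝[>] 0) (𝓝 ((∫ z, k z) * g x)) := by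
  have h1 : Continuous fun t : ℝ => ∫ z in closedBall (0 : EE) 1, k z * g (x + t • z) := by
    refine continuous_parametric_integral_of_continuous (f := fun (t : ℝ) (z : EE) => k z * g (x + t • z)) ?_ (isCompact_closedBall 0 1)
    have := h.smooth.continuous
    exact (this.comp continuous_snd).mul (hg.comp (by fun_prop))
  have h2 : ∀ t : ℝ, ∫ z in closedBall (0 : EE) 1, k z * g (x + t • z) = ∫ z, k z * g (x + t • z) := fun t =>
    setIntegral_eq_integral_of_forall_compl_eq_zero fun z hz => by rw [h.supp z (by simpa using hz), zero_mul]
  simp_rw [h2] at h1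
  have := (h1.tendsto 0).mono_left (nhdsWithin_le_nhds (s := Ioi 0))
  simpa [integral_mul_const] using this
lemma cmp {f f' B B' : ℝ → ℝ} {a b : ℝ} (hab : a ≤ b) (hf : ∀ t ∈ Icc a b, HasDerivAt f (f' t) t)
    (hB : ∀ t ∈ Icc a b, HasDerivAt B (B' t) t) (h : ∀ t ∈ Icc a b, |f' t| ≤ B' t) : |f b - f a| ≤ B b - B a := by
  refine image_norm_le_of_norm_deriv_right_le_deriv_boundary' (f := fun t => f t - f a) (B := fun t => B t - B a)
    (f' := f') (B' := B') (a := a) (b := b)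
    (fun t ht => ((hf t ht).continuousAt.sub continuousAt_const).continuousWithinAt)
    (fun t ht => ((hf t ⟨ht.1, ht.2.le⟩).sub_const _).hasDerivWithinAt) smp
    (fun t ht => ((hB t ht).continuousAt.sub continuousAt_const).continuousWithinAt)
    (fun t ht => ((hB t ⟨ht.1, ht.2.le⟩).sub_const _).hasDerivWithinAt)
    (fun t ht => h t ⟨ht.1, ht.2.le⟩) ⟨hab, le_rfl⟩
lemma cmp0 {f f' B B' : ℝ → ℝ} {b l : ℝ} (hb : 0 < b) (hf : ∀ t ∈ Ioc 0 b, HasDerivAt f (f' t) t)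
    (hB : ∀ t ∈ Ioc 0 b, HasDerivAt B (B' t) t) (h : ∀ t ∈ Ioc 0 b, |f' t| ≤ B' t)
    (hl : Tendsto f (𝓝[>] 0) (𝓝 l)) (hB0 : Tendsto B (𝓝[>] 0) (𝓝 0)) : |f b - l| ≤ B b := by
  have h1 : Tendsto (fun a => |f b - f a|) (𝓝[>] 0) (𝓝 |f b - l|) := (tendsto_const_nhds.sub hl).abs
  have h2 : Tendsto (fun a => B b - B a) (𝓝[>] 0) (𝓝 (B b - 0)) := tendsto_const_nhds.sub hB0
  rw [sub_zero] at h2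
  refine le_of_tendsto_of_tendsto h1 h2 ?_
  filter_upwards [Ioc_mem_nhdsGT hb] with a ha
  have : ∀ t ∈ Icc a b, t ∈ Ioc 0 b := fun t ht => ⟨ha.1.trans_le ht.1, ht.2⟩
  exact cmp ha.2 (fun t ht => hf t (this t ht)) (fun t ht => hB t (this t ht)) (fun t ht => h t (this t ht))
lemma cont_lap {U : EE → ℝ} (hU : ContDiff ℝ 2 U) : Continuous (lap U) := by
  unfold lap
  exact continuous_finsetSum _ fun i _ => ((cont_D2 hU).clm_apply continuous_const).clm_apply continuous_const
lemma Ker.shift {k : EE → ℝ} (h : Ker k) : ∃ c, 0 ≤ c ∧ ∀ (g : EE → ℝ) (t N : ℝ) (x y : EE), Continuous g → 0 < t → N(y) ≤ t →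
    (∀ z, N(z) ≤ 2 * t → |g (x + z)| ≤ N) → |∫ z, k z * (g (x + t • z) - g (x + y + t • z))| ≤ c * (N(y) / t) * N := by
  obtain ⟨L, hL⟩ := ContDiff.lipschitzWith_of_hasCompactSupport h.cs (h.cd 1) nnu
  refine ⟨L * volume.real (closedBall (0 : EE) 2), by positivity, fun g t N x y hg ht hy hN => ?_⟩
  have c1 : Continuous fun z : EE => g (x + t • z) := hg.comp (by fun_prop)
  have c2 : Continuous fun z : EE => g (x + y + t • z) := hg.comp (by fun_prop)
  have e1 : ∫ z, k z * g (x + y + t • z) = ∫ z, k (z - t⁻¹ • y) * g (x + t • z) := by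
    rw [← integral_sub_right_eq_self (fun z => k z * g (x + y + t • z)) (t⁻¹ • y)]
    congr 1; funext z; congr 2
    rw [smul_sub, smul_smul, mul_inv_cancel₀ ht.ne', one_smul]; abel
  have i1 := h.integrable c1
  have i2 : Integrable fun z => k (z - t⁻¹ • y) * g (x + t • z) := by
    have := (h.integrable c2).comp_sub_right (t⁻¹ • y)
    refine this.congr (.of_forall fun z => ?_)
    simp only []; congr 2
    rw [smul_sub, smul_smul, mul_inv_cancel₀ ht.ne', one_smul]; abel
  have e2 : ∫ z, k z * (g (x + t • z) - g (x + y + t • z)) = ∫ z, (k z - k (z - t⁻¹ • y)) * g (x + t • z) := by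
    simp_rw [mul_sub, sub_mul]
    rw [integral_sub i1 (h.integrable c2), integral_sub i1 i2, e1]
  have hty : N(t⁻¹ • y) = N(y) / t := by rw [norm_smul, norm_inv, Real.norm_of_nonneg ht.le, inv_mul_eq_div]
  have hty1 : N(t⁻¹ • y) ≤ 1 := by rw [hty]; exact (div_le_one ht).2 hy
  rw [e2]
  have e3 : ∫ z, (k z - k (z - t⁻¹ • y)) * g (x + t • z) = ∫ z in closedBall (0 : EE) 2, (k z - k (z - t⁻¹ • y)) * g (x + t • z) := by
    symm; refine setIntegral_eq_integral_of_forall_compl_eq_zero fun z hz => ?_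
    have hz : 2 < N(z) := by simpa using hz
    have := norm_sub_norm_le z (t⁻¹ • y)
    rw [h.supp z lna, h.supp (z - t⁻¹ • y) lna]; simp
  rw [e3]
  have := norm_setIntegral_le_of_norm_le_const (μ := volume) (s := closedBall (0 : EE) 2) (C := L * (N(y) / t) * N)
    (f := fun z => (k z - k (z - t⁻¹ • y)) * g (x + t • z)) (measure_closedBall_lt_top) (fun z hz => by
      rw [norm_mul]
      have h1 := hL.norm_sub_le z (z - t⁻¹ • y)
      rw [sub_sub_cancel, hty] at h1
      have h2 : |g (x + t • z)| ≤ N := hN _ (by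
        rw [norm_smul, Real.norm_of_nonneg ht.le, mul_comm]; gcongr; simpa using hz)
      gcongr; exact h2)
  calc _ ≤ _ := this
    _ = _ := by ring
lemma lap_est1 (hd : 1 ≤ d) (ξ η : EE) : ∃ C, 0 ≤ C ∧ ∀ (U : EE → ℝ) (M H : ℝ), ContDiff ℝ 2 U → 0 ≤ M → 0 ≤ H →
    (∀ z, N(z) ≤ 1 → |U z| ≤ M) → (∀ y z, N(y) ≤ 1 → N(z) ≤ 1 → |lap U y - lap U z| ≤ H * √N(y - z)) →
    |D2 U 0 ξ η| ≤ C * (M + H) ∧ ∀ y, N(y) ≤ 1/4 → |D2 U y ξ η - D2 U 0 ξ η| ≤ C * (M + H) * √N(y) := by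
  obtain ⟨φ, Ψ, hφ, hΨ, hp, -, h1⟩ := exists_kernel hd
  have hp2 := Pair.pd (hφ.pd ξ) (hΨ.pd ξ) (Pair.pd hφ hΨ hp ξ) η
  set k := DPE.pd η (DPE.pd ξ φ)
  set m := DPE.pd η (DPE.pd ξ Ψ)
  have hk : Ker k := (hφ.pd ξ).pd η
  have hm : Ker m := (hΨ.pd ξ).pd η
  have hm0 : ∫ z, m z = 0 := (hΨ.pd ξ).int_pd η
  obtain ⟨ck, hck, sk⟩ := hk.shift
  obtain ⟨cm, hcm, sm⟩ := hm.shift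
  set c := ∫ z, |m z|
  set c0 := ∫ z, |k z|
  have hc : 0 ≤ c := integral_nonneg fun z => abs_nonneg _
  have hc0 : 0 ≤ c0 := integral_nonneg fun z => abs_nonneg _
  refine ⟨c0 + 4 * c + 8 * ck + 4 * cm, by clear * - hck hcm; positivity, fun U M H hU hM hH hUM hUH => ?_⟩
  set f : EE → ℝ → ℝ := fun x t => (t ^ 2)⁻¹ * ∫ z, k z * U (x + t • z) with hf
  have hder : ∀ x t, 0 < t → HasDerivAt (f x) (t * (t ^ 2)⁻¹ * ∫ z, m z * lap U (x + t • z)) t := fun x t ht =>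
    Ker.lemmaK hk hm hp2 hU x ht
  have clap := cont_lap hU
  have hlim : ∀ x, Tendsto (f x) (𝓝[>] 0) (𝓝 (D2 U x ξ η)) := by
    intro x
    have := hφ.tendsto (((cont_D2 hU).clm_apply continuous_const).clm_apply continuous_const : Continuous fun z => D2 U z ξ η) x
    rw [h1, one_mul] at this
    refine this.congr' ?_
    filter_upwards [self_mem_nhdsWithin] with t ht
    have ht : 0 < t := ht
    have e := hφ.ibp2 (V := fun z => U (x + t • z)) (hU.comp (by fun_prop)) ξ η
    simp_rw [D2_smul t hU.contDiffAt] at e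
    simp only [hf]; rw [← e]
    rw [← integral_const_mul]; congr 1; funext z; (clear * - ht; field_simp)
  have hsq : ∀ (b t : ℝ), 0 < t → HasDerivAt (fun t => b * √t) (b * (1 / (2 * √t))) t := fun b t ht =>
    (Real.hasDerivAt_sqrt ht.ne').const_mul b
  have A : ∀ x R, 0 < R → (∀ z, N(z) ≤ R → |lap U (x + z) - lap U x| ≤ H * √N(z)) → |f x R - D2 U x ξ η| ≤ 2 * c * H * √R := by
    intro x R hR hx
    refine cmp0 hR (fun t ht => hder x t ht.1) (fun t ht => hsq (2 * c * H) t ht.1) (fun t ht => ?_) (hlim x) ?_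
    · have ht0 := ht.1
      have e : ∫ z, m z * lap U (x + t • z) = ∫ z, m z * (lap U (x + t • z) - lap U x) := by
        simp_rw [mul_sub]
        rw [integral_sub (hm.integrable (by fun_prop)) (hm.integrable continuous_const), integral_mul_const, hm0]; simp
      have b := hm.bd (g := fun z => lap U (x + t • z) - lap U x) (N := H * √t) (fun z hz => by
        have hn : N(t • z) ≤ t := by rw [norm_smul, Real.norm_of_nonneg ht0.le]; nlinarith only [ht0, hz]
        refine (hx (t • z) (hn.trans ht.2)).trans ?_
        gcongr)
      rw [e, abs_mul, abs_of_pos (show 0 < t * (t^2)⁻¹ by positivity)]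
      have hst : √t * √t = t := Real.mul_self_sqrt ht0.le
      have hs0 : 0 < √t := Real.sqrt_pos.2 ht0
      calc t * (t^2)⁻¹ * _ ≤ t * (t^2)⁻¹ * (c * (H * √t)) := by gcongr
        _ = _ := by field_simp; rw [sq, hst]; ring
    · have : Tendsto (fun t => 2 * c * H * √t) (𝓝 0) (𝓝 (2 * c * H * √0)) := (Real.continuous_sqrt.const_mul _).tendsto 0
      rw [Real.sqrt_zero, mul_zero] at this
      exact this.mono_left nhdsWithin_le_nhds
  have hM1 : 0 ≤ ck * M := by positivity
  refine ⟨?_, fun y hy => ?_⟩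
  · have h2 := A 0 1 one_pos (fun z hz => by simpa using hUH z 0 hz smp)
    have h3 : |f 0 1| ≤ c0 * M := by
      simp only [hf, one_pow, inv_one, one_mul]; exact hk.bd (fun z hz => hUM _ (by simpa using hz))
    rw [Real.sqrt_one, mul_one] at h2
    have h4 : |D2 U 0 ξ η| ≤ |f 0 1| + |f 0 1 - D2 U 0 ξ η| := by
      have := abs_sub (f 0 1) (f 0 1 - D2 U 0 ξ η); rwa [sub_sub_cancel] at this
    have : 0 ≤ c * M := by positivity
    have : 0 ≤ c * H := by positivity
    have : 0 ≤ c0 * H := by positivity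
    have : 0 ≤ ck * H := by positivity
    have : 0 ≤ cm * H := by positivity
    have : 0 ≤ cm * M := by positivity
    linarith
  · rcases eq_or_ne y 0 with rfl | hy0
    · simp
    set ρ := N(y)
    have hρ : 0 < ρ := norm_pos_iff.2 hy0
    have a1 := A 0 ρ hρ (fun z hz => by simpa using hUH z 0 lna smp)
    have a2 := A y ρ hρ (fun z hz => by
      simpa using hUH (y + z) y (by have := norm_add_le y z; linarith) lna)
    have hsub : ∀ t : ℝ, 0 < t → ∀ (q g : EE → ℝ), Ker q → Continuous g → (∫ z, q z * g (0 + t • z)) - ∫ z, q z * g (y + t • z) = ∫ z, q z * (g (0 + t • z) - g (0 + y + t • z)) := by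
      intro t ht q g hq hg
      rw [← integral_sub (hq.integrable (by fun_prop)) (hq.integrable (by fun_prop))]
      simp [mul_sub]
    have a3 : |f 0 (1/2) - f y (1/2)| ≤ 8 * ck * M * ρ := by
      simp only [hf]; rw [← mul_sub, hsub _ nnu _ _ hk hU.continuous, abs_mul]
      have := sk U (1/2) M 0 y hU.continuous nnu lna (fun z hz => by simpa using hUM z lna)
      norm_num at this ⊢
      linarith only [this]
    have a4 : |(f 0 (1/2) - f y (1/2)) - (f 0 ρ - f y ρ)| ≤ (-(4 * cm * H * ρ) / √(1/2)) - (-(4 * cm * H * ρ) / √ρ) := by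
      refine cmp (f := fun t => f 0 t - f y t) (B := fun t => -(4 * cm * H * ρ) / √t) (by linarith only [hy, hρ])
        (fun t ht => (hder 0 t (hρ.trans_le ht.1)).sub (hder y t (hρ.trans_le ht.1)))
        (fun t ht => (((Real.hasDerivAt_sqrt (hρ.trans_le ht.1).ne').inv (Real.sqrt_pos.2 (hρ.trans_le ht.1)).ne').const_mul (-(4 * cm * H * ρ))))
        (fun t ht => ?_)
      have ht0 : 0 < t := hρ.trans_le ht.1
      rw [← mul_sub, hsub _ ht0 _ _ hm clap, abs_mul, abs_of_pos (show 0 < t * (t^2)⁻¹ by positivity)]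
      have := sm (fun z => lap U z - lap U 0) t (H * √(2 * t)) 0 y (by fun_prop) ht0 ht.1 (fun z hz => by
        rw [zero_add]
        refine (hUH z 0 (by have := ht.2; linarith) smp).trans ?_
        rw [sub_zero]; gcongr)
      simp only [sub_sub_sub_cancel_right] at this
      have hst : √t * √t = t := Real.mul_self_sqrt ht0.le
      have hs0 : 0 < √t := Real.sqrt_pos.2 ht0
      have h2 : √(2 * t) ≤ 2 * √t := by
        rw [Real.sqrt_mul nnu]; gcongr
        rw [Real.sqrt_le_left nnu]; norm_num
      calc t * (t^2)⁻¹ * _ ≤ t * (t^2)⁻¹ * (cm * (ρ / t) * (H * (2 * √t))) := by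
            refine mll (this.trans ?_) pv; (clear * - h2 hH hcm hy0 ht0; gcongr)
        _ = _ := by
          field_simp
          rw [show √t ^ 4 = (√t * √t)^2 by ring, hst]; ring
    have hsr : √ρ * √ρ = ρ := Real.mul_self_sqrt hρ.le
    have hs0 : 0 < √ρ := Real.sqrt_pos.2 hρ
    have hs1 : √ρ ≤ 1 := Real.sqrt_le_one.2 (by linarith only [hy, hρ])
    have a5 : -(-(4 * cm * H * ρ) / √ρ) = 4 * cm * H * √ρ := by field_simp; rw [sq, hsr]
    have a6 : -(4 * cm * H * ρ) / √(1/2) ≤ 0 := div_nonpos_of_nonpos_of_nonneg (by simp; positivity) pv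
    have a7 : 8 * ck * M * ρ ≤ 8 * ck * M * √ρ := by
      gcongr; nlinarith only [hsr, hs0, hs1]
    have key : |D2 U y ξ η - D2 U 0 ξ η| ≤ 4 * c * H * √ρ + 8 * ck * M * √ρ + 4 * cm * H * √ρ := by
      rw [abs_le] at a1 a2 a3 a4 ⊢
      constructor <;> linarith only [a1, a2, a3, a4, a5, a6, a7]
    refine key.trans ?_
    have : 0 ≤ c * M * √ρ := by clear * - hM hy0; positivity
    have : 0 ≤ c0 * H * √ρ := by clear * - hH hy0; positivity
    have : 0 ≤ c0 * M * √ρ := by clear * - hM hy0; positivity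
    have : 0 ≤ ck * H * √ρ := by positivity
    have : 0 ≤ cm * M * √ρ := by positivity
    linarith
lemma norm_le_entries (L : EB) {c : ℝ} (hc : 0 ≤ c) (h : ∀ i j, |L (ee i) (ee j)| ≤ c) :
    N(L) ≤ d ^ 2 * c := by
  have hz : ∀ (z : EE) i, |z i| ≤ N(z) := fun z i => PiLp.norm_apply_le z i
  refine L.opNorm_le_bound₂ pv fun x y => ?_
  have e : L x y = ∑ i, ∑ j, x i * (y j * L (ee i) (ee j)) := by
    conv_lhs => rw [← sum_ee x, ← sum_ee y]
    simp [Finset.mul_sum, mul_left_comm]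
    exact Finset.sum_comm
  rw [e]
  calc N(∑ i, ∑ j, x i * (y j * L (ee i) (ee j))) ≤ ∑ i : Fin d, ∑ j : Fin d, N(x) * (N(y) * c) := by
        refine norm_sum_le_of_le _ fun i _ => norm_sum_le_of_le _ fun j _ => ?_
        rw [norm_mul, norm_mul]; gcongr
        · exact hz x i
        · exact hz y j
        · exact h i j
    _ = _ := by simp; ring
lemma lap_est (hd : 1 ≤ d) : ∃ C, 0 ≤ C ∧ ∀ (U : EE → ℝ) (M H : ℝ), ContDiff ℝ 2 U → 0 ≤ M → 0 ≤ H →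
    (∀ z, N(z) ≤ 1 → |U z| ≤ M) → (∀ y z, N(y) ≤ 1 → N(z) ≤ 1 → |lap U y - lap U z| ≤ H * √N(y - z)) →
    N(D2 U 0) ≤ C * (M + H) ∧ ∀ y, N(y) ≤ 1/4 → N(D2 U y - D2 U 0) ≤ C * (M + H) * √N(y) := by
  choose C hC h using fun i j : Fin d => lap_est1 hd (ee i) (ee j)
  have hle : ∀ i j, C i j ≤ ∑ i, ∑ j, C i j := fun i j =>
    (Finset.single_le_sum (f := fun j => C i j) (fun j _ => hC i j) (Finset.mem_univ j)).trans
      (Finset.single_le_sum (f := fun i => ∑ j, C i j) (fun i _ => Finset.sum_nonneg fun j _ => hC i j) (Finset.mem_univ i))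
  have hS : 0 ≤ ∑ i, ∑ j, C i j := Finset.sum_nonneg fun i _ => Finset.sum_nonneg fun j _ => hC i j
  refine ⟨d ^ 2 * ∑ i, ∑ j, C i j, by positivity, fun U M H hU hM hH h1 h2 => ⟨?_, fun y hy => ?_⟩⟩
  · rw [mul_assoc]
    exact norm_le_entries _ pv fun i j => ((h i j U M H hU hM hH h1 h2).1).trans (by gcongr; exact hle i j)
  · rw [mul_assoc, mul_assoc]
    refine norm_le_entries _ pv fun i j => ?_
    rw [← mul_assoc]
    exact ((h i j U M H hU hM hH h1 h2).2 y hy).trans (by gcongr; exact hle i j)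
end
section
structure Coef (a : EE → MM) (K C : ℝ) : Prop where
  hC : 1 ≤ C
  hK : 0 ≤ K
  lip : ∀ x y i j, |a x i j - a y i j| ≤ K * N(x - y)
  symm : ∀ x, (a x).IsSymm
  ell : ∀ x z, C⁻¹ * N(z) ^ 2 ≤ quadForm (a x) z ∧ quadForm (a x) z ≤ C * N(z) ^ 2
lemma psd_root {A : MM} (hA : A.IsSymm) (h : ∀ z, 0 ≤ quadForm A z) :
    ∃ S : EE →L[ℝ] EE, (∀ z, N(S z) ^ 2 = quadForm A z) ∧
      ∀ M, tr A M = ∑ k, M (S (ee k)) (S (ee k)) := by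
  have hps : A.PosSemidef := by
    refine Matrix.PosSemidef.of_dotProduct_mulVec_nonneg (by rw [Matrix.IsHermitian, Matrix.conjTranspose_eq_transpose_of_trivial]; exact hA) fun x => ?_
    refine (h (WithLp.toLp 2 x)).trans_eq ?_
    simp [quadForm, dotProduct, Matrix.mulVec, Finset.mul_sum, mul_assoc]
  obtain ⟨Q, hQs, hQ⟩ : ∃ Q : MM, Q.IsHermitian ∧ Q * Q = A := by
    open scoped MatrixOrder Matrix.Norms.L2Operator in
    exact ⟨CFC.sqrt A, (Matrix.nonneg_iff_posSemidef.1 (CFC.sqrt_nonneg A)).isHermitian, CFC.sqrt_mul_sqrt_self _ hps.nonneg⟩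
  have hQs' : ∀ i j, Q i j = Q j i := fun i j => by
    have := congrFun (congrFun hQs j) i; simpa using this
  set S : EE →L[ℝ] EE := Matrix.toEuclideanCLM (𝕜 := ℝ) Q with hS
  have hSi : ∀ z i, S z i = ∑ j, Q i j * z j := fun z i => rfl
  have hA' : ∀ i j, A i j = ∑ k, Q k i * Q k j := fun i j => by
    rw [← hQ, Matrix.mul_apply]; exact Finset.sum_congr rfl fun k _ => by rw [hQs' i k]
  refine ⟨S, fun z => ?_, fun M => ?_⟩
  · rw [EuclideanSpace.real_norm_sq_eq]
    simp only [hSi, quadForm, hA', sq, Finset.sum_mul_sum, Finset.mul_sum, Finset.sum_mul]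
    rw [Finset.sum_comm]
    refine Finset.sum_congr rfl fun i _ => ?_
    rw [Finset.sum_comm]
    exact Finset.sum_congr rfl fun j _ => Finset.sum_congr rfl fun k _ => by ring
  · have h1 : ∀ k, S (ee k) = ∑ i, Q k i • ee i := fun k => by
      conv_lhs => rw [← sum_ee (S (ee k))]
      exact Finset.sum_congr rfl fun i _ => by rw [hSi, hQs' k i]; simp [ee]
    have h2 : ∀ k, M (S (ee k)) (S (ee k)) = ∑ i, ∑ j, Q k i * Q k j * M (ee i) (ee j) := fun k => by
      rw [h1]
      simp only [map_sum, map_smul, FunLike.coe_sum, Finset.sum_apply, smul_apply, smul_eq_mul, Finset.mul_sum]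
      rw [Finset.sum_comm]
      exact Finset.sum_congr rfl fun i _ => Finset.sum_congr rfl fun j _ => by ring
    simp only [h2, tr, hA', Finset.sum_mul]
    symm
    rw [Finset.sum_comm]
    refine Finset.sum_congr rfl fun i _ => ?_
    rw [Finset.sum_comm]
lemma root {A : MM} {C : ℝ} (hC : 1 ≤ C) (hA : A.IsSymm)
    (h : ∀ z, C⁻¹ * N(z) ^ 2 ≤ quadForm A z ∧ quadForm A z ≤ C * N(z) ^ 2) :
    ∃ S S' : EE →L[ℝ] EE, (∀ z, N(S z) ≤ √C * N(z)) ∧ (∀ z, N(S' z) ≤ √C * N(z)) ∧ (∀ z, S (S' z) = z) ∧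
      ∀ M, tr A M = ∑ k, M (S (ee k)) (S (ee k)) := by
  have hC0 : 0 < C := by linarith
  obtain ⟨S, hn, hS⟩ := psd_root hA fun z => le_trans pv (h z).1
  have hup : ∀ z, N(S z) ≤ √C * N(z) := fun z => by
    rw [← Real.sqrt_sq (norm_nonneg (S z)), ← Real.sqrt_sq (norm_nonneg z), ← Real.sqrt_mul hC0.le]
    exact Real.sqrt_le_sqrt (by rw [hn]; exact (h z).2)
  have hlo : ∀ z, N(z) ≤ √C * N(S z) := fun z => by
    rw [← Real.sqrt_sq (norm_nonneg (S z)), ← Real.sqrt_sq (norm_nonneg z), ← Real.sqrt_mul hC0.le]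
    refine Real.sqrt_le_sqrt ?_
    have := (h z).1
    rw [hn]
    rwa [inv_mul_le_iff₀ hC0] at this
  have hinj : Function.Injective S := (injective_iff_map_eq_zero S).2 fun z hz => by
    have := hlo z; rw [hz] at this; simpa using this
  set e := LinearEquiv.ofInjectiveEndo (S : EE →ₗ[ℝ] EE) hinj with he
  have hes : ∀ z, S (e.symm z) = z := fun z => LinearEquiv.apply_symm_apply e z
  refine ⟨S, LinearMap.toContinuousLinearMap (e.symm : EE →ₗ[ℝ] EE), hup, fun z => ?_, hes, hS⟩
  have := hlo (e.symm z); rw [hes] at this; exact this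
lemma tr_bd {A : MM} {c : ℝ} (h : ∀ i j, |A i j| ≤ c) (M : EB) :
    |tr A M| ≤ d ^ 2 * c * N(M) := by
  rw [← nea]
  calc N(tr A M) ≤ ∑ i : Fin d, ∑ j : Fin d, c * (N(M) * 1 * 1) := by
        unfold tr
        refine norm_sum_le_of_le _ fun i _ => norm_sum_le_of_le _ fun j _ => ?_
        rw [norm_mul]
        have := M.le_opNorm₂ (ee i) (ee j)
        simp only [ee, PiLp.norm_single, norm_one] at this
        exact mul_le_mul (h i j) this (norm_nonneg _) ((abs_nonneg _).trans (h i j))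
    _ = _ := by simp; ring
lemma tr_sub (A : MM) (M N : EB) : tr A (M - N) = tr A M - tr A N := by
  simp [tr, mul_sub, Finset.sum_sub_distrib]
lemma tr_add (A : MM) (M N : EB) : tr A (M + N) = tr A M + tr A N := by
  simp [tr, mul_add, Finset.sum_add_distrib]
lemma tr_smul (A : MM) (c : ℝ) (M : EB) : tr A (c • M) = c * tr A M := by
  simp [tr, Finset.mul_sum, mul_left_comm]
lemma tr_sub' (A B : MM) (M : EB) : tr (A - B) M = tr A M - tr B M := by
  simp [tr, sub_mul, Finset.sum_sub_distrib]
lemma Coef.tr_bd {a : EE → MM} {K C : ℝ} (h : Coef a K C) (x : EE) (M : EB) :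
    |tr (a x) M| ≤ d * C * N(M) := by
  obtain ⟨S, S', h1, h2, h3, h4⟩ := root h.hC (h.symm x) (h.ell x)
  have hC := h.hC
  rw [h4]
  calc |∑ k, M (S (ee k)) (S (ee k))| ≤ ∑ k : Fin d, N(M) * √C * √C := by
        refine norm_sum_le_of_le _ fun k _ => (M.le_opNorm₂ _ _).trans ?_
        have := h1 (ee k); simp only [ee, PiLp.norm_single, norm_one, mul_one] at this
        (clear * - this hC; gcongr)
    _ = _ := by simp only [Finset.sum_const, Finset.card_univ, Fintype.card_fin, nsmul_eq_mul, mul_assoc]; rw [Real.mul_self_sqrt lna]; ring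
lemma glob {u : EE → ℝ} {x : EE} {r' r : ℝ} (h0 : 0 < r') (h : r' < r) (hu : ContDiffOn ℝ 2 u (ball x r)) :
    ∃ U : EE → ℝ, ContDiff ℝ 2 U ∧ HasCompactSupport U ∧ ∀ y ∈ ball x r', U =ᶠ[𝓝 y] u := by
  let f : ContDiffBump x := ⟨r', (r' + r) / 2, h0, by linarith⟩
  refine ⟨fun y => f y * u y, contDiff_iff_contDiffAt.2 fun y => ?_, f.hasCompactSupport.mul_right, fun y hy => ?_⟩
  · by_cases hy : y ∈ ball x r
    · exact f.contDiff.contDiffAt.mul ((hu.contDiffAt (isOpen_ball.mem_nhds hy)))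
    · have : (fun y => f y * u y) =ᶠ[𝓝 y] fun _ => 0 := by
        have hy' : y ∈ (closedBall x ((r' + r) / 2))ᶜ := fun h2 => hy (by simp at h2 ⊢; linarith)
        filter_upwards [isClosed_closedBall.isOpen_compl.mem_nhds hy'] with z hz
        rw [f.zero_of_le_dist (by simp at hz; exact hz.le), zero_mul]
      exact contDiffAt_const.congr_of_eventuallyEq this
  · filter_upwards [isOpen_ball.mem_nhds hy] with z hz
    rw [f.one_of_mem_closedBall (ball_subset_closedBall hz), one_mul]
lemma D2_congr {u v : EE → ℝ} {x : EE} (h : u =ᶠ[𝓝 x] v) : D2 u x = D2 v x := h.fderiv.fderiv_eq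
lemma frozen (hd : 1 ≤ d) {K C : ℝ} (hK : 0 ≤ K) (hC : 1 ≤ C) : ∃ C1, 0 ≤ C1 ∧
    ∀ (a : EE → MM), Coef a K C → ∀ (u : EE → ℝ) (x : EE) (T r M H : ℝ), 0 < T → T * √C < r → ContDiffOn ℝ 2 u (ball x r) → 0 ≤ M → 0 ≤ H →
    (∀ y, N(y - x) ≤ T * √C → |u y| ≤ M) →
    (∀ y z, N(y - x) ≤ T * √C → N(z - x) ≤ T * √C → |tr (a x) (D2 u y) - tr (a x) (D2 u z)| ≤ H * √N(y - z)) →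
    T ^ 2 * N(D2 u x) ≤ C1 * (M + T ^ 2 * √T * H) ∧
    ∀ y, N(y - x) ≤ T / (4 * √C) → T ^ 2 * N(D2 u y - D2 u x) ≤ C1 * (M + T ^ 2 * √T * H) * √(N(y - x) / T) := by
  obtain ⟨Cl, hCl, hl⟩ := lap_est hd
  have hs1 : 1 ≤ √C := Real.one_le_sqrt.2 hC
  have hss : √C * √C = C := Real.mul_self_sqrt lna
  have hs2 : √(√C) ≤ √C := Real.sqrt_le_iff.2 ⟨by positivity, by nlinarith only [hC, hss, hs1]⟩
  refine ⟨Cl * C * C, by positivity, fun a ha u x T r M H hT hTr hu hM hH h1 h2 => ?_⟩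
  obtain ⟨S, S', hS, hS', hSS, htr⟩ := root ha.hC (ha.symm x) (ha.ell x)
  have hr' : T * √C < (T * √C + r) / 2 := by linarith
  obtain ⟨V, hV, -, hVu⟩ := glob (r' := (T * √C + r) / 2) (by linarith [show 0 < T * √C by positivity]) lna hu
  have hD : ∀ y, N(y - x) ≤ T * √C → D2 V y = D2 u y := fun y hy =>
    D2_congr (hVu y (by rw [mem_ball, dist_eq_norm]; linarith only [hTr, hy]))
  have hVe : ∀ y, N(y - x) ≤ T * √C → V y = u y := fun y hy =>
    (hVu y (by rw [mem_ball, dist_eq_norm]; linarith only [hTr, hy])).eq_of_nhds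
  set L := T • S with hLd
  have hL : ∀ z, N(L z) ≤ T * √C * N(z) := fun z => by
    simp only [hLd, smul_apply, norm_smul, Real.norm_of_nonneg hT.le, mul_assoc]; gcongr; exact hS z
  have hL1 : ∀ z, N(z) ≤ 1 → N(x + L z - x) ≤ T * √C := fun z hz => by
    rw [add_sub_cancel_left]; refine (hL z).trans ?_
    exact mul_le_of_le_one_right pv hz
  have hcW : ContDiff ℝ 2 fun z => V (x + L z) := hV.comp (by fun_prop)
  have hDW : ∀ z ξ η, D2 (fun z => V (x + L z)) z ξ η = D2 V (x + L z) (L ξ) (L η) := fun z ξ η => D2_aff L hV.contDiffAt ξ η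
  have hlap : ∀ z, N(z) ≤ 1 → lap (fun z => V (x + L z)) z = T ^ 2 * tr (a x) (D2 u (x + L z)) := fun z hz => by
    simp only [lap, hDW, hD _ (hL1 z hz), htr, Finset.mul_sum]
    exact Finset.sum_congr rfl fun k _ => by simp [hLd]; ring
  have hsT : √(T * √C) ≤ √T * √C := by
    rw [Real.sqrt_mul hT.le]; gcongr
  obtain ⟨e1, e2⟩ := hl (fun z => V (x + L z)) M (T ^ 2 * (H * (√T * √C))) hcW hM pv
    (fun z hz => by rw [hVe _ (hL1 z hz)]; exact h1 _ (hL1 z hz)) (fun y z hy hz => by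
      rw [hlap y hy, hlap z hz, ← mul_sub, abs_mul, abs_of_pos (show 0 < T ^ 2 by positivity), mul_assoc]
      gcongr
      refine (h2 _ _ (hL1 y hy) (hL1 z hz)).trans ?_
      rw [mul_assoc]; gcongr
      rw [add_sub_add_left_eq_sub, ← map_sub]
      calc √N(L (y - z)) ≤ √(T * √C * N(y - z)) := Real.sqrt_le_sqrt (hL _)
        _ = √(T * √C) * √N(y - z) := Real.sqrt_mul pv _
        _ ≤ _ := by clear * - hsT; gcongr)
  have hE : M + T ^ 2 * (H * (√T * √C)) ≤ √C * (M + T ^ 2 * √T * H) := by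
    have : M ≤ √C * M := le_mul_of_one_le_left hM hs1
    nlinarith only [this]
  have back : ∀ N W : EB, (∀ ξ η, W ξ η = N (L ξ) (L η)) → T ^ 2 * N(N) ≤ C * N(W) := by
    intro N W hW
    have : N(N) ≤ C * N(W) / T ^ 2 := by
      refine N.opNorm_le_bound₂ (by clear * - hC hT; positivity) fun ξ η => ?_
      have := hW (S' ξ) (S' η)
      simp only [hLd, smul_apply, hSS, map_smul, smul_eq_mul] at this
      have e : N ξ η = W (S' ξ) (S' η) / T ^ 2 := by rw [this]; (clear * - hT; field_simp)
      rw [e, norm_div, Real.norm_of_nonneg (show 0 ≤ T ^ 2 by positivity), div_mul_eq_mul_div, div_mul_eq_mul_div]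
      gcongr
      calc N(W (S' ξ) (S' η)) ≤ N(W) * (√C * N(ξ)) * (√C * N(η)) := (W.le_opNorm₂ _ _).trans (by gcongr; exact hS' ξ; exact hS' η)
        _ = (√C * √C) * N(W) * N(ξ) * N(η) := by ring
        _ = _ := by rw [hss]
    rwa [ldi pv, mul_comm] at this
  have hx0 : N(x - x) ≤ T * √C := by simp; positivity
  refine ⟨?_, fun y hy => ?_⟩
  · have := back (D2 u x) _ (fun ξ η => by rw [hDW 0]; simp [hD x hx0])
    refine this.trans ?_
    calc C * _ ≤ C * (Cl * (√C * (M + T ^ 2 * √T * H))) := by gcongr; exact e1.trans (by gcongr)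
      _ ≤ C * (Cl * (C * (M + T ^ 2 * √T * H))) := by gcongr; nlinarith only [hC, hss, hs1]
      _ = _ := by ring
  · set z := T⁻¹ • S' (y - x) with hz
    have hLz : x + L z = y := by simp [hLd, hz, smul_smul, hT.ne', hSS]
    have hzn : N(z) ≤ √C * (N(y - x) / T) := by
      rw [hz, norm_smul, norm_inv, Real.norm_of_nonneg hT.le, inv_mul_eq_div, ← mul_div_assoc]
      gcongr; exact hS' _
    have hyT : N(y - x) / T ≤ 1 / (4 * √C) := by rw [div_le_iff₀ hT]; exact hy.trans_eq (by ring)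
    have hz4 : N(z) ≤ 1 / 4 := hzn.trans (by
      calc √C * (N(y - x) / T) ≤ √C * (1 / (4 * √C)) := by gcongr
        _ = 1 / 4 := by field_simp)
    have hy1 : N(y - x) ≤ T * √C := by rw [← hLz]; exact hL1 z (by linarith only [hz4])
    have := back (D2 u y - D2 u x) (D2 (fun z => V (x + L z)) z - D2 (fun z => V (x + L z)) 0) (fun ξ η => by
      simp only [sub_apply, hDW, hLz, hD y hy1]; simp [hD x hx0])
    refine this.trans ?_
    have hq : √N(z) ≤ √C * √(N(y - x) / T) := (Real.sqrt_le_sqrt hzn).trans (by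
      rw [Real.sqrt_mul pv]; (clear * - hs2; gcongr))
    calc C * _ ≤ C * (Cl * (√C * (M + T ^ 2 * √T * H)) * (√C * √(N(y - x) / T))) := by
          gcongr; exact (e2 z hz4).trans (by clear * - hE hCl hq hC hM hT hH; gcongr)
      _ = Cl * C * (√C * √C) * (M + T ^ 2 * √T * H) * √(N(y - x) / T) := by ring
      _ = _ := by rw [hss]
end
section
lemma absorb {P : ℝ → Prop} {A B0 : ℝ} (hA : 0 ≤ A) (hB : 0 ≤ B0) (h0 : P B0) (hs : ∀ B, 0 ≤ B → P B → P (A + B / 2))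
    (hm : ∀ B B', B ≤ B' → P B → P B') : ∀ ε > 0, P (2 * A + ε) := by
  intro ε hε
  have h : ∀ n : ℕ, P (2 * A + B0 / 2 ^ n) := by
    intro n
    induction n with
    | zero => exact hm _ _ (by simp; linarith) h0
    | succ n ih => exact hm _ _ (by rw [pow_succ]; apply le_of_eq; field_simp; ring) (hs _ pv ih)
  obtain ⟨n, hn⟩ := exists_nat_gt (B0 / ε)
  refine hm _ _ ?_ (h n)
  have : (n : ℝ) < 2 ^ n := by exact_mod_cast Nat.lt_two_pow_self
  have : B0 / 2 ^ n ≤ ε := by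
    rw [div_le_iff₀ pv]
    rw [div_lt_iff₀ hε] at hn
    nlinarith only [hn, hε, this]
  linarith
lemma le_of_eps {X A S : ℝ} (h : ∀ ε > 0, X ≤ (A + ε) * S) : X ≤ A * S := by
  have ht : Tendsto (fun ε : ℝ => (A + ε) * S) (𝓝[>] 0) (𝓝 ((A + 0) * S)) :=
    ((continuous_const.add continuous_id).mul continuous_const).continuousAt.tendsto.mono_left nhdsWithin_le_nhds
  rw [add_zero] at ht
  exact ge_of_tendsto ht (eventually_mem_nhdsWithin.mono fun ε hε => h ε hε)
lemma nrm1 (M N : EB) : N(M) ≤ N(N) + N(M - N) := norm_le_norm_add_norm_sub' M N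
lemma nrm0 (M : EB) : 0 ≤ N(M) := norm_nonneg M
set_option maxHeartbeats 1000000 in
lemma schauder (hd : 1 ≤ d) {K C : ℝ} (hK : 0 ≤ K) (hC : 1 ≤ C) : ∃ A, 0 ≤ A ∧
    ∀ (a : EE → MM), Coef a K C → ∀ (u : EE → ℝ) (x0 : EE) (r M H : ℝ), 0 < r → r ≤ 1 → ContDiffOn ℝ 2 u (ball x0 r) → 0 ≤ H →
    (∃ Q, ∀ y ∈ ball x0 r, ∀ z ∈ ball x0 r, N(D2 u y - D2 u z) ≤ Q * √N(y - z)) →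
    (∀ y ∈ ball x0 r, |u y| ≤ M) →
    (∀ y ∈ ball x0 r, ∀ z ∈ ball x0 r, |tr (a y) (D2 u y) - tr (a z) (D2 u z)| ≤ H * √N(y - z)) →
    r ^ 2 * N(D2 u x0) ≤ A * (M + r ^ 2 * √r * H) ∧
    ∀ y, N(y - x0) ≤ r / 2 → r ^ 2 * √r * N(D2 u y - D2 u x0) ≤ A * (M + r ^ 2 * √r * H) * √N(y - x0) := by
  obtain ⟨C1, hC1, hf⟩ := frozen hd hK hC
  have hs1 : 1 ≤ √C := Real.one_le_sqrt.2 hC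
  have hss : √C * √C = C := Real.mul_self_sqrt lna
  obtain ⟨n, hn⟩ : ∃ n : ℝ, n = (d : ℝ) ^ 2 := ⟨_, rfl⟩
  have hn0 : 0 ≤ n := by rw [hn]; positivity
  obtain ⟨W, hW⟩ : ∃ W : ℝ, W = C1 * C ^ 2 := ⟨_, rfl⟩
  have hW0 : 0 ≤ W := by rw [hW]; positivity
  obtain ⟨N, hN⟩ : ∃ N : ℝ, N = 160 * n * K * W + 4 := ⟨_, rfl⟩
  have hN4 : 4 ≤ N := by rw [hN]; have : 0 ≤ 160 * n * K * W := by positivity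
                         linarith
  have hN0 : 0 < N := by linarith
  refine ⟨2 * (10 * W * N ^ 5), by positivity, fun a ha u x0 r M H hr hr1 hu hH hQ hM hL => ?_⟩
  obtain ⟨Q, hQ⟩ := hQ
  have hx0 : x0 ∈ ball x0 r := mem_ball_self hr
  have hM0 : 0 ≤ M := (abs_nonneg _).trans (hM x0 hx0)
  obtain ⟨D, hD⟩ : ∃ D : ℝ, D = M + r ^ 2 * √r * H := ⟨_, rfl⟩
  have hD0 : 0 ≤ D := by rw [hD]; positivity
  let P : ℝ → Prop := fun B => ∀ x, ∀ δ, 0 < δ → δ = r - N(x - x0) → δ ^ 2 * N(D2 u x) ≤ B ∧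
    ∀ y, N(y - x) ≤ δ / 2 → δ ^ 2 * √δ * N(D2 u y - D2 u x) ≤ B * √N(y - x)
  have hQ' : ∀ y ∈ ball x0 r, ∀ z ∈ ball x0 r, N(D2 u y - D2 u z) ≤ |Q| * √N(y - z) := fun y hy z hz =>
    (hQ y hy z hz).trans (by gcongr; exact le_abs_self Q)
  have hmem : ∀ x y δ, δ = r - N(x - x0) → N(y - x) < δ → y ∈ ball x0 r := fun x y δ h1 h2 => by
    rw [mem_ball, dist_eq_norm]; have := norm_sub_le_norm_sub_add_norm_sub y x x0; linarith
  have hP0 : P (N(D2 u x0) + 2 * |Q|) := by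
    intro x δ hδ hδx
    have hδ1 : δ ≤ 1 := by linarith [norm_nonneg (x - x0)]
    have hx : x ∈ ball x0 r := hmem x x δ hδx (by simpa)
    have hd2 : δ ^ 2 ≤ 1 := pow_le_one₀ hδ.le hδ1
    refine ⟨?_, fun y hy => ?_⟩
    · have h1 := hQ' x hx x0 hx0
      have h2 : √N(x - x0) ≤ 1 := Real.sqrt_le_one.2 lna
      have h3 : N(D2 u x) ≤ N(D2 u x0) + N(D2 u x - D2 u x0) := nrm1 _ _
      have h4 : |Q| * √N(x - x0) ≤ |Q| := mul_le_of_le_one_right (abs_nonneg _) h2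
      have h5 : δ ^ 2 * N(D2 u x) ≤ N(D2 u x) := mul_le_of_le_one_left (nrm0 _) hd2
      linarith [abs_nonneg Q]
    · have h1 := hQ' y (hmem x y δ hδx lna) x hx
      have h2 : √δ ≤ 1 := Real.sqrt_le_one.2 hδ1
      have h3 : δ ^ 2 * √δ ≤ 1 := mul_le_one₀ hd2 pv h2
      calc _ ≤ N(D2 u y - D2 u x) := mul_le_of_le_one_left (nrm0 _) h3
        _ ≤ |Q| * √N(y - x) := h1
        _ ≤ _ := by gcongr; linarith only [norm_nonneg (D2 u x0), abs_nonneg Q]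
  have hstep : ∀ B, 0 ≤ B → P B → P (10 * W * N ^ 5 * D + B / 2) := by
    intro B hB hPB
    obtain ⟨Y, hY⟩ : ∃ Y : ℝ, Y = D + 8 * n * K * B / N ^ 6 := ⟨_, rfl⟩
    have hY0 : 0 ≤ Y := by rw [hY]; (clear * - hD0 hn0 hK hB hN4; positivity)
    have hfin : 10 * W * N ^ 5 * Y ≤ 10 * W * N ^ 5 * D + B / 2 := by
      have e : 10 * W * N ^ 5 * Y = 10 * W * N ^ 5 * D + (80 * n * K * W / N) * B := by
        rw [hY]; field_simp; ring
      have : 80 * n * K * W / N ≤ 1 / 2 := by rw [div_le_iff₀ hN0]; linarith only [hN]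
      rw [e]; nlinarith only [this, hB]
    have key : ∀ x, ∀ δ, 0 < δ → δ = r - N(x - x0) → δ ^ 2 * N(D2 u x) ≤ C1 * C * N ^ 4 * Y ∧
        ∀ y, N(y - x) ≤ δ / (4 * C * N ^ 2) → δ ^ 2 * √δ * N(D2 u y - D2 u x) ≤ W * N ^ 5 * Y * √N(y - x) := by
      intro x δ hδ hδx
      have hδr : δ ≤ r := by linarith only [hδx, norm_nonneg (x - x0)]
      obtain ⟨T, hT⟩ : ∃ T, T = δ / (√C * N ^ 2) := ⟨_, rfl⟩
      have hT0 : 0 < T := by rw [hT]; positivity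
      have hδT : δ = T * √C * N ^ 2 := by rw [hT]; field_simp
      have hTC : T * √C = δ / N ^ 2 := by rw [hT]; field_simp
      have hN2 : δ / N ^ 2 ≤ δ / 16 := by gcongr; nlinarith only [hN4]
      have hsub : ball x δ ⊆ ball x0 r := fun y hy => hmem x y δ hδx (by rwa [mem_ball, dist_eq_norm] at hy)
      have hcl : ∀ y, N(y - x) ≤ T * √C → y ∈ ball x0 r := fun y hy => hmem x y δ hδx (by linarith only [hδ, hTC, hN2, hy])
      have hsδ : √δ = √T * √(√C) * N := by
        rw [hδT, Real.sqrt_mul pv, Real.sqrt_mul hT0.le, Real.sqrt_sq hN0.le]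
      have hss2 : √(√C) * √(√C) = √C := Real.mul_self_sqrt pv
      have hss1 : 1 ≤ √(√C) := Real.one_le_sqrt.2 hs1
      have hδ2 : δ ^ 2 = C * N ^ 4 * T ^ 2 := by rw [hδT, mul_pow, mul_pow, sq (√C), hss]; ring
      have hsδ0 : √δ * √δ = δ := Real.mul_self_sqrt hδ.le
      have hsδp : 0 < √δ := Real.sqrt_pos.2 hδ
      have hq : ∀ y z, N(y - x) ≤ T * √C → N(z - x) ≤ T * √C →
          |tr (a x) (D2 u y) - tr (a x) (D2 u z)| ≤ (H + 8 * n * K * B / N * (√δ / δ ^ 2)) * √N(y - z) := by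
        intro y z hy hz
        have hyz : N(y - z) ≤ 2 * (δ / N ^ 2) := by
          have := norm_sub_le_norm_sub_add_norm_sub y x z
          rw [norm_sub_rev x z] at this; linarith only [hTC, hy, hz, this]
        have h1 : δ ^ 2 * N(D2 u y) ≤ 2 * B := by
          obtain ⟨e1, e2⟩ := hPB x δ hδ hδx
          have e2 := e2 y (by linarith only [hδ, hTC, hN2, hy])
          have e3 : N(D2 u y) ≤ N(D2 u x) + N(D2 u y - D2 u x) := nrm1 _ _
          have e4 : B * √N(y - x) ≤ B * √δ := by gcongr; linarith only [hδ, hTC, hN2, hy]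
          have e5 : δ ^ 2 * N(D2 u y - D2 u x) ≤ B := by
            refine le_of_mul_le_mul_right ?_ hsδp
            calc _ = δ ^ 2 * √δ * N(D2 u y - D2 u x) := by ring
              _ ≤ _ := e2.trans e4
          nlinarith only [sq_nonneg δ, e1, e3, e5]
        have h2 : δ ^ 2 * √δ * N(D2 u y - D2 u z) ≤ 4 * B * √N(y - z) := by
          obtain ⟨δ', hδ'⟩ : ∃ δ', δ' = r - N(z - x0) := ⟨_, rfl⟩
          have e1 : N(z - x0) ≤ N(z - x) + N(x - x0) := norm_sub_le_norm_sub_add_norm_sub z x x0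
          have e2 : 15 / 16 * δ ≤ δ' := by linarith only [hδx, hTC, hN2, hz, hδ', e1]
          have e3 := (hPB z δ' (by linarith only [hδ, hδx, hTC, hN2, hz, hδ', e1]) hδ').2 y (by linarith only [hδ, hδx, hTC, hN2, hz, hyz, hδ', e1])
          have e4 : δ ^ 2 ≤ 2 * δ' ^ 2 := by nlinarith only [e2, hδ]
          have e5 : √δ ≤ 2 * √δ' := by
            rw [Real.sqrt_le_left pv, mul_pow, Real.sq_sqrt (by linarith only [hδ, hδx, hTC, hN2, hz, hδ', e1])]; linarith only [hδ, hδx, hTC, hN2, hz, hδ', e1]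
          calc _ ≤ (2 * δ' ^ 2) * (2 * √δ') * N(D2 u y - D2 u z) := by clear * - e4 e5 hδ; gcongr
            _ = 4 * (δ' ^ 2 * √δ' * N(D2 u y - D2 u z)) := by ring
            _ ≤ 4 * (B * √N(y - z)) := by gcongr
            _ = _ := by ring
        have h3 := hL y (hcl y hy) z (hcl z hz)
        have h4 : |tr (a y - a z) (D2 u y)| ≤ n * (K * N(y - z)) * N(D2 u y) := hn ▸ tr_bd (fun i j => ha.lip y z i j) _
        have h5 : |tr (a z - a x) (D2 u y - D2 u z)| ≤ n * (K * N(z - x)) * N(D2 u y - D2 u z) :=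
          hn ▸ tr_bd (fun i j => ha.lip z x i j) _
        have e : tr (a x) (D2 u y) - tr (a x) (D2 u z) = (tr (a y) (D2 u y) - tr (a z) (D2 u z)) - tr (a y - a z) (D2 u y)
            - tr (a z - a x) (D2 u y - D2 u z) := by simp only [tr_sub, tr_sub']; ring
        rw [e]
        have hs : N(y - z) ≤ √N(y - z) * (2 / N * √δ) := by
          have e1 : √N(y - z) ≤ 2 / N * √δ := by
            rw [Real.sqrt_le_left pv, mul_pow, Real.sq_sqrt hδ.le]
            refine hyz.trans ?_
            have : (2 / N) ^ 2 * δ = 4 * (δ / N ^ 2) := by field_simp; ring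
            rw [this]; linarith only [hδ, hN4, show 0 ≤ δ / N ^ 2 by positivity]
          calc N(y - z) = √N(y - z) * √N(y - z) := (Real.mul_self_sqrt (norm_nonneg _)).symm
            _ ≤ _ := by clear * - e1; gcongr
        have h4' : n * (K * N(y - z)) * N(D2 u y) ≤ 4 * n * K * B / N * (√δ / δ ^ 2) * √N(y - z) := by
          calc _ ≤ n * (K * (√N(y - z) * (2 / N * √δ))) * (2 * B / δ ^ 2) := by
                gcongr; rw [ldi pv]; linarith only [h1]
            _ = _ := by field_simp; ring
        have h5' : n * (K * N(z - x)) * N(D2 u y - D2 u z) ≤ 4 * n * K * B / N * (√δ / δ ^ 2) * √N(y - z) := by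
          have hzx : N(z - x) ≤ δ / N := (hz.trans_eq hTC).trans (by gcongr; nlinarith only [hN4])
          calc _ ≤ n * (K * (δ / N)) * (4 * B * √N(y - z) / (δ ^ 2 * √δ)) := by
                gcongr; rw [ldi pv]; linarith only [h2]
            _ = 4 * n * K * B / N * (δ / √δ / δ ^ 2) * √N(y - z) := by clear * - hδ hN4; field_simp
            _ = _ := by rw [Real.div_sqrt]
        have t1 := abs_sub (tr (a y) (D2 u y) - tr (a z) (D2 u z) - tr (a y - a z) (D2 u y)) (tr (a z - a x) (D2 u y - D2 u z))
        have t2 := abs_sub (tr (a y) (D2 u y) - tr (a z) (D2 u z)) (tr (a y - a z) (D2 u y))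
        have e' : (H + 8 * n * K * B / N * (√δ / δ ^ 2)) * √N(y - z) = H * √N(y - z) +
            4 * n * K * B / N * (√δ / δ ^ 2) * √N(y - z) + 4 * n * K * B / N * (√δ / δ ^ 2) * √N(y - z) := by ring
        rw [e']; linarith only [h3, h4, h5, h4', h5', t1, t2]
      obtain ⟨f1, f2⟩ := hf a ha u x T δ M _ hT0 (by linarith only [hδ, hTC, hN2]) (hu.mono hsub) hM0 (by clear * - hH hn0 hK hB hN4 hδ; positivity) (fun y hy => hM y (hcl y hy)) hq
      have hTT : N ^ 5 * (T ^ 2 * √T) ≤ δ ^ 2 * √δ := by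
        rw [hδ2, hsδ]
        have : (1 : ℝ) * 1 ≤ C * √(√C) := mul_le_mul hC hss1 zero_le_one (by linarith only [hC])
        have h0 : 0 ≤ N ^ 5 * (T ^ 2 * √T) := by positivity
        nlinarith only [this, h0]
      have hE : M + T ^ 2 * √T * (H + 8 * n * K * B / N * (√δ / δ ^ 2)) ≤ Y := by
        have e1 : T ^ 2 * √T ≤ δ ^ 2 * √δ / N ^ 5 := by rw [ldi pv]; linarith only [hTT]
        have e2 : T ^ 2 * √T ≤ r ^ 2 * √r := by
          refine e1.trans ((div_le_self pv (one_le_pow₀ (by linarith only [hN4]))).trans (by clear * - hδ hδr hr; gcongr))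
        have e3 : T ^ 2 * √T * (8 * n * K * B / N * (√δ / δ ^ 2)) ≤ 8 * n * K * B / N ^ 6 := by
          calc _ ≤ δ ^ 2 * √δ / N ^ 5 * (8 * n * K * B / N * (√δ / δ ^ 2)) := by clear * - e1 hn0 hK hB hN4 hδ; gcongr
            _ = 8 * n * K * B / N ^ 6 * (√δ * √δ) := by clear * - hδ hN4; field_simp
            _ ≤ 8 * n * K * B / N ^ 6 * 1 := by rw [hsδ0]; gcongr; linarith only [hr1, hδr]
            _ = _ := mul_one _
        rw [hY, hD]
        have : T ^ 2 * √T * H ≤ r ^ 2 * √r * H := by clear * - e2 hH; gcongr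
        linarith only [e3, this]
      refine ⟨?_, fun y hy => ?_⟩
      · calc δ ^ 2 * N(D2 u x) = C * N ^ 4 * (T ^ 2 * N(D2 u x)) := by rw [hδ2]; ring
          _ ≤ C * N ^ 4 * (C1 * Y) := mll (f1.trans (by clear * - hE hC1; gcongr)) pv
          _ = _ := by ring
      · have f2 := f2 y (hy.trans_eq (by rw [hT, div_div]; congr 1; rw [show √C * N ^ 2 * (4 * √C) = 4 * (√C * √C) * N ^ 2 by ring, hss]))
        calc δ ^ 2 * √δ * N(D2 u y - D2 u x) = C * N ^ 5 * √(√C) * √T * (T ^ 2 * N(D2 u y - D2 u x)) := by rw [hsδ, hδ2]; ring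
          _ ≤ C * N ^ 5 * C * √T * (C1 * Y * √(N(y - x) / T)) := by
            refine mul_le_mul ?_ (f2.trans (by clear * - hE hC1; gcongr)) (by clear * - hT0; positivity) pv
            gcongr
            rw [Real.sqrt_le_left (by linarith only [hC]), Real.sqrt_le_left pv]
            have := one_le_pow₀ (n := 3) hC
            nlinarith only [this, hC]
          _ = W * N ^ 5 * Y * (√T * √(N(y - x) / T)) := by rw [hW]; ring
          _ = _ := by rw [← Real.sqrt_mul hT0.le, mul_div_cancel₀ _ hT0.ne']
    have hX : C1 * C * N ^ 4 * Y ≤ W * N ^ 5 * Y := by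
      rw [hW]; gcongr
      · nlinarith only [hC]
      · linarith only [hN4]
      · norm_num
    have hX0 : 0 ≤ W * N ^ 5 * Y := by positivity
    intro x δ hδ hδx
    obtain ⟨k1, k2⟩ := key x δ hδ hδx
    refine ⟨by linarith only [hfin, hX, hX0, k1], fun y hy => ?_⟩
    by_cases hc : N(y - x) ≤ δ / (4 * C * N ^ 2)
    · refine (k2 y hc).trans ?_
      gcongr; linarith only [hfin, hX0]
    · push Not at hc
      obtain ⟨δ', hδ'⟩ : ∃ δ', δ' = r - N(y - x0) := ⟨_, rfl⟩
      have e1 := norm_sub_le_norm_sub_add_norm_sub y x x0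
      have e2 : δ / 2 ≤ δ' := by linarith only [hδx, hy, hδ', e1]
      have k3 := (key y δ' (by linarith only [hδ, hδx, hy, hδ', e1]) hδ').1
      have e3 : δ ^ 2 ≤ 4 * δ' ^ 2 := by nlinarith only [e2, hδ]
      have e4 : √δ ≤ 2 * C * N * √N(y - x) := by
        rw [Real.sqrt_le_left pv, mul_pow, Real.sq_sqrt (norm_nonneg _)]
        rw [div_lt_iff₀ pv] at hc
        have : N(y - x) * (4 * C * N ^ 2) ≤ N(y - x) * (4 * (C * C) * N ^ 2) := by gcongr; nlinarith only [hC]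
        nlinarith only [this, hc]
      have e5 : δ ^ 2 * N(D2 u y - D2 u x) ≤ 5 * (C1 * C * N ^ 4 * Y) := by
        have := norm_sub_le (D2 u y) (D2 u x)
        calc _ ≤ δ ^ 2 * (N(D2 u y) + N(D2 u x)) := by clear * - this hδ; gcongr
          _ = δ ^ 2 * N(D2 u y) + δ ^ 2 * N(D2 u x) := by ring
          _ ≤ 4 * δ' ^ 2 * N(D2 u y) + δ ^ 2 * N(D2 u x) := by clear * - e3; gcongr
          _ ≤ _ := by linarith only [k1, k3]
      calc δ ^ 2 * √δ * N(D2 u y - D2 u x) = √δ * (δ ^ 2 * N(D2 u y - D2 u x)) := by ring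
        _ ≤ (2 * C * N * √N(y - x)) * (5 * (C1 * C * N ^ 4 * Y)) := by clear * - e4 e5 hδ hC hN4; gcongr
        _ = 10 * W * N ^ 5 * Y * √N(y - x) := by rw [hW]; ring
        _ ≤ _ := by clear * - hfin; gcongr
  have hm : ∀ B B', B ≤ B' → P B → P B' := fun B B' h hP x δ h1 h2 =>
    ⟨(hP x δ h1 h2).1.trans h, fun y hy => ((hP x δ h1 h2).2 y hy).trans (by clear * - h; gcongr)⟩
  have hend := absorb (P := P) (A := 10 * W * N ^ 5 * D) pv (by clear * -; positivity) hP0 hstep hm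
  rw [← hD]
  refine ⟨?_, fun y hy => ?_⟩
  · have := le_of_eps (X := r ^ 2 * N(D2 u x0)) (S := 1) fun ε hε => (by
      rw [mul_one]; exact (hend ε hε x0 r hr smp).1)
    linarith
  · have := le_of_eps fun ε hε => ((hend ε hε x0 r hr smp).2 y hy)
    rwa [← mul_assoc] at this
end
section
lemma second_test {f f' : ℝ → ℝ} {c : ℝ} (h1 : ∀ᶠ s in 𝓝 0, HasDerivAt f (f' s) s) (h2 : HasDerivAt f' c 0)
    (hm : ∀ᶠ s in 𝓝 0, f s ≤ f 0) : c ≤ 0 := by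
  by_contra hc
  push Not at hc
  have e1 : deriv f =ᶠ[𝓝 0] f' := h1.mono fun s hs => hs.deriv
  have e2 : deriv (deriv f) 0 = c := by rw [e1.deriv_eq, h2.deriv]
  have hmax : IsLocalMax f 0 := hm
  have hmin : IsLocalMin f 0 := isLocalMin_of_deriv_deriv_pos (by rw [e2]; exact hc) hmax.deriv_eq_zero
    h1.self_of_nhds.continuousAt
  have hconst : f =ᶠ[𝓝 0] fun _ => f 0 := by
    filter_upwards [hm, hmin] with s h3 h4 using le_antisymm h3 h4
  have : deriv (deriv f) 0 = 0 := by
    rw [hconst.deriv.deriv_eq]; simp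
  linarith
lemma line_D2 {u : EE → ℝ} {x : EE} (hu : ContDiffAt ℝ 2 u x) (ξ : EE) :
    (∀ᶠ s : ℝ in 𝓝 0, HasDerivAt (fun s : ℝ => u (x + s • ξ)) (Df u (x + s • ξ) ξ) s) ∧
    HasDerivAt (fun s : ℝ => Df u (x + s • ξ) ξ) (D2 u x ξ ξ) 0 := by
  have hl : ∀ s : ℝ, HasDerivAt (fun s : ℝ => x + s • ξ) ξ s := fun s => by
    simpa using ((hasDerivAt_id s).smul_const ξ).const_add x
  have ht : Tendsto (fun s : ℝ => x + s • ξ) (𝓝 0) (𝓝 x) := by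
    have := (hl 0).continuousAt.tendsto; simpa using this
  constructor
  · have := ht.eventually (hu.eventually smp)
    filter_upwards [this] with s hs
    exact (hs.differentiableAt nnu).hasFDerivAt.comp_hasDerivAt s (hl s)
  · have h1 : DifferentiableAt ℝ (Df u) x := (hu.fderiv_right (m := 1) nnu).differentiableAt nnu
    have h2 : HasFDerivAt (Df u) (D2 u x) (x + (0:ℝ) • ξ) := by rw [zero_smul, add_zero]; exact h1.hasFDerivAt
    have h3 := h2.comp_hasDerivAt 0 (hl 0)
    have h4 := (ContinuousLinearMap.apply ℝ ℝ ξ).hasFDerivAt.comp_hasDerivAt (0:ℝ) h3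
    exact h4
lemma test2 {u v : EE → ℝ} {x y ξ η : EE} {B G : ℝ} (hu : ContDiffAt ℝ 2 u x) (hv : ContDiffAt ℝ 2 v y)
    (h : ∀ᶠ s : ℝ in 𝓝 0, u (x + s • ξ) - v (y + s • η) ≤ u x - v y + B * s + G * s ^ 2) :
    D2 u x ξ ξ - D2 v y η η ≤ 2 * G := by
  obtain ⟨h1, h2⟩ := line_D2 hu ξ
  obtain ⟨h3, h4⟩ := line_D2 hv η
  have hq : ∀ s : ℝ, HasDerivAt (fun s : ℝ => B * s + G * s ^ 2) (B + 2 * G * s) s := fun s => by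
    have := ((hasDerivAt_id s).const_mul B).add (((hasDerivAt_id s).pow 2).const_mul G)
    refine this.congr_deriv ?_
    simp; ring
  have hq' : HasDerivAt (fun s : ℝ => B + 2 * G * s) (2 * G) 0 := by
    simpa using ((hasDerivAt_id (0:ℝ)).const_mul (2 * G)).const_add B
  have := second_test (f := fun s => u (x + s • ξ) - v (y + s • η) - (B * s + G * s ^ 2))
    (by filter_upwards [h1, h3] with s e1 e2 using (e1.sub e2).sub (hq s)) ((h2.sub h4).sub hq')
    (by filter_upwards [h] with s hs; simp; linarith)
  linarith
lemma D2_nonpos {v : EE → ℝ} {x : EE} (hv : ContDiffAt ℝ 2 v x) (hm : IsLocalMax v x) (ξ : EE) : D2 v x ξ ξ ≤ 0 := by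
  obtain ⟨h1, h2⟩ := line_D2 hv ξ
  refine second_test h1 h2 ?_
  have ht : Tendsto (fun s : ℝ => x + s • ξ) (𝓝 0) (𝓝 x) := by
    have : Continuous fun s : ℝ => x + s • ξ := by fun_prop
    simpa using this.tendsto 0
  simpa using ht.eventually hm
lemma Coef.tr_nonpos {a : EE → MM} {K C : ℝ} (h : Coef a K C) (x : EE)
    {M : EB} (hM : ∀ ξ, M ξ ξ ≤ 0) : tr (a x) M ≤ 0 := by
  obtain ⟨S, S', h1, h2, h3, h4⟩ := root h.hC (h.symm x) (h.ell x)
  rw [h4]; exact Finset.sum_nonpos fun k _ => hM _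
lemma tr_smul' (A : MM) (c : ℝ) (M : EB) : tr (c • A) M = c * tr A M := by
  simp [tr, Finset.mul_sum, mul_assoc]
lemma tr_add' (A B : MM) (M : EB) : tr (A + B) M = tr A M + tr B M := by
  simp [tr, add_mul, Finset.sum_add_distrib]
lemma tr_one (M : EB) : tr 1 M = ∑ k, M (ee k) (ee k) := by
  simp [tr, Matrix.one_apply]
lemma tr_vec (e : EE) (M : EB) : tr (Matrix.of fun i j => e i * e j) M = M e e := by
  conv_rhs => rw [← sum_ee e]
  simp only [tr, Matrix.of_apply, map_sum, map_smul, FunLike.coe_sum, Finset.sum_apply, smul_apply, smul_eq_mul, Finset.mul_sum]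
  rw [Finset.sum_comm]
  exact Finset.sum_congr rfl fun i _ => Finset.sum_congr rfl fun j _ => by ring
noncomputable def oz (z : EE) : EB := (innerSL ℝ z).smulRight (innerSL ℝ z)
lemma oz_apply (z ξ η : EE) : oz z ξ η = inner ℝ z ξ * inner ℝ z η := rfl
lemma quad_tr (A : MM) (z : EE) : quadForm A z = tr A (oz z) := by
  unfold quadForm tr
  refine Finset.sum_congr rfl fun i _ => Finset.sum_congr rfl fun j _ => ?_
  simp [oz_apply, ee, EuclideanSpace.inner_single_right]; ring
lemma norm_oz (z : EE) : N(oz z) ≤ N(z) ^ 2 :=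
  ContinuousLinearMap.opNorm_le_bound₂ _ pv fun ξ η => by
    rw [oz_apply, norm_mul]
    calc _ ≤ (N(z) * N(ξ)) * (N(z) * N(η)) := by gcongr <;> exact norm_inner_le_norm _ _
      _ = _ := by ring
noncomputable def ip : EB := innerSL ℝ
lemma ip_self (x : EE) : ip x x = N(x) ^ 2 := real_inner_self_eq_norm_sq x
lemma ip_norm : N((ip : EB)) ≤ 1 :=
  ContinuousLinearMap.opNorm_le_bound₂ _ nnu fun ξ η => by
    rw [one_mul]; exact norm_inner_le_norm ξ η
lemma coupling {A A' : MM} {C k D b κ : ℝ} {e : EE} (he : N(e) = 1) (hC : 0 < C) (hA : A.IsSymm) (hA' : A'.IsSymm)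
    (hell : ∀ z, C⁻¹ * N(z) ^ 2 ≤ quadForm A z) (hk : ∀ i j, |A' i j - A i j| ≤ k) (hkC : d ^ 2 * k ≤ (2 * C)⁻¹) (hk0 : 0 ≤ k)
    {M M' : EB} (hD : 0 ≤ D)
    (h1 : M e e - M' e e ≤ - b + 2 * κ) (h2 : ∀ ξ η, M ξ ξ - M' η η ≤ D * N(ξ - η) ^ 2 + 2 * κ * N(ξ) ^ 2) :
    tr A M - tr A' M' ≤ - ((2 * C)⁻¹ * b) + D * (2 * d ^ 3 * k + d ^ 2 * k) + 2 * κ * tr A ip := by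
  obtain ⟨l, hl⟩ : ∃ l, l = (2 * C)⁻¹ := ⟨_, rfl⟩
  have hl0 : 0 ≤ l := by rw [hl]; positivity
  have hlC : C⁻¹ = 2 * l := by rw [hl]; field_simp
  rw [← hl] at hkC ⊢
  rw [hlC] at hell
  obtain ⟨ε, hε⟩ : ∃ ε, ε = (d:ℝ) ^ 2 * k := ⟨_, rfl⟩
  have hε0 : 0 ≤ ε := by rw [hε]; positivity
  rw [← hε] at hkC
  set E : MM := Matrix.of fun i j => e i * e j with hE
  have hEs : E.IsSymm := by ext i j; simp [hE, mul_comm]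
  set P := A - l • E - ε • (1 : MM) with hP
  set R := ε • (1 : MM) + (A' - A) with hR
  have q1 : ∀ z : EE, ∑ k, oz z (ee k) (ee k) = N(z) ^ 2 := fun z => by
    rw [EuclideanSpace.real_norm_sq_eq]
    exact Finset.sum_congr rfl fun k _ => by simp [oz_apply, ee, EuclideanSpace.inner_single_right, sq]
  obtain ⟨S, -, hS⟩ := psd_root (A := P) ((hA.sub (hEs.smul l)).sub (Matrix.isSymm_one.smul ε)) fun z => by
    rw [quad_tr, hP, tr_sub', tr_sub', tr_smul', tr_smul', tr_vec, tr_one, q1, ← quad_tr, oz_apply]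
    have h3 := hell z
    have h4 : |inner ℝ z e| ≤ N(z) * N(e) := abs_real_inner_le_norm z e
    rw [he, mul_one] at h4
    have h5 : inner ℝ z e * inner ℝ z e ≤ N(z) ^ 2 := by rw [← abs_mul_abs_self, sq]; (clear * - h4; gcongr)
    nlinarith only [h3, hkC, hl0, h5, sq_nonneg N(z)]
  obtain ⟨S', -, hS'⟩ := psd_root (A := R) ((Matrix.isSymm_one.smul ε).add (hA'.sub hA)) fun z => by
    rw [quad_tr, hR, tr_add', tr_smul', tr_one, q1]
    have h3 := tr_bd (A := A' - A) hk (oz z)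
    rw [← hε] at h3
    have h4 : ε * N(oz z) ≤ ε * N(z) ^ 2 := by gcongr; exact norm_oz z
    linarith [neg_abs_le (tr (A' - A) (oz z))]
  have e1 : ∀ N, tr A N = tr P N + l * N e e + ε * ∑ k, N (ee k) (ee k) := fun N => by
    rw [hP, tr_sub', tr_sub', tr_smul', tr_smul', tr_vec, tr_one]; ring
  have e2 : ∀ N, tr A' N = tr P N + l * N e e + tr R N := fun N => by
    rw [hP, hR, tr_sub', tr_sub', tr_add', tr_sub', tr_smul', tr_smul', tr_vec, tr_one]; ring
  have hek : ∀ k : Fin d, N(ee k) = 1 := fun k => by simp [ee]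
  have t1 : tr P M - tr P M' ≤ 2 * κ * tr P ip := by
    rw [hS, hS, hS, ← Finset.sum_sub_distrib, Finset.mul_sum]
    exact Finset.sum_le_sum fun k _ => by have := h2 (S (ee k)) (S (ee k)); simpa [ip_self] using this
  have t2 : ∑ k, M (ee k) (ee k) ≤ d * (D + 2 * κ) := by
    calc _ ≤ ∑ k : Fin d, (D + 2 * κ) := Finset.sum_le_sum fun k _ => by
          have := h2 (ee k) 0; simpa [hek] using this
      _ = _ := by simp [mul_add]
  have t3 : - tr R M' ≤ D * tr R ip := by
    rw [hS', hS', ← Finset.sum_neg_distrib, Finset.mul_sum]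
    exact Finset.sum_le_sum fun k _ => by have := h2 0 (S' (ee k)); simpa [ip_self] using this
  have t4 : tr R ip ≤ d * ε + d ^ 2 * k := by
    rw [hR, tr_add', tr_smul', tr_one]
    have h3 := tr_bd (A := A' - A) hk ip
    have h4 : (d:ℝ) ^ 2 * k * N((ip : EB)) ≤ (d:ℝ) ^ 2 * k * 1 := by gcongr; exact ip_norm
    have h5 : ∑ k, (ip : EB) (ee k) (ee k) = d := by simp [ip_self, hek]
    rw [h5]; linarith [le_abs_self (tr (A' - A) ip)]
  have t5 : tr A ip = tr P ip + l + ε * d := by rw [e1]; simp [ip_self, hek, he]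
  have t6 := mll t2 hε0
  have t7 := mll t4 hD
  have t8 := mll h1 hl0
  rw [e1, e2, t5]
  have : D * (2 * d ^ 3 * k + d ^ 2 * k) = D * (d * ε + d * ε + d ^ 2 * k) := by rw [hε]; ring
  rw [this]
  linarith
set_option maxHeartbeats 800000 in
lemma doubling {a : EE → MM} {K C : ℝ} (ha : Coef a K C) {u : EE → ℝ} {x0 : EE} {r M N L : ℝ}
    (hr : 0 < r) (hrK : d ^ 2 * (K * r) ≤ (2 * C)⁻¹) (hrK2 : K * (2 * d ^ 3 + d ^ 2) * (C * r) ≤ 2)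
    (hu : ContDiffOn ℝ 2 u (ball x0 r)) (hM : ∀ y ∈ ball x0 r, |u y| ≤ M)
    (hN : ∀ y ∈ ball x0 r, |tr (a y) (D2 u y)| ≤ N) (hL : C * r * N + (8 * d * C ^ 2 + 16) * (M / r) < L)
    (y0 : EE) (hy0 : N(x0 - y0) ≤ r / 4) : u x0 - u y0 ≤ L * N(x0 - y0) := by
  by_contra hcon
  push Not at hcon
  have hx00 := mem_ball_self (x := x0) hr
  have hM0 : 0 ≤ M := (abs_nonneg _).trans (hM x0 hx00)
  have hN0 : 0 ≤ N := (abs_nonneg _).trans (hN x0 hx00)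
  have hC := ha.hC
  have hC0 : 0 < C := by linarith
  have hMr : 0 ≤ M / r := by positivity
  have hL16 : 16 * (M / r) < L := lt_of_le_of_lt (by
    have : 0 ≤ C * r * N + 8 * d * C ^ 2 * (M / r) := by positivity
    linarith only [this]) hL
  have hL0 : 0 < L := by linarith
  obtain ⟨w, hw⟩ : ∃ w : ℝ → ℝ, w = fun t => t - t ^ 2 / r := ⟨_, rfl⟩
  obtain ⟨κ, hκ⟩ : ∃ κ, κ = 8 * M / r ^ 2 := ⟨_, rfl⟩
  have hκ0 : 0 ≤ κ := by rw [hκ]; positivity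
  let Φ : EE × EE → ℝ := fun p => u p.1 - u p.2 - L * w N(p.1 - p.2) - κ * N(p.1 - x0) ^ 2
  let S : Set (EE × EE) := {p | N(p.1 - x0) ≤ r / 2 ∧ N(p.1 - p.2) ≤ r / 4}
  have hSb : ∀ p ∈ S, p.1 ∈ ball x0 r ∧ p.2 ∈ ball x0 r := by
    rintro ⟨x, y⟩ ⟨h1, h2⟩
    simp only [mem_ball, dist_eq_norm] at h1 h2 ⊢
    refine ⟨by linarith only [hr, h1], ?_⟩
    have := norm_sub_le_norm_sub_add_norm_sub y x x0
    rw [norm_sub_rev y x] at this; linarith only [hr, h1, h2, this]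
  have hSc : IsCompact S := by
    refine Metric.isCompact_of_isClosed_isBounded ?_ ?_
    · have q1 : IsClosed {p : EE × EE | N(p.1 - x0) ≤ r / 2} := isClosed_le (by fun_prop) (by fun_prop)
      have q2 : IsClosed {p : EE × EE | N(p.1 - p.2) ≤ r / 4} := isClosed_le (by fun_prop) (by fun_prop)
      exact q1.inter q2
    · refine (Metric.isBounded_ball (x := x0) (r := r)).prod (Metric.isBounded_ball (x := x0) (r := r)) |>.subset fun p hp => ?_
      exact hSb p hp
  have hΦ : ContinuousOn Φ S := by
    have h1 : ContinuousOn (fun p : EE × EE => u p.1) S := hu.continuousOn.comp continuousOn_fst fun p hp => (hSb p hp).1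
    have h2 : ContinuousOn (fun p : EE × EE => u p.2) S := hu.continuousOn.comp continuousOn_snd fun p hp => (hSb p hp).2
    have h3 : Continuous (fun p : EE × EE => L * w N(p.1 - p.2)) := by rw [hw]; fun_prop
    have h4 : Continuous (fun p : EE × EE => κ * N(p.1 - x0) ^ 2) := by fun_prop
    exact ((h1.sub h2).sub h3.continuousOn).sub h4.continuousOn
  have h0S : (x0, y0) ∈ S := ⟨by simp; positivity, hy0⟩
  obtain ⟨⟨x, y⟩, hxyS, hmax⟩ := hSc.exists_isMaxOn ⟨_, h0S⟩ hΦ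
  have hpos : 0 < Φ (x, y) := by
    refine lt_of_lt_of_le ?_ (hmax h0S)
    have : L * w N(x0 - y0) ≤ L * N(x0 - y0) := by
      gcongr; rw [hw]; simp; positivity
    simp only [Φ, sub_self, norm_zero]; linarith
  obtain ⟨hxb, hyb⟩ := hSb _ hxyS
  have hux := hu.contDiffAt (isOpen_ball.mem_nhds hxb)
  have huy := hu.contDiffAt (isOpen_ball.mem_nhds hyb)
  simp only at hxb hyb hux huy
  have h2M : u x - u y ≤ 2 * M := by
    have h1 := abs_le.1 (hM x hxb); have h2 := abs_le.1 (hM y hyb); linarith only [h1, h2]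
  have hxyS' : N(x - x0) ≤ r / 2 ∧ N(x - y) ≤ r / 4 := hxyS
  obtain ⟨t, ht⟩ : ∃ t, t = N(x - y) := ⟨_, rfl⟩
  have hpos' : 0 < u x - u y - L * w t - κ * N(x - x0) ^ 2 := by rw [ht]; exact hpos
  have ht0 : 0 < t := by
    rw [ht, norm_pos_iff, sub_ne_zero]
    rintro rfl
    simp only [sub_self, norm_zero] at ht
    rw [hw, ht] at hpos'
    have : 0 ≤ κ * N(x - x0) ^ 2 := by clear * - hκ0; positivity
    simp at hpos'; linarith only [this, hpos']
  have ht4 : t ≤ r / 4 := ht ▸ hxyS'.2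
  have hwt : 0 ≤ w t := by
    rw [hw]; simp only [sub_nonneg]; rw [div_le_iff₀ hr]; nlinarith only [ht4, ht0, hr]
  have ht4' : t < r / 4 := by
    refine lt_of_le_of_ne ht4 fun h => ?_
    have e1 : w t = 3 / 16 * r := by rw [hw, h]; field_simp; ring
    have e2 : 3 * M ≤ L * w t := by
      rw [e1]
      have := mlr hL16.le (show 0 ≤ 3 / 16 * r by positivity)
      calc 3 * M = 16 * (M / r) * (3 / 16 * r) := by field_simp
        _ ≤ _ := this
    have : 0 ≤ κ * N(x - x0) ^ 2 := by clear * - hκ0; positivity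
    linarith only [hM0, h2M, hpos', e2, this]
  have hx2 : N(x - x0) < r / 2 := by
    refine lt_of_le_of_ne hxyS'.1 fun h => ?_
    have e1 : κ * N(x - x0) ^ 2 = 2 * M := by rw [h, hκ]; field_simp; ring
    have : 0 ≤ L * w t := by positivity
    linarith only [h2M, hpos', e1, this]
  have hpert : ∀ ξ η : EE, ∀ᶠ s : ℝ in 𝓝 0, u (x + s • ξ) - u (y + s • η) ≤ u x - u y +
      L * (w N(x - y + s • (ξ - η)) - w t) + κ * (2 * s * inner ℝ (x - x0) ξ + s ^ 2 * N(ξ) ^ 2) := by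
    intro ξ η
    have c1 : Continuous fun s : ℝ => N(x + s • ξ - x0) := by fun_prop
    have c2 : Continuous fun s : ℝ => N(x + s • ξ - (y + s • η)) := by fun_prop
    have e1 := (c1.tendsto 0).eventually_lt_const (show N(x + (0:ℝ) • ξ - x0) < r / 2 by rw [zero_smul, add_zero]; exact hx2)
    have e2 := (c2.tendsto 0).eventually_lt_const (show N(x + (0:ℝ) • ξ - (y + (0:ℝ) • η)) < r / 4 by rw [zero_smul, zero_smul, add_zero, add_zero, ← ht]; exact ht4')
    filter_upwards [e1, e2] with s h1 h2
    have := hmax (show (x + s • ξ, y + s • η) ∈ S from ⟨h1.le, h2.le⟩)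
    have h3 : u (x + s • ξ) - u (y + s • η) - L * w N(x + s • ξ - (y + s • η)) - κ * N(x + s • ξ - x0) ^ 2 ≤
      u x - u y - L * w t - κ * N(x - x0) ^ 2 := by rw [ht]; exact this
    have h4 : x + s • ξ - (y + s • η) = x - y + s • (ξ - η) := by rw [smul_sub]; abel
    have h5 : N(x + s • ξ - x0) ^ 2 = N(x - x0) ^ 2 + 2 * s * inner ℝ (x - x0) ξ + s ^ 2 * N(ξ) ^ 2 := by
      rw [add_sub_right_comm, norm_add_sq_real, inner_smul_right, norm_smul, mul_pow, nea, sq_abs]; ring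
    rw [h4, h5] at h3
    linarith only [h3]
  have hwd : ∀ t', w t' - w t ≤ (1 - 2 * t / r) * (t' - t) := fun t' => by
    rw [hw]
    have : (1 - 2 * t / r) * (t' - t) - ((t' - t' ^ 2 / r) - (t - t ^ 2 / r)) = (t' - t) ^ 2 / r := by field_simp; ring
    have h2 : 0 ≤ (t' - t) ^ 2 / r := by clear * - hr; positivity
    simp only; linarith only [this, h2]
  have hw1 : 0 ≤ 1 - 2 * t / r := by rw [sub_nonneg, div_le_one hr]; linarith only [ht0, ht4']
  have hw2 : 1 - 2 * t / r ≤ 1 := by linarith only [ht0, hr, show 0 ≤ 2 * t / r by positivity]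
  set e := t⁻¹ • (x - y) with he
  have hte : t • e = x - y := by rw [he, smul_smul, mul_inv_cancel₀ ht0.ne', one_smul]
  have hen : N(e) = 1 := by rw [he, norm_smul, norm_inv, ← ht, Real.norm_of_nonneg ht0.le, inv_mul_cancel₀ ht0.ne']
  have f1 : D2 u x e e - D2 u y (-e) (-e) ≤ 2 * (-(4 / r) * L + κ) := by
    refine test2 (B := 2 * L * (1 - 2 * t / r) + 2 * κ * inner ℝ (x - x0) e) hux huy ?_
    have e1 : ∀ᶠ s : ℝ in 𝓝 0, -t / 2 < s := eventually_gt_nhds (by linarith only [ht0])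
    filter_upwards [hpert e (-e), e1] with s h1 h2
    have h3 : N(x - y + s • (e - -e)) = t + 2 * s := by
      rw [← hte, sub_neg_eq_add, smul_add, ← add_smul, ← add_smul, norm_smul, hen, mul_one, Real.norm_of_nonneg (by linarith only [h2])]; ring
    have h4 : w (t + 2 * s) - w t = (1 - 2 * t / r) * (2 * s) - 4 / r * s ^ 2 := by rw [hw]; field_simp; ring
    rw [h3, h4, hen] at h1
    refine h1.trans (le_of_eq ?_); ring
  have f2 : ∀ ξ η : EE, D2 u x ξ ξ - D2 u y η η ≤ (L / t) * N(ξ - η) ^ 2 + 2 * κ * N(ξ) ^ 2 := by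
    intro ξ η
    have := test2 (B := L * (1 - 2 * t / r) * inner ℝ (x - y) (ξ - η) / t + 2 * κ * inner ℝ (x - x0) ξ)
      (G := L * (1 - 2 * t / r) * N(ξ - η) ^ 2 / (2 * t) + κ * N(ξ) ^ 2) (ξ := ξ) (η := η) hux huy (by
      filter_upwards [hpert ξ η] with s h1
      refine h1.trans ?_
      have h2 : N(x - y + s • (ξ - η)) - t ≤ s * inner ℝ (x - y) (ξ - η) / t + s ^ 2 * N(ξ - η) ^ 2 / (2 * t) := by
        have h3 : N(x - y + s • (ξ - η)) ^ 2 = t ^ 2 + 2 * s * inner ℝ (x - y) (ξ - η) + s ^ 2 * N(ξ - η) ^ 2 := by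
          rw [norm_add_sq_real, inner_smul_right, norm_smul, mul_pow, nea, sq_abs, ht]; ring
        have h4 : s * inner ℝ (x - y) (ξ - η) / t + s ^ 2 * N(ξ - η) ^ 2 / (2 * t) = (N(x - y + s • (ξ - η)) ^ 2 - t ^ 2) / (2 * t) := by
          rw [h3]; field_simp; ring
        rw [h4, ldi pv]
        nlinarith only [sq_nonneg (N(x - y + s • (ξ - η)) - t)]
      have h5 := (hwd N(x - y + s • (ξ - η))).trans (mll h2 hw1)
      have h6 := mll h5 hL0.le
      calc _ ≤ u x - u y + L * ((1 - 2 * t / r) * (s * inner ℝ (x - y) (ξ - η) / t + s ^ 2 * N(ξ - η) ^ 2 / (2 * t))) +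
            κ * (2 * s * inner ℝ (x - x0) ξ + s ^ 2 * N(ξ) ^ 2) := by linarith only [h6]
        _ = _ := by ring)
    refine this.trans ?_
    have h7 : L * (1 - 2 * t / r) ≤ L := mul_le_of_le_one_right hL0.le hw2
    have h8 : 2 * (L * (1 - 2 * t / r) * N(ξ - η) ^ 2 / (2 * t)) ≤ L / t * N(ξ - η) ^ 2 := by
      calc _ = (L * (1 - 2 * t / r)) / t * N(ξ - η) ^ 2 := by clear * - hr ht0 hL0; field_simp
        _ ≤ _ := by clear * - h7 ht0; gcongr
    linarith only [h8]
  have hcp := coupling (A := a x) (A' := a y) (k := K * t) (b := 8 / r * L) (κ := κ) hen hC0 (ha.symm x) (ha.symm y)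
    (fun z => (ha.ell x z).1) (fun i j => by rw [ht, norm_sub_rev]; exact ha.lip y x i j)
    (by refine le_trans ?_ hrK; have := ha.hK; gcongr; linarith only [ht0, ht4']) (by have := ha.hK; positivity)
    (M := D2 u x) (M' := D2 u y) (D := L / t) pv (by
      have := f1; simp only [map_neg, neg_apply, neg_neg] at this; refine this.trans (le_of_eq ?_); ring) f2
  have g1 := (abs_le.1 (hN x hxb)).1
  have g2 := (abs_le.1 (hN y hyb)).2
  have g3 : tr (a x) ip ≤ d * C := (le_abs_self _).trans ((ha.tr_bd x ip).trans (mul_le_of_le_one_right pv ip_norm))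
  have g4 : L / t * (2 * d ^ 3 * (K * t) + d ^ 2 * (K * t)) = L * (K * (2 * d ^ 3 + d ^ 2)) := by clear * - ht0 hL0; field_simp
  have g5 : K * (2 * d ^ 3 + d ^ 2) ≤ 2 / (C * r) := by rw [ldi pv]; exact hrK2
  have g6 : (2 * C)⁻¹ * (8 / r * L) = 2 * (L * (2 / (C * r))) := by field_simp; ring
  have g7 := mll g5 hL0.le
  have g8 := mll g3 (show 0 ≤ 2 * κ by positivity)
  rw [g4, g6] at hcp
  have g9 : L * (2 / (C * r)) ≤ 2 * N + 2 * κ * (d * C) := by linarith only [hcp, g1, g2, g7, g8]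
  have g10 : L ≤ C * r * N + 8 * d * C ^ 2 * (M / r) := by
    have := mll g9 (show 0 ≤ C * r / 2 by positivity)
    calc L = C * r / 2 * (L * (2 / (C * r))) := by field_simp
      _ ≤ _ := this
      _ = _ := by rw [hκ]; (clear * - hr hC; field_simp)
  linarith only [g10, hL, hMr]
lemma D2_neg (u : EE → ℝ) (x : EE) : D2 (fun y => - u y) x = - D2 u x := by
  have : Df (fun y => - u y) = fun y => - Df u y := funext fun y => fderiv_neg
  unfold D2; rw [this]; exact fderiv_neg
lemma tr_neg (A : MM) (M : EB) : tr A (-M) = - tr A M := by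
  simp [tr]
lemma grad_est {K C : ℝ} (hK : 0 ≤ K) (hC : 1 ≤ C) : ∃ A, 0 ≤ A ∧
    ∀ (a : EE → MM), Coef a K C → ∀ (u : EE → ℝ) (x0 : EE) (r M N : ℝ), 0 < r → r ≤ 1 → ContDiffOn ℝ 2 u (ball x0 r) →
    (∀ y ∈ ball x0 r, |u y| ≤ M) → (∀ y ∈ ball x0 r, |tr (a y) (D2 u y)| ≤ N) →
    N(Df u x0) ≤ A * (M / r + r * N) := by
  obtain ⟨q, hq⟩ : ∃ q : ℝ, q = d ^ 2 * K * (2 * C) + K * (2 * d ^ 3 + d ^ 2) * C + 1 := ⟨_, rfl⟩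
  have hq1 : 1 ≤ q := by
    rw [hq]
    have : 0 ≤ d ^ 2 * K * (2 * C) + K * (2 * d ^ 3 + d ^ 2) * C := by positivity
    linarith
  have hq0 : 0 < q := by linarith
  refine ⟨C + (8 * d * C ^ 2 + 16) * q, by positivity, fun a ha u x0 r M N hr hr1 hu hM hN => ?_⟩
  have hx00 := mem_ball_self (x := x0) hr
  have hM0 : 0 ≤ M := (abs_nonneg _).trans (hM x0 hx00)
  have hN0 : 0 ≤ N := (abs_nonneg _).trans (hN x0 hx00)
  obtain ⟨ρ, hρ⟩ : ∃ ρ, ρ = r / q := ⟨_, rfl⟩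
  have hρ0 : 0 < ρ := by rw [hρ]; positivity
  have hρr : ρ ≤ r := by rw [hρ]; exact div_le_self hr.le hq1
  have hρq : ρ ≤ 1 / q := by rw [hρ]; gcongr
  have hsub : ball x0 ρ ⊆ ball x0 r := ball_subset_ball hρr
  have c1 : (d:ℝ) ^ 2 * (K * ρ) ≤ (2 * C)⁻¹ := by
    rw [← one_div, ldi pv]
    calc (d:ℝ) ^ 2 * (K * ρ) * (2 * C) = (d ^ 2 * K * (2 * C)) * ρ := by ring
      _ ≤ q * (1 / q) := by
        gcongr; rw [hq]; have : 0 ≤ K * (2 * d ^ 3 + d ^ 2) * C := by positivity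
        linarith
      _ = 1 := by field_simp
  have c2 : K * (2 * d ^ 3 + d ^ 2) * (C * ρ) ≤ 2 := by
    calc K * (2 * d ^ 3 + d ^ 2) * (C * ρ) = (K * (2 * d ^ 3 + d ^ 2) * C) * ρ := by ring
      _ ≤ q * (1 / q) := by
        gcongr; rw [hq]; have : 0 ≤ d ^ 2 * K * (2 * C) := by positivity
        linarith
      _ = 1 := by field_simp
      _ ≤ 2 := by norm_num
  have hfin : C * ρ * N + (8 * d * C ^ 2 + 16) * (M / ρ) ≤ (C + (8 * d * C ^ 2 + 16) * q) * (M / r + r * N) := by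
    have e1 : M / ρ = q * (M / r) := by rw [hρ]; field_simp
    have e2 : C * ρ * N ≤ C * r * N := by clear * - hρr hC hN0; gcongr
    have e3 : 0 ≤ M / r := by positivity
    have e4 : 0 ≤ C * (M / r) + (8 * d * C ^ 2 + 16) * q * (r * N) := by clear * - hC hM0 hr hq1 hN0; positivity
    rw [e1]; linarith only [e2, e4]
  refine le_trans ?_ hfin
  refine le_of_forall_pos_le_add fun ε hε => ?_
  have k1 := doubling (L := C * ρ * N + (8 * d * C ^ 2 + 16) * (M / ρ) + ε) ha hρ0 c1 c2 (hu.mono hsub)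
    (fun y hy => hM y (hsub hy)) (fun y hy => hN y (hsub hy)) (by linarith only [hε])
  have k2 := doubling (u := fun y => - u y) (L := C * ρ * N + (8 * d * C ^ 2 + 16) * (M / ρ) + ε) ha hρ0 c1 c2 (hu.mono hsub).neg
    (fun y hy => by rw [abs_neg]; exact hM y (hsub hy)) (fun y hy => by rw [D2_neg, tr_neg, abs_neg]; exact hN y (hsub hy)) (by linarith only [hε])
  have hdf := ((hu.contDiffAt (isOpen_ball.mem_nhds hx00)).differentiableAt nnu).hasFDerivAt
  refine hdf.le_of_lip' (by clear * - hC hρ0 hN0 hM0 hε; positivity) ?_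
  filter_upwards [closedBall_mem_nhds x0 (show 0 < ρ / 4 by positivity)] with y hy
  rw [mem_closedBall, dist_eq_norm, norm_sub_rev] at hy
  rw [norm_sub_rev y x0, nea, abs_le]
  have := k1 y hy; have := k2 y hy
  constructor <;> linarith
end
section
lemma MP {a : EE → MM} {K C : ℝ} (ha : Coef a K C) {v : EE → ℝ} {s : Set EE} (hs : IsCompact s)
    (hc : ContinuousOn v s) (h : ∀ x ∈ s, 0 < v x → s ∈ 𝓝 x ∧ ContDiffAt ℝ 2 v x ∧ (Df v x = 0 → 0 < tr (a x) (D2 v x))) :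
    ∀ x ∈ s, v x ≤ 0 := by
  intro x hx
  obtain ⟨y, hy, hm⟩ := hs.exists_isMaxOn ⟨x, hx⟩ hc
  by_contra h0
  push Not at h0
  obtain ⟨h1, h2, h3⟩ := h y hy (h0.trans_le (hm hx))
  have hl : IsLocalMax v y := hm.isLocalMax h1
  exact absurd (h3 hl.fderiv_eq_zero) (not_lt.2 (ha.tr_nonpos y (D2_nonpos h2 hl)))
lemma cda {u : EE → ℝ} {s : Set EE} {x : EE} (h : ContDiffOn ℝ 2 u s) (hs : s ∈ 𝓝 x) : ContDiffAt ℝ 2 u x := h.contDiffAt hs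
lemma ev_diff {u : EE → ℝ} {x : EE} (h : ContDiffAt ℝ 2 u x) : ∀ᶠ y in 𝓝 x, DifferentiableAt ℝ u y :=
  (h.eventually smp).mono fun _ hy => hy.differentiableAt nnu
lemma diff1 {u : EE → ℝ} {x : EE} (h : ContDiffAt ℝ 2 u x) : DifferentiableAt ℝ (Df u) x :=
  (h.fderiv_right (m := 1) nnu).differentiableAt nnu
lemma lin2 {u v : EE → ℝ} {x : EE} (c : ℝ) (hu : ContDiffAt ℝ 2 u x) (hv : ContDiffAt ℝ 2 v x) :
    Df (fun y => u y + c * v y) x = Df u x + c • Df v x ∧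
    D2 (fun y => u y + c * v y) x = D2 u x + c • D2 v x := by
  have key : ∀ y, DifferentiableAt ℝ u y → DifferentiableAt ℝ v y →
      Df (fun y => u y + c * v y) y = Df u y + c • Df v y := fun y h1 h2 =>
    (h1.hasFDerivAt.add (h2.hasFDerivAt.const_mul c)).fderiv
  have e : Df (fun y => u y + c * v y) =ᶠ[𝓝 x] fun y => Df u y + c • Df v y := by
    filter_upwards [ev_diff hu, ev_diff hv] with y h1 h2 using key y h1 h2
  refine ⟨e.self_of_nhds, ?_⟩
  unfold D2
  rw [e.fderiv_eq]
  exact ((diff1 hu).hasFDerivAt.add ((diff1 hv).hasFDerivAt.const_smul c)).fderiv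
lemma ip_apply (x y : EE) : ip x y = inner ℝ x y := rfl
lemma D2_rad {F F1 : ℝ → ℝ} {F2 : ℝ} (x0 x : EE) (h1 : ∀ᶠ t in 𝓝 (N(x - x0) ^ 2), HasDerivAt F (F1 t) t)
    (h2 : HasDerivAt F1 F2 (N(x - x0) ^ 2)) :
    Df (fun y => F (N(y - x0) ^ 2)) x = (2 * F1 (N(x - x0) ^ 2)) • ip (x - x0) ∧
    D2 (fun y => F (N(y - x0) ^ 2)) x = (2 * F1 (N(x - x0) ^ 2)) • ip + (4 * F2) • oz (x - x0) := by
  have hq : ∀ y : EE, HasFDerivAt (fun y : EE => N(y - x0) ^ 2) (2 • ip (y - x0)) y := fun y =>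
    ((hasFDerivAt_id y).sub_const x0).norm_sq
  have hc : Tendsto (fun y : EE => N(y - x0) ^ 2) (𝓝 x) (𝓝 (N(x - x0) ^ 2)) :=
    (by fun_prop : Continuous fun y : EE => N(y - x0) ^ 2).tendsto x
  have e : Df (fun y => F (N(y - x0) ^ 2)) =ᶠ[𝓝 x] fun y => (2 * F1 (N(y - x0) ^ 2)) • ip (y - x0) := by
    filter_upwards [hc.eventually h1] with y hy
    have := (hy.comp_hasFDerivAt y (hq y)).fderiv
    refine this.trans ?_
    ext z; simp; ring
  refine ⟨e.self_of_nhds, ?_⟩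
  unfold D2
  rw [e.fderiv_eq]
  have h3 := (h2.comp_hasFDerivAt x (hq x)).const_mul 2
  have h4 : HasFDerivAt (fun y : EE => ip (y - x0)) (ip : EB) x :=
    (ip : EB).hasFDerivAt.comp x ((hasFDerivAt_id x).sub_const x0)
  refine (h3.smul h4).fderiv.trans ?_
  ext z w
  simp [oz_apply, ip_apply, inner_sub_left]; ring
lemma tr_ip {a : EE → MM} {K C : ℝ} (ha : Coef a K C) (hd : 1 ≤ d) (x : EE) :
    C⁻¹ ≤ tr (a x) ip ∧ tr (a x) ip ≤ d * C := by
  have e : tr (a x) ip = ∑ i, a x i i := by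
    simp [tr, ip_apply, ee, EuclideanSpace.inner_single_left, Pi.single_apply]
  have q : ∀ i, quadForm (a x) (ee i) = a x i i := fun i => by
    simp [quadForm, ee, Pi.single_apply]
  have h : ∀ i, C⁻¹ ≤ a x i i ∧ a x i i ≤ C := fun i => by
    have := ha.ell x (ee i); rw [q] at this; simpa using this
  have hC : 0 < C⁻¹ := inv_pos.2 (by linarith [ha.hC])
  rw [e]
  constructor
  · refine (h ⟨0, hd⟩).1.trans (Finset.single_le_sum (f := fun i => a x i i) (fun i _ => hC.le.trans (h i).1) (Finset.mem_univ _))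
  · refine (Finset.sum_le_sum fun i _ => (h i).2).trans ?_
    simp
noncomputable def dl (x : EE) : ℝ := √(1 - N(x))
lemma dl_nonneg (x : EE) : 0 ≤ dl x := Real.sqrt_nonneg _
lemma dl_le (x : EE) : dl x ≤ 1 := Real.sqrt_le_one.2 (by linarith [norm_nonneg x])
lemma dl_pos {x : EE} (h : N(x) < 1) : 0 < dl x := Real.sqrt_pos.2 lna
lemma dl_sq {x : EE} (h : N(x) ≤ 1) : dl x ^ 2 = 1 - N(x) := Real.sq_sqrt lna
lemma dl_bd {x : EE} (h : N(x) = 1) : dl x = 0 := by simp [dl, h]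
lemma cont_dl : Continuous (dl : EE → ℝ) := by unfold dl; fun_prop
lemma sqle {p q : ℝ} (hq : 0 ≤ q) (h : p ^ 2 ≤ q ^ 2) : p ≤ q := (abs_le_of_sq_le_sq' h hq).2
lemma ns1 (y x : EE) : N(y) ≤ N(x) + N(y - x) := norm_le_norm_add_norm_sub' y x
lemma ns2 (y x : EE) : N(x) ≤ N(y) + N(y - x) := norm_le_norm_add_norm_sub y x
lemma near_real {p q a b e : ℝ} (hp : 0 ≤ p) (hq : 0 ≤ q) (h2 : p ^ 2 = 1 - a) (h4 : q ^ 2 = 1 - b) (h : e ≤ p ^ 2 / 2) (h1 : b ≤ a + e) (h1' : a ≤ b + e) :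
    p ≤ 3 / 2 * q ∧ q ≤ 5 / 4 * p := by
  have := sq_nonneg p
  constructor <;> refine sqle lna ?_ <;> rw [mul_pow] <;> linarith
lemma near_lt {p a b e : ℝ} (ha : a < 1) (h2 : p ^ 2 = 1 - a) (h : e ≤ p ^ 2 / 2) (h1 : b ≤ a + e) : b < 1 := by linarith
lemma dl_near {x y : EE} (hx : N(x) < 1) (h : N(y - x) ≤ dl x ^ 2 / 2) :
    N(y) < 1 ∧ dl x ≤ 3 / 2 * dl y ∧ dl y ≤ 5 / 4 * dl x := by
  have hy : N(y) < 1 := near_lt hx (dl_sq hx.le) h (ns1 y x)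
  exact ⟨hy, near_real (dl_nonneg x) (dl_nonneg y) (dl_sq hx.le) (dl_sq hy.le) h (ns1 y x) (ns2 y x)⟩
structure WY (N : ℝ) (g : EE → ℝ) : Prop where
  sup : ∀ x, N(x) < 1 → |g x| * dl x ^ 3 ≤ N
  hol : ∀ x y, N(x) < 1 → N(y - x) ≤ dl x ^ 2 / 2 → |g y - g x| * dl x ^ 4 ≤ N * √N(y - x)
structure WX (N : ℝ) (u : EE → ℝ) : Prop where
  cd : ContDiffOn ℝ 2 u (ball 0 1)
  sup : ∀ x, N(x) ≤ 1 → |u x| ≤ N * dl x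
  grad : ∀ x, N(x) < 1 → N(Df u x) * dl x ≤ N
  hess : ∀ x, N(x) < 1 → N(D2 u x) * dl x ^ 3 ≤ N
  hol : ∀ x y, N(x) < 1 → N(y - x) ≤ dl x ^ 2 / 2 → N(D2 u y - D2 u x) * dl x ^ 4 ≤ N * √N(y - x)
lemma nb {x : EE} (hx : N(x) < 1) : ball (0 : EE) 1 ∈ 𝓝 x := isOpen_ball.mem_nhds (by simpa using hx)
lemma WX.cda {N : ℝ} {u : EE → ℝ} (h : WX N u) {x : EE} (hx : N(x) < 1) : ContDiffAt ℝ 2 u x := h.cd.contDiffAt (nb hx)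
lemma WX.nonneg {N : ℝ} {u : EE → ℝ} (h : WX N u) : 0 ≤ N := by
  have := h.sup 0 smp
  have h1 : dl (0 : EE) = 1 := by simp [dl]
  rw [h1] at this; linarith [abs_nonneg (u 0)]
lemma WX.cont {N : ℝ} {u : EE → ℝ} (h : WX N u) : ContinuousOn u (closedBall 0 1) := by
  intro x hx
  rw [mem_closedBall_zero_iff] at hx
  rcases hx.lt_or_eq with hx | hx
  · exact (h.cda hx).continuousAt.continuousWithinAt
  · have h0 : u x = 0 := abs_nonpos_iff.1 (by simpa [dl_bd hx] using h.sup x hx.le)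
    rw [ContinuousWithinAt, h0]
    refine squeeze_zero_norm' (a := fun y => N * dl y) ?_ ?_
    · filter_upwards [self_mem_nhdsWithin] with y hy
      exact h.sup y (by simpa using hy)
    · have : Tendsto (fun y : EE => N * dl y) (𝓝 x) (𝓝 (N * dl x)) := (by have := @cont_dl d; fun_prop : Continuous fun y : EE => N * dl y).tendsto x
      rw [dl_bd hx, mul_zero] at this
      exact this.mono_left nhdsWithin_le_nhds
lemma WX.lin {N M : ℝ} {u v : EE → ℝ} (hu : WX N u) (hv : WX M v) (c : ℝ) : WX (N + |c| * M) (fun y => u y + c * v y) := by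
  have e1 : ∀ x, N(x) < 1 → _ := fun x hx => lin2 c (hu.cda hx) (hv.cda hx)
  refine ⟨hu.cd.add (contDiffOn_const.mul hv.cd), fun x hx => ?_, fun x hx => ?_, fun x hx => ?_, fun x y hx hy => ?_⟩
  · have h1 := hu.sup x hx
    have h2 := mll (hv.sup x hx) (abs_nonneg c)
    have h3 := abs_add_le (u x) (c * v x)
    rw [abs_mul] at h3; linarith
  · rw [(e1 x hx).1]
    have h1 := hu.grad x hx
    have h2 := mll (hv.grad x hx) (abs_nonneg c)
    have h3 := norm_add_le (Df u x) (c • Df v x)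
    rw [norm_smul, nea] at h3
    have := mlr h3 (dl_nonneg x)
    linarith
  · rw [(e1 x hx).2]
    have h1 := hu.hess x hx
    have h2 := mll (hv.hess x hx) (abs_nonneg c)
    have h3 := norm_add_le (D2 u x) (c • D2 v x)
    rw [norm_smul, nea] at h3
    have := mlr h3 (pow_nonneg (dl_nonneg x) 3)
    linarith
  · rw [(e1 x hx).2, (e1 y (dl_near hx hy).1).2]
    have h1 := hu.hol x y hx hy
    have h2 := mll (hv.hol x y hx hy) (abs_nonneg c)
    have h3 := norm_add_le (D2 u y - D2 u x) (c • (D2 v y - D2 v x))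
    rw [norm_smul, nea] at h3
    have := mlr h3 (pow_nonneg (dl_nonneg x) 4)
    have e : D2 u y + c • D2 v y - (D2 u x + c • D2 v x) = D2 u y - D2 u x + c • (D2 v y - D2 v x) := by
      rw [smsb]; abel
    rw [e]; linarith
lemma WX.mono {N M : ℝ} {u : EE → ℝ} (hu : WX N u) (h : N ≤ M) : WX M u :=
  ⟨hu.cd, fun x hx => (hu.sup x hx).trans (mlr h (dl_nonneg x)), fun x hx => (hu.grad x hx).trans h,
    fun x hx => (hu.hess x hx).trans h, fun x y hx hy => (hu.hol x y hx hy).trans (mlr h (Real.sqrt_nonneg _))⟩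
lemma WY.mono {N M : ℝ} {g : EE → ℝ} (hg : WY N g) (h : N ≤ M) : WY M g :=
  ⟨fun x hx => (hg.sup x hx).trans h, fun x y hx hy => (hg.hol x y hx hy).trans (mlr h (Real.sqrt_nonneg _))⟩
lemma hyp_lim {E : Type*} [NormedAddCommGroup E] [ProperSpace E] (f : ℕ → E) {c : ℝ} (h : ∀ k, N(f k) ≤ c) :
    ∃ l, Tendsto f (hyperfilter ℕ : Filter ℕ) (𝓝 l) := by
  obtain ⟨l, -, hl⟩ := (isCompact_closedBall (0 : E) c).ultrafilter_le_nhds ((hyperfilter ℕ).map f)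
    (by simp only [le_principal_iff, Ultrafilter.mem_coe, Ultrafilter.mem_map]; exact Filter.univ_mem' fun k => by simpa using h k)
  exact ⟨l, hl⟩
lemma taylor {E : Type*} [NormedAddCommGroup E] [NormedSpace ℝ E] {f : EE → E} {f' : EE → EE →L[ℝ] E} {x y : EE} {c : ℝ}
    (hf : ∀ z, N(z - x) ≤ N(y - x) → HasFDerivAt f (f' z) z) (hc : ∀ z, N(z - x) ≤ N(y - x) → N(f' z - f' x) ≤ c) :
    N(f y - f x - f' x (y - x)) ≤ c * N(y - x) := by
  refine (convex_closedBall x N(y - x)).norm_image_sub_le_of_norm_hasFDerivWithin_le' (f' := f') (φ := f' x)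
    (fun z hz => (hf z (by simpa [dist_eq_norm] using hz)).hasFDerivWithinAt) (fun z hz => hc z (by simpa [dist_eq_norm] using hz)) ?_ ?_
  · simp
  · simp [dist_eq_norm]
lemma mvt {E : Type*} [NormedAddCommGroup E] [NormedSpace ℝ E] {f : EE → E} {x y z : EE} {c r : ℝ}
    (hf : ∀ z ∈ ball x r, DifferentiableAt ℝ f z) (hc : ∀ z ∈ ball x r, N(Df f z) ≤ c) (hy : y ∈ ball x r) (hz : z ∈ ball x r) :
    N(f y - f z) ≤ c * N(y - z) :=
  (convex_ball x r).norm_image_sub_le_of_norm_fderiv_le hf hc hz hy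
lemma lim_fderiv {E : Type*} [NormedAddCommGroup E] [NormedSpace ℝ E] {f : ℕ → EE → E} {f' : ℕ → EE →L[ℝ] E} {w : EE → E}
    {w' : EE →L[ℝ] E} {x : EE} {c r : ℝ} {F : Filter ℕ} [F.NeBot] (hr : 0 < r) (hw : ∀ y, N(y - x) ≤ r → Tendsto (fun k => f k y) F (𝓝 (w y)))
    (hw' : Tendsto f' F (𝓝 w')) (h : ∀ y, N(y - x) ≤ r → ∀ k, N(f k y - f k x - f' k (y - x)) ≤ c * √N(y - x) * N(y - x)) :
    HasFDerivAt w w' x := by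
  rw [hasFDerivAt_iff_isLittleO]
  have hb : (fun y => w y - w x - w' (y - x)) =O[𝓝 x] fun y => √N(y - x) * N(y - x) := by
    refine Asymptotics.IsBigO.of_bound c ?_
    filter_upwards [closedBall_mem_nhds x hr] with y hy
    have hy : N(y - x) ≤ r := by simpa [dist_eq_norm] using hy
    rw [Real.norm_of_nonneg (by positivity : 0 ≤ √N(y - x) * N(y - x)), ← mul_assoc]
    exact le_of_tendsto (((hw y hy).sub (hw x (by simpa using hr.le))).sub ((((ContinuousLinearMap.apply ℝ _ (y - x)).continuous.tendsto _).comp hw'))).norm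
          (Eventually.of_forall fun k => h y hy k)
  refine hb.trans_isLittleO ?_
  have : (fun y : EE => √N(y - x) * N(y - x)) =o[𝓝 x] fun y => (1 : ℝ) * N(y - x) := by
    refine Asymptotics.IsLittleO.mul_isBigO ((Asymptotics.isLittleO_one_iff ℝ).2 ?_) (Asymptotics.isBigO_refl _ _)
    have := (by fun_prop : Continuous fun y : EE => √N(y - x)).tendsto x
    simpa using this
  simpa using this.norm_right
lemma WX.hess' {N : ℝ} {u : EE → ℝ} (hu : WX N u) {x y : EE} (hx : N(x) < 1) (hy : N(y - x) ≤ dl x ^ 2 / 2) : N(D2 u y) ≤ 4 * N / dl x ^ 3 := by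
  obtain ⟨h4, h5, h6⟩ := dl_near hx hy
  have hp := dl_pos hx
  have h7 := hu.hess y h4
  rw [ldi pv]
  have h8 : dl x ^ 3 ≤ 4 * dl y ^ 3 := (pow_le_pow_left₀ hp.le h5 3).trans (by
    rw [mul_pow]; nlinarith only [h4, pow_pos (dl_pos h4) 3])
  calc _ ≤ N(D2 u y) * (4 * dl y ^ 3) := mll h8 (nrm0 _)
    _ ≤ _ := by linarith
lemma WX.glip {N : ℝ} {u : EE → ℝ} (hu : WX N u) {x y z : EE} (hx : N(x) < 1) (hy : N(y - x) ≤ dl x ^ 2 / 2) (hz : N(z - x) ≤ dl x ^ 2 / 2) :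
    N(Df u y - Df u z) ≤ 4 * N / dl x ^ 3 * N(y - z) :=
  (convex_closedBall x (dl x ^ 2 / 2)).norm_image_sub_le_of_norm_fderiv_le (f := Df u)
    (fun z' hz' => diff1 (hu.cda (dl_near hx (by simpa [dist_eq_norm] using hz')).1))
    (fun z' hz' => hu.hess' hx (by simpa [dist_eq_norm] using hz')) (by simpa [dist_eq_norm] using hz) (by simpa [dist_eq_norm] using hy)
lemma WX.tay1 {N : ℝ} {u : EE → ℝ} (hu : WX N u) {x y : EE} (hx : N(x) < 1) (hy : N(y - x) ≤ dl x ^ 2 / 2) :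
    N(Df u y - Df u x - D2 u x (y - x)) ≤ N / dl x ^ 4 * √N(y - x) * N(y - x) := by
  have hp := dl_pos hx
  refine taylor (f := Df u) (f' := D2 u) (fun z hz => (diff1 (hu.cda (dl_near hx (hz.trans hy)).1)).hasFDerivAt) fun z hz => ?_
  have h2 := hu.hol x z hx (hz.trans hy)
  rw [div_mul_eq_mul_div, ldi pv]
  exact h2.trans (mll (Real.sqrt_le_sqrt hz) hu.nonneg)
lemma WX.tay0 {N : ℝ} {u : EE → ℝ} (hu : WX N u) {x y : EE} (hx : N(x) < 1) (hy : N(y - x) ≤ dl x ^ 2 / 2) :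
    N(u y - u x - Df u x (y - x)) ≤ 4 * N / dl x ^ 3 * √N(y - x) * N(y - x) := by
  have hp := dl_pos hx
  have hN := hu.nonneg
  have h1 : N(y - x) ≤ √N(y - x) := by
    refine Real.le_sqrt_of_sq_le ?_
    have : N(y - x) ≤ 1 := by nlinarith only [hy, hp, dl_le x]
    nlinarith [norm_nonneg (y - x)]
  refine taylor (f := u) (f' := Df u) (fun z hz => ((hu.cda (dl_near hx (hz.trans hy)).1).differentiableAt nnu).hasFDerivAt) fun z hz => ?_
  exact (hu.glip hx (hz.trans hy) (by simp; positivity)).trans (mll (hz.trans h1) pv)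
lemma CL {N : ℝ} (u : ℕ → EE → ℝ) (hu : ∀ k, WX N (u k)) : ∃ w, WX N w ∧ ∀ x, N(x) < 1 →
    Tendsto (fun k => u k x) (hyperfilter ℕ : Filter ℕ) (𝓝 (w x)) ∧
    Tendsto (fun k => Df (u k) x) (hyperfilter ℕ : Filter ℕ) (𝓝 (Df w x)) ∧
    Tendsto (fun k => D2 (u k) x) (hyperfilter ℕ : Filter ℕ) (𝓝 (D2 w x)) := by
  have hN := (hu 0).nonneg
  have e0 : ∀ x : EE, ∃ l, N(x) ≤ 1 → Tendsto (fun k => u k x) (hyperfilter ℕ : Filter ℕ) (𝓝 l) := fun x => by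
    by_cases hx : N(x) ≤ 1
    · obtain ⟨l, hl⟩ := hyp_lim (fun k => u k x) (fun k => (hu k).sup x hx); exact ⟨l, fun _ => hl⟩
    · exact ⟨0, fun h => absurd h hx⟩
  have e1 : ∀ x : EE, ∃ l, N(x) < 1 → Tendsto (fun k => Df (u k) x) (hyperfilter ℕ : Filter ℕ) (𝓝 l) := fun x => by
    by_cases hx : N(x) < 1
    · obtain ⟨l, hl⟩ := hyp_lim (fun k => Df (u k) x) (c := N / dl x) (fun k => by rw [ldi (dl_pos hx)]; exact (hu k).grad x hx)
      exact ⟨l, fun _ => hl⟩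
    · exact ⟨0, fun h => absurd h hx⟩
  have e2 : ∀ x : EE, ∃ l, N(x) < 1 → Tendsto (fun k => D2 (u k) x) (hyperfilter ℕ : Filter ℕ) (𝓝 l) := fun x => by
    by_cases hx : N(x) < 1
    · obtain ⟨l, hl⟩ := hyp_lim (fun k => D2 (u k) x) (c := N / dl x ^ 3) (fun k => by rw [ldi (pow_pos (dl_pos hx) 3)]; exact (hu k).hess x hx)
      exact ⟨l, fun _ => hl⟩
    · exact ⟨0, fun h => absurd h hx⟩
  choose w hw using e0
  choose w1 hw1 using e1
  choose w2 hw2 using e2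
  have hol : ∀ x y, N(x) < 1 → N(y - x) ≤ dl x ^ 2 / 2 → N(w2 y - w2 x) * dl x ^ 4 ≤ N * √N(y - x) := fun x y hx hy =>
    lim_ns (hw2 y (dl_near hx hy).1) (hw2 x hx) fun k => (hu k).hol x y hx hy
  have hess : ∀ x, N(x) < 1 → N(w2 x) * dl x ^ 3 ≤ N := fun x hx => lim_n (hw2 x hx) fun k => (hu k).hess x hx
  have hr : ∀ x : EE, N(x) < 1 → 0 < dl x ^ 2 / 2 := fun x hx => by have := dl_pos hx; positivity
  have hd1 : ∀ x, N(x) < 1 → HasFDerivAt w1 (w2 x) x := fun x hx =>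
    lim_fderiv (hr x hx) (fun y hy => hw1 y (dl_near hx hy).1) (hw2 x hx) fun y hy k => (hu k).tay1 hx hy
  have hd0 : ∀ x, N(x) < 1 → HasFDerivAt w (w1 x) x := fun x hx =>
    lim_fderiv (hr x hx) (fun y hy => hw y (dl_near hx hy).1.le) (hw1 x hx) fun y hy k => (hu k).tay0 hx hy
  have f0 : ∀ x, N(x) < 1 → Df w x = w1 x := fun x hx => (hd0 x hx).fderiv
  have f1 : ∀ x, N(x) < 1 → D2 w x = w2 x := fun x hx => by
    have : Df w =ᶠ[𝓝 x] w1 := by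
      filter_upwards [nb hx] with y hy using f0 y (by simpa using hy)
    exact this.fderiv_eq.trans (hd1 x hx).fderiv
  refine ⟨w, ⟨?_, fun x hx => ?_, fun x hx => ?_, fun x hx => ?_, fun x y hx hy => ?_⟩, fun x hx => ?_⟩
  · have hc2 : ContinuousOn w2 (ball 0 1) := fun x hx => by
      have hx : N(x) < 1 := by simpa using hx
      have hp := dl_pos hx
      refine (cont_of_holder (c := N / dl x ^ 4) (hr x hx) fun y hy => ?_).continuousWithinAt
      rw [div_mul_eq_mul_div, ldi pv]; exact hol x y hx hy
    have c1 : ContDiffOn ℝ 1 w1 (ball 0 1) := by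
      rw [show (1 : WithTop ℕ∞) = 0 + 1 by norm_num, contDiffOn_succ_iff_fderiv_of_isOpen isOpen_ball]
      refine ⟨fun x hx => (hd1 x (by simpa using hx)).differentiableAt.differentiableWithinAt, by simp, ?_⟩
      rw [contDiffOn_zero]
      exact hc2.congr fun x hx => (hd1 x (by simpa using hx)).fderiv
    rw [show (2 : WithTop ℕ∞) = 1 + 1 by norm_num, contDiffOn_succ_iff_fderiv_of_isOpen isOpen_ball]
    exact ⟨fun x hx => (hd0 x (by simpa using hx)).differentiableAt.differentiableWithinAt, by simp, c1.congr fun x hx => f0 x (by simpa using hx)⟩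
  · exact le_of_tendsto ((hw x hx).abs) (Eventually.of_forall fun k => (hu k).sup x hx)
  · rw [f0 x hx]; exact lim_n (hw1 x hx) fun k => (hu k).grad x hx
  · rw [f1 x hx]; exact hess x hx
  · rw [f1 x hx, f1 y (dl_near hx hy).1]; exact hol x y hx hy
  · rw [f0 x hx, f1 x hx]; exact ⟨hw x hx.le, hw1 x hx, hw2 x hx⟩
end
section
noncomputable def bq (x : EE) : ℝ := √(1 - N(x) ^ 2)
lemma bq_real {r q t : ℝ} (h0 : 0 ≤ r) (ht0 : 0 ≤ t) (hq0 : 0 ≤ q) (hq : q ^ 2 = 1 - r ^ 2) (ht : t ^ 2 = 1 - r) (h1 : r ≤ 1) :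
    t ≤ q ∧ q ≤ 3 / 2 * t ∧ q ^ 3 ≤ 3 * t ^ 3 := by
  have e : q ^ 2 = t ^ 2 * (1 + r) := by rw [hq, ht]; ring
  have h2 : q ^ 2 ≤ 2 * t ^ 2 := by nlinarith only [e, ht, sq_nonneg t]
  refine ⟨sqle hq0 (by nlinarith only [e, h0, sq_nonneg t]), sqle lna (by nlinarith only [h2, sq_nonneg t]), sqle pv ?_⟩
  calc (q ^ 3) ^ 2 = (q ^ 2) ^ 3 := by ring
    _ ≤ (2 * t ^ 2) ^ 3 := pow_le_pow_left₀ pv h2 3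
    _ ≤ _ := by nlinarith only [sq_nonneg (t ^ 3)]
lemma bq_sq {x : EE} (h : N(x) ≤ 1) : bq x ^ 2 = 1 - N(x) ^ 2 := Real.sq_sqrt (by nlinarith [norm_nonneg x])
lemma bq_dl {x : EE} (h : N(x) ≤ 1) : dl x ≤ bq x ∧ bq x ≤ 3 / 2 * dl x ∧ bq x ^ 3 ≤ 3 * dl x ^ 3 :=
  bq_real (norm_nonneg x) (dl_nonneg x) (Real.sqrt_nonneg _) (bq_sq h) (dl_sq h) h
lemma bq_pos {x : EE} (h : N(x) < 1) : 0 < bq x := (dl_pos h).trans_le (bq_dl h.le).1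
lemma bq_cd {x : EE} (h : N(x) < 1) : ContDiffAt ℝ 2 (bq : EE → ℝ) x := by
  refine ContDiffAt.sqrt (contDiffAt_const.sub (contDiff_norm_sq ℝ).contDiffAt) ?_
  have := norm_nonneg x
  nlinarith
lemma bq_L {a : EE → MM} {K C : ℝ} (ha : Coef a K C) (hd : 1 ≤ d) {x : EE} (hx : N(x) < 1) :
    tr (a x) (D2 bq x) ≤ - (C⁻¹ / bq x ^ 3) := by
  have hq := bq_pos hx
  have h1 : ∀ t : ℝ, t < 1 → HasDerivAt (fun t => √(1 - t)) (-(1 / (2 * √(1 - t)))) t := fun t ht => by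
    have := ((hasDerivAt_id t).const_sub 1).sqrt (by simp; linarith)
    refine this.congr_deriv ?_
    simp; ring
  have hx2 : N(x - 0) ^ 2 < 1 := by rw [sub_zero]; nlinarith only [hx, norm_nonneg x]
  have h2 : HasDerivAt (fun t => -(1 / (2 * √(1 - t)))) (-(1 / (4 * bq x ^ 3))) (N(x - 0) ^ 2) := by
    have h3 := (((h1 _ hx2).const_mul 2).inv (by rw [sub_zero]; exact (mul_pos two_pos hq).ne')).neg
    have e : √(1 - N(x - 0) ^ 2) = bq x := by rw [sub_zero]; rfl
    refine (h3.congr_deriv ?_).congr_of_eventuallyEq (Eventually.of_forall fun t => by simp)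
    rw [e]; field_simp; norm_num
  have h3 := (D2_rad 0 x ((isOpen_Iio.mem_nhds hx2 : Iio (1:ℝ) ∈ _) |> fun h => Filter.mem_of_superset h fun t ht => h1 t ht) h2).2
  have e : (fun y : EE => √(1 - N(y - 0) ^ 2)) = bq := by funext y; simp [bq]
  have e' : √(1 - N(x - 0) ^ 2) = bq x := by rw [sub_zero]; rfl
  rw [e, e', sub_zero] at h3
  rw [h3, tr_add, tr_smul, tr_smul, ← quad_tr]
  have h4 := (tr_ip ha hd x).1
  have h5 := (ha.ell x x).1
  have h6 := bq_sq hx.le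
  have e1 : 2 * -(1 / (2 * bq x)) * tr (a x) ip + 4 * -(1 / (4 * bq x ^ 3)) * quadForm (a x) x =
      - ((bq x ^ 2 * tr (a x) ip + quadForm (a x) x) / bq x ^ 3) := by field_simp; ring
  rw [e1]
  refine neg_le_neg (div_le_div_of_nonneg_right ?_ pv)
  have h7 := mll h4 (sq_nonneg (bq x))
  rw [h6] at h7 ⊢
  linarith only [h5, h7]
lemma bq_cont : Continuous (bq : EE → ℝ) := by unfold bq; fun_prop
lemma cb_nb {x : EE} (hx : N(x) < 1) : closedBall (0 : EE) 1 ∈ 𝓝 x := mem_of_superset (nb hx) ball_subset_closedBall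
lemma supb {a : EE → MM} {K C : ℝ} (ha : Coef a K C) (hd : 1 ≤ d) {s N : ℝ} (hs : 0 ≤ s) (hN : 0 < N) {u : EE → ℝ}
    (h2 : ContDiffOn ℝ 2 u (ball 0 1)) (hc : ContinuousOn u (closedBall 0 1)) (hb : ∀ x, N(x) = 1 → u x = 0)
    (h : ∀ x, N(x) < 1 → -N ≤ (tr (a x) (D2 u x) - s * u x) * dl x ^ 3) : ∀ x, N(x) ≤ 1 → u x ≤ 6 * C * N * dl x := by
  have hC := ha.hC
  intro x hx
  have key := MP ha (v := fun y => u y + (-(4 * C * N)) * bq y) (isCompact_closedBall (0 : EE) 1) (hc.add (by have := @bq_cont d; fun_prop)) ?_ x (by simpa using hx)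
  · have h3 := (bq_dl hx).2.1
    have : u x ≤ 4 * C * N * bq x := by linarith
    refine this.trans ?_
    calc _ ≤ 4 * C * N * (3 / 2 * dl x) := mll h3 pv
      _ = _ := by ring
  · intro y hy hv
    have hy' : N(y) < 1 := lt_of_le_of_ne (by simpa using hy) fun e => by
      have h3 : bq y = 0 := by simp [bq, e]
      rw [h3, hb y e] at hv; simp at hv
    have hu2 := h2.contDiffAt (nb hy')
    refine ⟨cb_nb hy', hu2.add (contDiffAt_const.mul (bq_cd hy')), fun _ => ?_⟩
    rw [(lin2 _ hu2 (bq_cd hy')).2, tr_add, tr_smul]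
    have h3 := bq_L ha hd hy'
    have hq := bq_pos hy'
    have ht := dl_pos hy'
    have h4 : 0 ≤ s * u y := mul_nonneg hs (by nlinarith only [hv, hC, hN, hq, mul_pos (by positivity : 0 < 4 * C * N) hq])
    have h5 : -N / dl y ^ 3 ≤ tr (a y) (D2 u y) - s * u y := by rw [div_le_iff₀ pv]; exact h y hy'
    have h6 : 4 * C * N * (C⁻¹ / bq y ^ 3) ≤ (-(4 * C * N)) * tr (a y) (D2 bq y) := by
      have := mll h3 (by positivity : 0 ≤ 4 * C * N); linarith only [this]
    have h7 : N / dl y ^ 3 < 4 * C * N * (C⁻¹ / bq y ^ 3) := by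
      have e : 4 * C * N * (C⁻¹ / bq y ^ 3) = 4 * N / bq y ^ 3 := by field_simp
      rw [e, div_lt_div_iff₀ pv pv]
      have := (bq_dl hy'.le).2.2
      nlinarith only [hN, ht, this, mul_pos hN (pow_pos ht 3)]
    have h8 : -N / dl y ^ 3 = -(N / dl y ^ 3) := neg_div _ _
    linarith only [h4, h5, h6, h7, h8]
lemma far_near {M : EE → EB} {N : ℝ} (hs : ∀ x, N(x) < 1 → N(M x) * dl x ^ 3 ≤ N)
    (hh : ∀ x y, N(x) < 1 → N(y - x) ≤ dl x ^ 2 / 16 → N(M y - M x) * dl x ^ 4 ≤ N * √N(y - x)) {x y : EE} (hx : N(x) < 1) (hy : N(y - x) ≤ dl x ^ 2 / 2) :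
    N(M y - M x) * dl x ^ 4 ≤ 20 * N * √N(y - x) := by
  have hN : 0 ≤ N := le_trans (mul_nonneg (nrm0 _) (pow_nonneg (dl_nonneg x) 3)) (hs x hx)
  by_cases h : N(y - x) ≤ dl x ^ 2 / 16
  · have := hh x y hx h
    nlinarith only [this, hN, mul_nonneg hN (Real.sqrt_nonneg N(y - x))]
  · push Not at h
    obtain ⟨h1, h2, h3⟩ := dl_near hx hy
    have hp := dl_pos hx
    have h4 : dl x / 4 ≤ √N(y - x) := Real.le_sqrt_of_sq_le (by linarith only [h, div_pow (dl x) 4 2])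
    have h5 : N(M y - M x) ≤ N(M y) + N(M x) := norm_sub_le (M y) (M x)
    have h6 : N(M y) * dl x ^ 3 ≤ 4 * N := by
      have h8 : dl x ^ 3 ≤ 4 * dl y ^ 3 := (pow_le_pow_left₀ hp.le h2 3).trans (by rw [mul_pow]; nlinarith only [h1, pow_pos (dl_pos h1) 3])
      have := mll h8 (nrm0 (M y))
      linarith [hs y h1]
    have h7 : N(M y - M x) * dl x ^ 3 ≤ 5 * N := by
      have := mlr h5 (pow_nonneg hp.le 3)
      linarith [hs x hx]
    calc N(M y - M x) * dl x ^ 4 = N(M y - M x) * dl x ^ 3 * dl x := by ring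
      _ ≤ 5 * N * dl x := mlr h7 hp.le
      _ ≤ 5 * N * (4 * √N(y - x)) := mll lna lna
      _ = _ := by ring
lemma e_arith {A G r t c N : ℝ} (ht : 0 < t) (ht1 : t ≤ 1) (hr : r = t ^ 2 / 2) (hA : 0 ≤ A) (hc : 0 ≤ c) (hN : 0 < N)
    (h : G ≤ A * ((c * N * t) / r + r * (c * N / t ^ 3))) : G * t ≤ A * (3 * c) * N := by
  have e : ((c * N * t) / r + r * (c * N / t ^ 3)) * t = (5 / 2) * (c * N) := by rw [hr]; field_simp; ring
  calc G * t ≤ A * ((c * N * t) / r + r * (c * N / t ^ 3)) * t := mlr h ht.le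
    _ = A * ((5 / 2) * (c * N)) := by rw [mul_assoc, e]
    _ ≤ A * (3 * (c * N)) := mll (by nlinarith only [hc, hN, mul_nonneg hc hN.le]) hA
    _ = _ := by ring
lemma s_arith {A G S r t c N : ℝ} (ht : 0 < t) (ht1 : t ≤ 1) (hr : r = t ^ 2 / 8) (hA : 0 ≤ A) (hc : 0 ≤ c) (hN : 0 < N) (hS : 0 ≤ S) :
    (r ^ 2 * G ≤ A * (c * N * t + r ^ 2 * √r * (c * N / t ^ 4)) → G * t ^ 3 ≤ 1000 * A * c * N) ∧
    (r ^ 2 * √r * G ≤ A * (c * N * t + r ^ 2 * √r * (c * N / t ^ 4)) * S → G * t ^ 4 ≤ 1000 * A * c * N * S) := by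
  have h1 : √r ≤ t / 2 := by rw [Real.sqrt_le_iff]; constructor <;> nlinarith only [ht, hr]
  have h1' : t / 3 ≤ √r := Real.le_sqrt_of_sq_le (by rw [hr]; nlinarith only [])
  have hcN : 0 ≤ c * N := mul_nonneg hc hN.le
  have h2 : c * N * t + r ^ 2 * √r * (c * N / t ^ 4) ≤ 2 * (c * N) * t := by
    have e : r ^ 2 * √r * (c * N / t ^ 4) = c * N / 64 * √r := by rw [hr]; field_simp; norm_num; ring
    rw [e]
    nlinarith only [h1, hcN, ht, mll h1 hcN, mul_nonneg hcN ht.le]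
  have h3 := mll h2 hA
  have hAc : 0 ≤ A * (c * N) := mul_nonneg hA hcN
  constructor
  · intro h
    have h4 := h.trans h3
    have e1 : r ^ 2 * G = (G * t ^ 3) * t / 64 := by rw [hr]; ring
    rw [e1] at h4
    have h5 : G * t ^ 3 * t ≤ 128 * (A * (c * N)) * t := by linarith only [h4]
    have := le_of_mul_le_mul_right h5 ht
    nlinarith only [hAc, this]
  · intro h
    by_cases hG : G ≤ 0
    · exact (mul_nonpos_of_nonpos_of_nonneg hG pv).trans pv
    push Not at hG
    have h4 := h.trans (mlr h3 hS)
    have e1 : (G * t ^ 4) * (t / 3) / 64 ≤ r ^ 2 * √r * G := by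
      have : (G * t ^ 4) * (t / 3) / 64 ≤ (G * t ^ 4) * √r / 64 := by gcongr
      refine this.trans (le_of_eq ?_); rw [hr]; ring
    have h5 : G * t ^ 4 * t ≤ 384 * (A * (c * N)) * S * t := by linarith only [h4, e1]
    have := le_of_mul_le_mul_right h5 ht
    nlinarith only [this, hAc, hS, mul_nonneg hAc hS]
lemma E1 (hd : 1 ≤ d) {K C S : ℝ} (hK : 0 ≤ K) (hC : 1 ≤ C) (hS : 0 ≤ S) : ∃ A, 0 ≤ A ∧
    ∀ (a : EE → MM), Coef a K C → ∀ (u g : EE → ℝ) (s M N : ℝ), 0 ≤ s → s ≤ S → WX M u → 0 < N → WY N g →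
    (∀ x, N(x) < 1 → tr (a x) (D2 u x) - s * u x = g x) → WX (A * N) u := by
  obtain ⟨A1, hA1, G1⟩ := grad_est (d := d) hK hC
  obtain ⟨A2, hA2, G2⟩ := schauder (d := d) hd hK hC
  set c1 : ℝ := 8 * C * (1 + S) + 4 with hc1
  have hc1p : 0 ≤ c1 := by positivity
  set A3 : ℝ := A1 * (3 * c1) with hA3
  have hA3p : 0 ≤ A3 := by positivity
  set c2 : ℝ := c1 + S * A3 * 2 + 6 with hc2
  have hc2p : 0 ≤ c2 := by positivity
  set A4 : ℝ := 1000 * A2 * c2 with hA4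
  have hA4p : 0 ≤ A4 := by positivity
  refine ⟨6 * C + A3 + 20 * A4, by positivity, fun a ha u g s M N hs hsS hu hN hg he => ?_⟩
  have hb : ∀ x, N(x) = 1 → u x = 0 := fun x hx => abs_nonpos_iff.1 (by simpa [dl_bd hx] using hu.sup x hx.le)
  have S1 : ∀ x, N(x) ≤ 1 → |u x| ≤ 6 * C * N * dl x := by
    intro x hx
    have hg' : ∀ x, N(x) < 1 → -N ≤ g x * dl x ^ 3 ∧ g x * dl x ^ 3 ≤ N := fun x hx => by
      have : |g x * dl x ^ 3| ≤ N := by rw [abs_mul, abs_of_nonneg (pow_nonneg (dl_nonneg x) 3)]; exact hg.sup x hx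
      exact abs_le.1 this
    rw [abs_le]
    constructor
    · have := supb ha hd hs hN (u := fun y => - u y) hu.cd.neg hu.cont.neg (fun x hx => by simp [hb x hx]) (fun x hx => by
        rw [D2_neg, tr_neg]
        have e := he x hx
        have e' : -tr (a x) (D2 u x) - s * -u x = - g x := by rw [← e]; ring
        rw [e']; linarith [(hg' x hx).2]) x hx
      linarith
    · exact supb ha hd hs hN hu.cd hu.cont hb (fun x hx => by rw [he x hx]; exact (hg' x hx).1) x hx
  have S1' : ∀ x y : EE, N(x) < 1 → N(y - x) ≤ dl x ^ 2 / 2 → |u y| ≤ 8 * C * N * dl x := fun x y hx hy => by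
    obtain ⟨h1, h2, h3⟩ := dl_near hx hy
    refine (S1 y h1.le).trans ?_
    have := mll h3 (by positivity : 0 ≤ 6 * C * N)
    have h4 := mul_nonneg (by positivity : 0 ≤ C * N) (dl_nonneg x)
    linarith only [this, h4]
  have gs : ∀ x y : EE, N(x) < 1 → N(y - x) ≤ dl x ^ 2 / 2 → |g y| ≤ 4 * N / dl x ^ 3 := fun x y hx hy => by
    obtain ⟨h1, h2, h3⟩ := dl_near hx hy
    have hp := dl_pos hx
    rw [ldi pv]
    have h8 : dl x ^ 3 ≤ 4 * dl y ^ 3 := (pow_le_pow_left₀ hp.le h2 3).trans (by rw [mul_pow]; nlinarith only [h1, pow_pos (dl_pos h1) 3])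
    have := mll h8 (abs_nonneg (g y))
    linarith [hg.sup y h1]
  have sub : ∀ x : EE, N(x) < 1 → ∀ r, r ≤ dl x ^ 2 / 2 → ∀ y ∈ ball x r, N(y - x) ≤ dl x ^ 2 / 2 := fun x hx r hr y hy =>
    (le_of_lt (by simpa [dist_eq_norm] using hy)).trans hr
  have S2 : ∀ x, N(x) < 1 → N(Df u x) * dl x ≤ A3 * N := by
    intro x hx
    have hp := dl_pos hx
    have h1 := dl_le x
    have hle : dl x ≤ 1 / dl x ^ 3 := by
      rw [ldi pv]
      calc dl x * dl x ^ 3 = dl x ^ 4 := by ring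
        _ ≤ 1 := pow_le_one₀ hp.le h1
    refine e_arith hp h1 rfl hA1 hc1p hN (G1 a ha u x (dl x ^ 2 / 2) (c1 * N * dl x) (c1 * N / dl x ^ 3) pv (by nlinarith only [h1, hp])
      (hu.cd.mono fun y hy => by simpa using (dl_near hx (sub x hx _ le_rfl y hy)).1) (fun y hy => ?_) (fun y hy => ?_))
    · refine (S1' x y hx (sub x hx _ le_rfl y hy)).trans (mlr (mlr ?_ hN.le) hp.le)
      have := mul_nonneg (by positivity : 0 ≤ C) hS
      rw [hc1]; linarith
    · have hy' := sub x hx _ le_rfl y hy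
      have e := he y (dl_near hx hy').1
      have e' : tr (a y) (D2 u y) = g y + s * u y := by linarith
      rw [e']
      have h3 : |s * u y| ≤ S * (8 * C * N * dl x) := by
        rw [abs_mul, abs_of_nonneg hs]; exact mul_le_mul hsS (S1' x y hx hy') (abs_nonneg _) hS
      have h4 : S * (8 * C * N * dl x) ≤ S * (8 * C * N * (1 / dl x ^ 3)) := by clear * - hle hC hN hS; gcongr
      have h5 := gs x y hx hy'
      have e5 : c1 * N / dl x ^ 3 = 4 * N / dl x ^ 3 + S * (8 * C * N * (1 / dl x ^ 3)) + 8 * C * N / dl x ^ 3 := by rw [hc1]; ring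
      have h6 : 0 ≤ 8 * C * N / dl x ^ 3 := by positivity
      linarith only [h3, h4, h5, e5, h6, abs_add_le (g y) (s * u y)]
  have S3 : ∀ x, N(x) < 1 → N(D2 u x) * dl x ^ 3 ≤ A4 * N ∧ ∀ y, N(y - x) ≤ dl x ^ 2 / 16 → N(D2 u y - D2 u x) * dl x ^ 4 ≤ A4 * N * √N(y - x) := by
    intro x hx
    have hp := dl_pos hx
    have h1 := dl_le x
    have hr8 : dl x ^ 2 / 8 ≤ dl x ^ 2 / 2 := by nlinarith only []
    have pair : ∀ y ∈ ball x (dl x ^ 2 / 8), ∀ z ∈ ball x (dl x ^ 2 / 8), N(y - z) ≤ dl z ^ 2 / 2 ∧ N(z) < 1 ∧ dl x ≤ 3 / 2 * dl z ∧ N(y - z) ≤ dl x ^ 2 / 4 := by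
      intro y hy z hz
      obtain ⟨h2, h3, h4⟩ := dl_near hx (sub x hx _ hr8 z hz)
      have h5 : N(y - z) ≤ N(y - x) + N(z - x) := by rw [← dist_eq_norm, ← dist_eq_norm, ← dist_eq_norm]; exact dist_triangle_right y z x
      have h6 : N(y - x) < dl x ^ 2 / 8 := by simpa [dist_eq_norm] using hy
      have h7 : N(z - x) < dl x ^ 2 / 8 := by simpa [dist_eq_norm] using hz
      have h8 : dl x ^ 2 ≤ 2 * dl z ^ 2 := by
        rw [dl_sq hx.le, dl_sq h2.le]; have := ns1 z x; have := dl_sq hx.le; linarith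
      exact ⟨by linarith only [h5, h6, h7, h8], h2, h3, by linarith only [h5, h6, h7]⟩
    have p4 : ∀ z : EE, N(z) < 1 → dl x ≤ 3 / 2 * dl z → dl x ^ 4 ≤ 6 * dl z ^ 4 := fun z hz h => (pow_le_pow_left₀ hp.le h 4).trans (by
      rw [mul_pow]; nlinarith only [hz, pow_pos (dl_pos hz) 4])
    obtain ⟨h5, h6⟩ := G2 a ha u x (dl x ^ 2 / 8) (c2 * N * dl x) (c2 * N / dl x ^ 4) pv (by nlinarith only [h1, hp])
      (hu.cd.mono fun y hy => by simpa using (dl_near hx (sub x hx _ hr8 y hy)).1) (by clear * - hC hS hA1 hN hp; positivity)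
      ⟨6 * M / dl x ^ 4, fun y hy z hz => by
        obtain ⟨q1, q2, q3, q4⟩ := pair y hy z hz
        have := hu.hol z y q2 q1
        rw [div_mul_eq_mul_div, ldi pv]
        have := mll (p4 z q2 q3) (nrm0 (D2 u y - D2 u z))
        linarith⟩
      (fun y hy => (S1' x y hx (sub x hx _ hr8 y hy)).trans (mlr (mlr (by
        have := mul_nonneg (by positivity : 0 ≤ C) hS
        have := mul_nonneg hS hA3p
        rw [hc2, hc1]; linarith) hN.le) hp.le))
      (fun y hy z hz => by
        obtain ⟨q1, q2, q3, q4⟩ := pair y hy z hz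
        have hy1 := (dl_near hx (sub x hx _ hr8 y hy)).1
        have ey := he y hy1
        have ez := he z q2
        have e' : tr (a y) (D2 u y) - tr (a z) (D2 u z) = (g y - g z) + s * (u y - u z) := by rw [← ey, ← ez]; ring
        rw [e']
        have g1 : |g y - g z| ≤ 6 * N / dl x ^ 4 * √N(y - z) := by
          rw [div_mul_eq_mul_div, ldi pv]
          have := mll (p4 z q2 q3) (abs_nonneg (g y - g z))
          linarith only [this, hg, q2, q1, hg.hol z y q2 q1]
        have u1 : |u y - u z| ≤ A3 * N * (3 / 2) / dl x * N(y - z) := by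
          refine mvt (f := u) (fun z hz => (hu.cda (dl_near hx (sub x hx _ hr8 z hz)).1).differentiableAt nnu) (fun z hz => ?_) hy hz
          obtain ⟨w1, w2, w3⟩ := dl_near hx (sub x hx _ hr8 z hz)
          rw [ldi hp]
          have := mll w2 (norm_nonneg (Df u z))
          linarith only [this, S2, w1, S2 z w1]
        have u2 : N(y - z) ≤ dl x * √N(y - z) := by
          have w : √N(y - z) ≤ dl x := by rw [Real.sqrt_le_iff]; exact ⟨hp.le, by nlinarith only [q4]⟩
          calc N(y - z) = √N(y - z) * √N(y - z) := (Real.mul_self_sqrt (norm_nonneg _)).symm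
            _ ≤ _ := mlr w (Real.sqrt_nonneg _)
        have u3 : |u y - u z| ≤ A3 * N * 2 / dl x ^ 4 * √N(y - z) := by
          calc _ ≤ A3 * N * (3 / 2) / dl x * (dl x * √N(y - z)) := u1.trans (mll u2 (by clear * - hA1 hC hS hN hp; positivity))
            _ = A3 * N * (3 / 2) * √N(y - z) := by clear * - hp hN; field_simp
            _ ≤ A3 * N * 2 / dl x ^ 4 * √N(y - z) := by
              refine mlr ?_ (Real.sqrt_nonneg _)
              rw [ldi pv]
              have := mll (pow_le_one₀ hp.le h1 : dl x ^ 4 ≤ 1) (by positivity : 0 ≤ A3 * N)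
              linarith only [this, hA3p, hN, mul_nonneg hA3p hN.le]
        have u4 : |s * (u y - u z)| ≤ S * (A3 * N * 2 / dl x ^ 4 * √N(y - z)) := by
          rw [abs_mul, abs_of_nonneg hs]; exact mul_le_mul hsS u3 (abs_nonneg _) hS
        have e5 : c2 * N / dl x ^ 4 * √N(y - z) = 6 * N / dl x ^ 4 * √N(y - z) + S * (A3 * N * 2 / dl x ^ 4 * √N(y - z)) + c1 * N / dl x ^ 4 * √N(y - z) := by
          rw [hc2]; ring
        have e6 : 0 ≤ c1 * N / dl x ^ 4 * √N(y - z) := by clear * - hC hS hN hp; positivity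
        linarith only [g1, u4, e5, e6, abs_add_le (g y - g z) (s * (u y - u z))])
    refine ⟨(s_arith hp h1 rfl hA2 hc2p hN le_rfl).1 h5, fun y hy => (s_arith hp h1 rfl hA2 hc2p hN (Real.sqrt_nonneg _)).2 (h6 y (by linarith only [hy]))⟩
  have q1 : 0 ≤ C * N := by positivity
  have q2 : 0 ≤ A3 * N := by positivity
  have q3 : 0 ≤ A4 * N := by clear * - hA2 hC hS hA1 hN; positivity
  refine ⟨hu.cd, fun x hx => (S1 x hx).trans (mlr lna (dl_nonneg x)), fun x hx => (S2 x hx).trans lna,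
    fun x hx => (S3 x hx).1.trans lna, fun x y hx hy => ?_⟩
  refine (far_near (M := D2 u) (fun x hx => (S3 x hx).1) (fun x y hx hy => (S3 x hx).2 y hy) hx hy).trans (mlr lna (Real.sqrt_nonneg _))
end
section
open MvPolynomial in
lemma deg_pd (i : Fin d) (p : MvPolynomial (Fin d) ℝ) : (pderiv i p).totalDegree ≤ p.totalDegree - 1 := by
  conv_lhs => rw [p.as_sum, map_sum]
  refine totalDegree_finsetSum_le fun s hs => ?_
  rw [pderiv_monomial]
  by_cases h : s i = 0
  · simp [h]
  refine (totalDegree_monomial_le _ _).trans ?_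
  have h1 := le_totalDegree hs
  have h2 : s = (s - Finsupp.single i 1) + Finsupp.single i 1 :=
    (tsub_add_cancel_of_le (Finsupp.single_le_iff.2 (Nat.one_le_iff_ne_zero.2 h))).symm
  have h3 : (s.sum fun _ e => e) = ((s - Finsupp.single i 1).sum fun _ e => e) + 1 := by
    conv_lhs => rw [h2]
    rw [Finsupp.sum_add_index' smp smp, Finsupp.sum_single_index rfl]
  have h4 : ((s - Finsupp.single i 1).sum fun _ e => e) ≤ p.totalDegree - 1 := by omega
  exact h4
lemma cd2 {f : EE → ℝ} (h : ContDiff ℝ ∞ f) : ContDiff ℝ 2 f := by exact_mod_cast contDiff_infty.1 h 2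
noncomputable def ev (p : MvPolynomial (Fin d) ℝ) (x : EE) : ℝ := MvPolynomial.eval (fun i => x i) p
open MvPolynomial in
lemma ev_fd (p : MvPolynomial (Fin d) ℝ) : ContDiff ℝ ∞ (ev p) ∧ ∀ i, pd (ee i) (ev p) = ev (pderiv i p) := by
  induction p using MvPolynomial.induction_on with
  | C a =>
    have : (ev (C a) : EE → ℝ) = fun _ => a := by funext x; simp [ev]
    rw [this]
    exact ⟨contDiff_const, fun i => by funext x; simp [pd, ev]⟩
  | add p q hp hq =>
    have : (ev (p + q) : EE → ℝ) = fun x => ev p x + ev q x := by funext x; simp [ev]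
    rw [this]
    refine ⟨hp.1.add hq.1, fun i => ?_⟩
    funext x
    have h1 := congrFun (hp.2 i) x
    have h2 := congrFun (hq.2 i) x
    simp only [pd] at h1 h2 ⊢
    rw [fderiv_fun_add (hp.1.differentiable smp x) (hq.1.differentiable smp x), add_apply, h1, h2]
    simp [ev]
  | mul_X p j hp =>
    have hj : ∀ x : EE, HasFDerivAt (fun x : EE => x j) (EuclideanSpace.proj j : EL) x := fun x => (EuclideanSpace.proj j : EL).hasFDerivAt
    have : (ev (p * X j) : EE → ℝ) = fun x => ev p x * x j := by funext x; simp [ev]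
    rw [this]
    refine ⟨hp.1.mul (EuclideanSpace.proj j : EL).contDiff, fun i => ?_⟩
    funext x
    have h1 := congrFun (hp.2 i) x
    simp only [pd] at h1 ⊢
    have h2 : HasFDerivAt (fun x : EE => ev p x * x j) _ x := (hp.1.differentiable smp x).hasFDerivAt.mul (hj x)
    rw [h2.fderiv]
    simp only [add_apply, smul_apply, h1]
    by_cases h : i = j
    · subst h; simp [ev]
    · simp [ev, h, pderiv_X_of_ne (Ne.symm h), Ne.symm h]
open MvPolynomial in
noncomputable def pL : MvPolynomial (Fin d) ℝ →ₗ[ℝ] MvPolynomial (Fin d) ℝ := ∑ i, (pderiv i).toLinearMap ∘ₗ (pderiv i).toLinearMap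
lemma lap_ev (p : MvPolynomial (Fin d) ℝ) (x : EE) : tr 1 (D2 (ev p) x) = ev (pL p) x := by
  rw [tr_one]
  have : ∀ i, D2 (ev p) x (ee i) (ee i) = ev (MvPolynomial.pderiv i (MvPolynomial.pderiv i p)) x := fun i => by
    rw [← pd_pd (cd2 (ev_fd p).1), (ev_fd p).2, (ev_fd _).2]
  simp [this, pL, ev]
open MvPolynomial in
noncomputable def pW : MvPolynomial (Fin d) ℝ := 1 - ∑ i, X i ^ 2
lemma ev_W (q : MvPolynomial (Fin d) ℝ) (x : EE) : ev (pW * q) x = (1 - N(x) ^ 2) * ev q x := by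
  simp [ev, pW, EuclideanSpace.norm_sq_eq]
lemma coef_one : Coef (fun _ : EE => (1 : MM)) 0 1 := by
  refine ⟨le_rfl, le_rfl, fun x y i j => by simp, fun x => Matrix.isSymm_one, fun x z => ?_⟩
  have : quadForm (1 : MM) z = N(z) ^ 2 := by
    simp only [quadForm, EuclideanSpace.norm_sq_eq]; simp [Matrix.one_apply, sq]
  rw [this]; simp
open MvPolynomial in
lemma poly_inj (hd : 1 ≤ d) {q : MvPolynomial (Fin d) ℝ} (h : pL (pW * q) = 0) : q = 0 := by
  have hs := (ev_fd (pW * q)).1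
  have key : ∀ c : ℝ, ∀ x : EE, N(x) ≤ 1 → c * ev (pW * q) x ≤ 0 := by
    intro c x hx
    have e : (fun y : EE => c * ev (pW * q) y) = ev (c • (pW * q)) := by funext y; simp [ev]
    have := fun N (hN : (0:ℝ) < N) => supb coef_one hd (s := 0) le_rfl hN (u := fun y : EE => c * ev (pW * q) y)
      (cd2 (contDiff_const.mul hs)).contDiffOn (continuous_const.mul hs.continuous).continuousOn (fun y hy => by rw [ev_W]; simp [hy])
      (fun y hy => by
        rw [e, lap_ev, map_smul, h]
        simp [ev]; exact hN.le) x hx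
    refine le_of_forall_pos_le_add fun ε hε => ?_
    have := this (ε / 6) lna
    have h1 := dl_le x
    nlinarith only [this, hε, h1, dl_nonneg x]
  obtain ⟨n, hn⟩ : ∃ n : ℕ, n = d := ⟨_, rfl⟩
  refine funext_set (fun _ => Ioo (0:ℝ) (1 / d)) (fun _ => Ioo_infinite pv) fun z hz => ?_
  rw [map_zero]
  set x : EE := WithLp.toLp 2 z with hx
  have hd0 : (0:ℝ) < d := by exact_mod_cast hd
  have hx1 : N(x) ^ 2 < 1 := by
    rw [EuclideanSpace.norm_sq_eq]
    have : ∀ i ∈ Finset.univ, N(x i) ^ 2 < 1 / d := fun i _ => by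
      have h1 := hz i trivial
      have h2 : (1:ℝ) / d ≤ 1 := by rw [div_le_one hd0]; exact_mod_cast hd
      have h3 : x i = z i := rfl
      rw [nea, sq_abs, h3]
      simp only [mem_Ioo] at h1
      nlinarith only [h1, h2, h1.1, h1.2]
    calc _ < ∑ i : Fin d, (1:ℝ) / d := Finset.sum_lt_sum_of_nonempty ⟨⟨0, hd⟩, Finset.mem_univ _⟩ this
      _ = 1 := by simp; field_simp
  have hx2 : N(x) ≤ 1 := by nlinarith only [hx1, norm_nonneg x]
  have h1 := key 1 x hx2
  have h2 := key (-1) x hx2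
  have h3 : ev (pW * q) x = 0 := by linarith
  rw [ev_W] at h3
  exact (mul_eq_zero.1 h3).resolve_left lna
open MvPolynomial in
lemma poly_sol (hd : 1 ≤ d) (p : MvPolynomial (Fin d) ℝ) : ∃ q, pL (pW * q) = p := by
  set n := p.totalDegree
  have hdeg : ∀ q ∈ restrictTotalDegree (Fin d) ℝ n, pL (pW * q) ∈ restrictTotalDegree (Fin d) ℝ n := by
    intro q hq
    rw [mem_restrictTotalDegree] at hq
    have hW : (pW * q).totalDegree ≤ n + 2 := by
      refine (totalDegree_mul _ _).trans ?_
      have : (pW : MvPolynomial (Fin d) ℝ).totalDegree ≤ 2 := by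
        refine (totalDegree_sub _ _).trans (max_le smp (totalDegree_finsetSum_le fun i _ => ?_))
        refine (totalDegree_pow _ _).trans smp
      omega
    have e : pL (pW * q) = ∑ i, pderiv i (pderiv i (pW * q)) := by simp [pL]
    rw [e]
    refine Submodule.sum_mem _ fun i _ => ?_
    rw [mem_restrictTotalDegree]
    have h1 := deg_pd i (pderiv i (pW * q))
    have h2 := deg_pd i (pW * q)
    omega
  set T : MvPolynomial (Fin d) ℝ →ₗ[ℝ] MvPolynomial (Fin d) ℝ := pL ∘ₗ LinearMap.mulLeft ℝ pW with hT
  have hinj : Function.Injective (T.restrict hdeg) := by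
    rw [← LinearMap.ker_eq_bot, LinearMap.ker_eq_bot']
    intro q hq
    exact Subtype.ext (poly_inj hd (congrArg Subtype.val hq))
  obtain ⟨q, hq⟩ := LinearMap.injective_iff_surjective.1 hinj ⟨p, by rw [mem_restrictTotalDegree]⟩
  exact ⟨q, congrArg Subtype.val hq⟩
lemma ball_bd {E : Type*} [NormedAddCommGroup E] {f : EE → E} (hf : Continuous f) : ∃ c, 0 ≤ c ∧ ∀ x, N(x) ≤ 1 → N(f x) ≤ c := by
  obtain ⟨c, hc⟩ := (isCompact_closedBall (0 : EE) 1).exists_bound_of_continuousOn hf.continuousOn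
  exact ⟨c, (norm_nonneg _).trans (hc 0 smp), fun x hx => hc x (by simpa using hx)⟩
lemma c1_lip {E : Type*} [NormedAddCommGroup E] [NormedSpace ℝ E] {f : EE → E} (hf : ContDiff ℝ ∞ f) :
    ∃ c, 0 ≤ c ∧ ∀ x y, N(x) < 1 → N(y) < 1 → N(f y - f x) ≤ c * N(y - x) := by
  obtain ⟨c, p, h⟩ := ball_bd (hf.continuous_fderiv smp)
  exact ⟨c, p, fun x y hx hy => (convex_ball (0 : EE) 1).norm_image_sub_le_of_norm_fderiv_le (fun z _ => hf.differentiable smp z)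
      (fun z hz => h z (by have : N(z) < 1 := by simpa using hz
                           exact this.le)) (by simpa using hx) (by simpa using hy)⟩
lemma WX_smooth {f : EE → ℝ} (hf : ContDiff ℝ ∞ f) : ∃ M, WX M (fun x => (1 - N(x) ^ 2) * f x) := by
  set u : EE → ℝ := fun x => (1 - N(x) ^ 2) * f x with hu
  have hus : ContDiff ℝ ∞ u := (contDiff_const.sub (contDiff_norm_sq ℝ)).mul hf
  have hu1 : ContDiff ℝ ∞ (Df u) := hus.fderiv_right smp
  have hu2 : ContDiff ℝ ∞ (D2 u) := hu1.fderiv_right smp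
  obtain ⟨c0, p0, h0⟩ := ball_bd hf.continuous
  obtain ⟨c1, p1, h1⟩ := ball_bd hu1.continuous
  obtain ⟨c2, p2, h2⟩ := ball_bd hu2.continuous
  obtain ⟨c3, p3, h3⟩ := c1_lip hu2
  refine ⟨2 * c0 + c1 + c2 + c3, (cd2 hus).contDiffOn, fun x hx => ?_, fun x hx => ?_, fun x hx => ?_, fun x y hx hy => ?_⟩
  · have t0 := dl_nonneg x
    have t1 := dl_le x
    have t2 := dl_sq hx
    have e : 1 - N(x) ^ 2 ≤ 2 * dl x := by nlinarith only [t2, hx, t0, t1, norm_nonneg x]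
    have e0 : 0 ≤ 1 - N(x) ^ 2 := by nlinarith only [hx, t2, norm_nonneg x]
    have e2 := h0 x hx
    rw [nea] at e2
    rw [hu, abs_mul, abs_of_nonneg e0]
    calc _ ≤ 2 * dl x * c0 := mul_le_mul e e2 (abs_nonneg _) pv
      _ ≤ _ := by nlinarith only [p1, t0, p2, p3]
  · have := mul_le_mul (h1 x hx.le) (dl_le x) (dl_nonneg x) p1
    linarith
  · have := mul_le_mul (h2 x hx.le) (pow_le_one₀ (n := 3) (dl_nonneg x) (dl_le x)) (by have := dl_nonneg x; positivity) p2
    linarith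
  · have hy1 := (dl_near hx hy).1
    have k := h3 x y hx hy1
    have t0 := dl_nonneg x
    have t1 := dl_le x
    have hh : N(y - x) ≤ √N(y - x) := Real.le_sqrt_of_sq_le (by
      have h5 : N(y - x) ≤ 1 := hy.trans (by nlinarith only [t1, t0])
      rw [sq]; exact mul_le_of_le_one_left (norm_nonneg _) h5)
    have k2 : N(D2 u y - D2 u x) ≤ c3 * √N(y - x) := k.trans (mll hh p3)
    have k3 := mul_le_mul k2 (pow_le_one₀ (n := 4) t0 t1) pv pv
    have := Real.sqrt_nonneg N(y - x)
    nlinarith only [k3, p0, this, p1, p2, mul_nonneg p0 this, mul_nonneg p1 this, mul_nonneg p2 this]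
end
section
lemma exists_proj {ρ : ℝ} (hρ : 0 ≤ ρ) : ∃ P : EE → EE, (∀ x y, N(P x - P y) ≤ N(x - y)) ∧ (∀ x, N(P x) ≤ ρ) ∧ ∀ x, N(x) ≤ ρ → P x = x := by
  have h : ∀ x : EE, ∃ v, N(v) ≤ ρ ∧ ∀ w, N(w) ≤ ρ → inner ℝ (x - v) (w - v) ≤ 0 := fun x => by
    obtain ⟨v, hv, e⟩ := exists_norm_eq_iInf_of_complete_convex (K := closedBall (0 : EE) ρ) ⟨0, by simpa using hρ⟩
      isClosed_closedBall.isComplete (convex_closedBall _ _) x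
    have := (norm_eq_iInf_iff_real_inner_le_zero (convex_closedBall _ _) hv).1 e
    exact ⟨v, by simpa using hv, fun w hw => this w (by simpa using hw)⟩
  choose P h1 h2 using h
  refine ⟨P, fun x y => ?_, h1, fun x hx => ?_⟩
  · have e1 := h2 x (P y) (h1 y)
    have e2 := h2 y (P x) (h1 x)
    have e3 : inner ℝ (x - P x) (P y - P x) + inner ℝ (y - P y) (P x - P y) = N(P x - P y) ^ 2 - inner ℝ (x - y) (P x - P y) := by
      rw [← real_inner_self_eq_norm_sq]; simp only [inner_sub_left, inner_sub_right]; ring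
    have e4 := real_inner_le_norm (x - y) (P x - P y)
    by_contra hc
    push Not at hc
    nlinarith only [e1, e2, e3, e4, hc, norm_nonneg (x - y)]
  · have e1 := h2 x x hx
    rw [real_inner_self_nonpos, sub_eq_zero] at e1
    exact e1.symm
open MvPolynomial in
lemma landau {G : EE → ℝ} {c : ℝ} (hb : ∀ x, |G x| ≤ c) (hh : ∀ x y, |G x - G y| ≤ c * √N(x - y)) (h0 : ∀ x, 2 ≤ N(x) → G x = 0) :
    ∃ p : ℕ → MvPolynomial (Fin d) ℝ, (∀ m x, N(x) ≤ 1 → |ev (p m) x| ≤ c) ∧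
      (∀ m x y, N(x) ≤ 1 → N(y) ≤ 1 → |ev (p m) x - ev (p m) y| ≤ c * √N(x - y)) ∧ ∀ x, N(x) ≤ 1 → Tendsto (fun m => ev (p m) x) atTop (𝓝 (G x)) := by
  have hG : Continuous G := by
    rw [Metric.continuous_iff']
    intro x ε hε
    have : Continuous fun y : EE => c * √N(y - x) := by fun_prop
    filter_upwards [(this.tendsto x).eventually_lt_const (show c * √N(x - x) < ε by simpa using hε)] with y hy
    exact (hh y x).trans_lt hy
  have hGs : HasCompactSupport G := HasCompactSupport.intro (isCompact_closedBall (0 : EE) 2) fun x hx => h0 x (by simp at hx; exact hx.le)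
  set S := closedBall (0 : EE) 3 with hS
  have hSc : IsCompact S := isCompact_closedBall 0 3
  set k : ℕ → EE → ℝ := fun m z => (9 - N(z) ^ 2) ^ m with hk
  have hkc : ∀ m, Continuous (k m) := fun m => by simp only [hk]; fun_prop
  have hk0 : ∀ m, ∀ z ∈ S, 0 ≤ k m z := fun m z hz => pow_nonneg (by
    have : N(z) ≤ 3 := by simpa [hS] using hz
    nlinarith [norm_nonneg z]) m
  have hint : ∀ (f : EE → ℝ), Continuous f → IntegrableOn f S := fun f hf => hf.continuousOn.integrableOn_compact hSc
  set I : ℕ → ℝ := fun m => ∫ z in S, k m z with hI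
  have hI0 : ∀ m, 0 ≤ I m := fun m => setIntegral_nonneg measurableSet_closedBall (hk0 m)
  set b : ℕ → EE → ℝ := fun m x => (I m)⁻¹ * ∫ z in S, k m z * G (x - z) with hbdef
  have hGx : ∀ x : EE, Continuous fun z => G (x - z) := fun x => hG.comp (by fun_prop)
  have bd : ∀ m (f : EE → ℝ) (B : ℝ), 0 ≤ B → Continuous f → (∀ z, |f z| ≤ B) → |(I m)⁻¹ * ∫ z in S, k m z * f z| ≤ B := by
    intro m f B hB hf hfB
    have h1 : |∫ z in S, k m z * f z| ≤ I m * B := by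
      rw [hI, ← integral_mul_const, ← nea]
      refine norm_integral_le_of_norm_le (hint _ ((hkc m).mul continuous_const)) ?_
      filter_upwards [self_mem_ae_restrict measurableSet_closedBall] with z hz
      rw [nea, abs_mul, abs_of_nonneg (hk0 m z hz)]
      exact mll (hfB z) (hk0 m z hz)
    rw [abs_mul, abs_of_nonneg (inv_nonneg.2 (hI0 m))]
    rcases (hI0 m).eq_or_lt with e | e
    · rw [← e]; simpa using hB
    · calc _ ≤ (I m)⁻¹ * (I m * B) := mll h1 (inv_nonneg.2 e.le)
        _ = B := by field_simp
  have hc0 : 0 ≤ c := (abs_nonneg _).trans (hb 0)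
  have hpoly : ∀ m, ∃ p : MvPolynomial (Fin d) ℝ, ∀ x, N(x) ≤ 1 → ev p x = b m x := by
    intro m
    set Q : MvPolynomial (Fin d) C(EE, ℝ) := (C 9 - ∑ i, (X i - C ⟨fun y => y i, by fun_prop⟩) ^ 2) ^ m with hQ
    refine ⟨∑ s ∈ Q.support, C ((I m)⁻¹ * ∫ y, (Q.coeff s) y * G y) * ∏ i, X i ^ s i, fun x hx => ?_⟩
    have e1 : ∫ z in S, k m z * G (x - z) = ∫ y, k m (x - y) * G y := by
      have h1 : ∀ z, S.indicator (fun z => k m z * G (x - z)) z = k m z * G (x - z) := fun z => by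
        by_cases hz : z ∈ S
        · simp [hz]
        · have : 3 < N(z) := by simpa [hS] using hz
          have h2 : 2 ≤ N(x - z) := by have := norm_sub_norm_le z x; rw [norm_sub_rev]; linarith
          simp [h0 _ h2]
      rw [← integral_indicator measurableSet_closedBall, integral_congr_ae (Eventually.of_forall h1),
        ← integral_sub_left_eq_self (fun z => k m z * G (x - z)) volume x]
      simp
    have e2 : ∀ y, k m (x - y) = ∑ s ∈ Q.support, (Q.coeff s) y * ∏ i, x i ^ s i := fun y => by
      have h1 := eval₂_eq' ((Pi.evalRingHom (fun _ : EE => ℝ) y).comp (ContinuousMap.coeFnRingHom)) (fun i => x i) Q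
      simp only [RingHom.comp_apply, Pi.evalRingHom_apply, ContinuousMap.coeFnRingHom_apply] at h1
      rw [← h1, hQ]
      simp only [hk, EuclideanSpace.norm_sq_eq, eval₂_pow, eval₂_sub, eval₂_sum, eval₂_X, eval₂_C]
      simp
      rfl
    simp only [hbdef]
    rw [e1]
    simp only [e2, Finset.sum_mul]
    rw [integral_finsetSum _ fun s _ => ?_, Finset.mul_sum]
    · simp only [ev, map_sum, map_mul, eval_C, map_prod, map_pow, eval_X]
      refine Finset.sum_congr rfl fun s _ => ?_
      rw [mul_assoc, ← integral_mul_const]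
      congr 2; funext y; ring
    · exact Continuous.integrable_of_hasCompactSupport (((Q.coeff s).continuous.mul continuous_const).mul hG) hGs.mul_left
  choose p hp using hpoly
  refine ⟨p, fun m x hx => ?_, fun m x y hx hy => ?_, fun x hx => ?_⟩
  · rw [hp m x hx]; exact bd m _ c hc0 (hGx x) fun z => hb _
  · rw [hp m x hx, hp m y hy, hbdef]
    have := bd m (fun z => G (x - z) - G (y - z)) (c * √N(x - y)) pv ((hGx x).sub (hGx y)) fun z => by
      simpa using hh (x - z) (y - z)
    simp only [mul_sub] at this
    have ii : ∀ x, IntegrableOn (fun z => k m z * G (x - z)) S := fun x => hint _ ((hkc m).mul (hGx x))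
    rw [integral_sub (ii x) (ii y), mul_sub] at this
    exact this
  · have h1 := tendsto_setIntegral_pow_smul_of_unique_maximum_of_isCompact_of_continuousOn (μ := volume) (x₀ := 0) hSc
      (c := fun z : EE => 9 - N(z) ^ 2) (by fun_prop) (fun y _ hy => by
        have := norm_pos_iff.2 hy
        simp; positivity) (fun y hy => by simpa [hk] using hk0 1 y hy) smp (by
        refine subset_closure (mem_interior_iff_mem_nhds.2 (closedBall_mem_nhds 0 nnu))) (hGx x).continuousOn
    simp only [smul_eq_mul, sub_zero] at h1
    exact h1.congr fun m => (hp m x hx).symm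
end
section
lemma tr_cont (A : MM) : Continuous fun M : EB => tr A M := by
  unfold tr
  exact continuous_finsetSum _ fun i _ => continuous_finsetSum _ fun j _ =>
    continuous_const.mul ((continuous_id.clm_apply continuous_const).clm_apply continuous_const)
lemma hyp_of {X : Type*} [TopologicalSpace X] {f : ℕ → X} {l : X} (h : Tendsto f atTop (𝓝 l)) : Tendsto f (hyperfilter ℕ : Filter ℕ) (𝓝 l) :=
  h.mono_left Nat.hyperfilter_le_atTop
lemma chi_bd {a b e : ℝ} (h : |a - b| ≤ e) : |min 1 (max 0 (2 - a)) - min 1 (max 0 (2 - b))| ≤ √e := by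
  have he : 0 ≤ e := (abs_nonneg _).trans h
  have h1 : |min 1 (max 0 (2 - a)) - min 1 (max 0 (2 - b))| ≤ e := by
    refine (abs_min_sub_min_le_max _ _ _ _).trans (max_le (by simpa using he) ((abs_max_sub_max_le_max _ _ _ _).trans (max_le (by simpa using he) ?_)))
    rw [abs_le] at h ⊢; constructor <;> linarith [h.1, h.2]
  have h2 : |min 1 (max 0 (2 - a)) - min 1 (max 0 (2 - b))| ≤ 1 := by
    have : ∀ t : ℝ, 0 ≤ min 1 (max 0 (2 - t)) ∧ min 1 (max 0 (2 - t)) ≤ 1 := fun t => ⟨le_min zero_le_one (le_max_left _ _), min_le_left _ _⟩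
    rw [abs_le]; constructor <;> linarith [(this a).1, (this a).2, (this b).1, (this b).2]
  refine Real.le_sqrt_of_sq_le (le_trans ?_ h1)
  rw [sq]; exact mul_le_of_le_one_left (abs_nonneg _) h2
lemma trunc {g : EE → ℝ} {N ρ : ℝ} (hN : 0 < N) (hg : WY N g) (h0 : 0 ≤ ρ) (h1 : ρ < 1) :
    ∃ G : EE → ℝ, ∃ c, 0 < c ∧ WY N G ∧ (∀ x, |G x| ≤ c) ∧ (∀ x y, |G x - G y| ≤ c * √N(x - y)) ∧ (∀ x, 2 ≤ N(x) → G x = 0) ∧ ∀ x, N(x) ≤ ρ → G x = g x := by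
  obtain ⟨P, hP1, hP2, hP3⟩ := exists_proj (d := d) h0
  have hPn : ∀ x, N(P x) ≤ N(x) := fun x => by
    have := hP1 x 0
    rwa [hP3 0 (by simpa using h0), sub_zero, sub_zero] at this
  have hPd : ∀ x, N(x) < 1 → dl x ≤ dl (P x) := fun x hx => Real.sqrt_le_sqrt (by linarith [hPn x])
  have hP4 : ∀ x, N(P x) < 1 := fun x => (hP2 x).trans_lt h1
  set χ : EE → ℝ := fun x => min 1 (max 0 (2 - N(x))) with hχ
  have χ1 : ∀ x, N(x) ≤ 1 → χ x = 1 := fun x hx => min_eq_left (le_max_of_le_right lna)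
  have χb : ∀ x, |χ x| ≤ 1 := fun x => abs_le.2 ⟨by linarith [le_min zero_le_one (le_max_left 0 (2 - N(x)))], min_le_left _ _⟩
  have χl : ∀ x y, |χ x - χ y| ≤ √N(x - y) := fun x y => chi_bd (abs_norm_sub_norm_le x y)
  obtain ⟨t, ht, ht2⟩ : ∃ t : ℝ, 0 < t ∧ t ^ 2 = 1 - ρ := ⟨√(1 - ρ), Real.sqrt_pos.2 lna, Real.sq_sqrt lna⟩
  have htd : ∀ x, t ≤ dl (P x) := fun x => sqle (dl_nonneg _) (by rw [dl_sq (hP4 x).le, ht2]; linarith [hP2 x])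
  have gb : ∀ x, |g (P x)| ≤ N / t ^ 3 := fun x => by
    rw [ldi pv]
    exact (mll (pow_le_pow_left₀ ht.le (htd x) 3) (abs_nonneg _)).trans (hg.sup _ (hP4 x))
  have gh : ∀ x y, |g (P x) - g (P y)| ≤ (N / t ^ 4 + 2 * (N / t ^ 3) / (t / 2)) * √N(x - y) := fun x y => by
    rw [add_mul]
    have p1 : 0 ≤ N / t ^ 4 * √N(x - y) := by positivity
    have p2 : 0 ≤ 2 * (N / t ^ 3) / (t / 2) * √N(x - y) := by positivity
    by_cases h : N(P x - P y) ≤ t ^ 2 / 2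
    · have h2 := hg.hol (P y) (P x) (hP4 y) (h.trans (by have := pow_le_pow_left₀ ht.le (htd y) 2; linarith))
      have h3 := mll (pow_le_pow_left₀ ht.le (htd y) 4) (abs_nonneg (g (P x) - g (P y)))
      have h4 : |g (P x) - g (P y)| ≤ N / t ^ 4 * √N(x - y) := by
        rw [div_mul_eq_mul_div, ldi pv]
        exact h3.trans (h2.trans (mll (Real.sqrt_le_sqrt (hP1 x y)) hN.le))
      linarith
    · push Not at h
      have h2 : t / 2 ≤ √N(x - y) := Real.le_sqrt_of_sq_le (by nlinarith only [h, hP1, hP1 x y, sq_nonneg t])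
      have h3 : |g (P x) - g (P y)| ≤ 2 * (N / t ^ 3) := (abs_sub _ _).trans (by linarith [gb x, gb y])
      have h4 : 2 * (N / t ^ 3) ≤ 2 * (N / t ^ 3) / (t / 2) * √N(x - y) := by
        rw [div_mul_eq_mul_div, ldi pv]
        exact mll h2 pv
      linarith only [p1, h3, h4]
  set c2 := N / t ^ 4 + 2 * (N / t ^ 3) / (t / 2) with hc2
  have c2p : 0 < c2 := by positivity
  have Bp : 0 < N / t ^ 3 := by positivity
  refine ⟨fun x => g (P x) * χ x, N / t ^ 3 + c2, by positivity, ⟨fun x hx => ?_, fun x y hx hy => ?_⟩, fun x => ?_, fun x y => ?_, fun x hx => ?_, fun x hx => ?_⟩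
  · rw [χ1 x hx.le, mul_one]
    exact (mll (pow_le_pow_left₀ (dl_nonneg x) (hPd x hx) 3) (abs_nonneg _)).trans (hg.sup _ (hP4 x))
  · simp only [χ1 x hx.le, χ1 y (dl_near hx hy).1.le, mul_one]
    have h2 := pow_le_pow_left₀ (dl_nonneg x) (hPd x hx) 2
    refine (mll (pow_le_pow_left₀ (dl_nonneg x) (hPd x hx) 4) (abs_nonneg _)).trans ((hg.hol _ _ (hP4 x) ?_).trans ?_)
    · linarith [hP1 y x]
    · exact mll (Real.sqrt_le_sqrt (hP1 y x)) hN.le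
  · rw [abs_mul]
    have := mul_le_mul (gb x) (χb x) (abs_nonneg _) Bp.le
    linarith
  · have e : g (P x) * χ x - g (P y) * χ y = (g (P x) - g (P y)) * χ x + g (P y) * (χ x - χ y) := by ring
    have e1 := mul_le_mul (gh x y) (χb x) (abs_nonneg _) pv
    have e2 := mul_le_mul (gb y) (χl x y) (abs_nonneg _) Bp.le
    rw [← abs_mul] at e1 e2
    rw [e]
    refine (abs_add_le _ _).trans ?_
    linarith
  · have : χ x = 0 := by simp only [hχ]; rw [max_eq_left lna, min_eq_right zero_le_one]
    simp [this]
  · simp only [χ1 x (hx.trans h1.le), hP3 x hx, mul_one]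
lemma lap_sol (hd : 1 ≤ d) : ∃ A, 0 ≤ A ∧ ∀ (g : EE → ℝ) (N : ℝ), 0 < N → WY N g → ∃ u, WX (A * N) u ∧ ∀ x, N(x) < 1 → tr 1 (D2 u x) = g x := by
  obtain ⟨A, hA, E⟩ := E1 hd (K := 0) (C := 1) (S := 0) le_rfl le_rfl le_rfl
  have E' : ∀ (u g : EE → ℝ) (M N : ℝ), WX M u → 0 < N → WY N g → (∀ x, N(x) < 1 → tr 1 (D2 u x) = g x) → WX (A * N) u :=
    fun u g M N h1 h2 h3 h4 => E _ coef_one u g 0 M N le_rfl le_rfl h1 h2 h3 fun x hx => by simpa using h4 x hx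
  have lim : ∀ (u g : ℕ → EE → ℝ) (g0 : EE → ℝ) (M : ℝ), (∀ k, WX M (u k)) → (∀ k x, N(x) < 1 → tr 1 (D2 (u k) x) = g k x) →
      (∀ x, N(x) < 1 → Tendsto (fun k => g k x) atTop (𝓝 (g0 x))) → ∃ w, WX M w ∧ ∀ x, N(x) < 1 → tr 1 (D2 w x) = g0 x := by
    intro u g g0 M h1 h2 h3
    obtain ⟨w, hw, hl⟩ := CL u h1
    refine ⟨w, hw, fun x hx => tendsto_nhds_unique (((tr_cont 1).tendsto _).comp (hl x hx).2.2) ((hyp_of (h3 x hx)).congr fun k => (h2 k x hx).symm)⟩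
  refine ⟨A, hA, fun g N hN hg => ?_⟩
  have step : ∀ k : ℕ, ∃ (u G : EE → ℝ), WX (A * N) u ∧ (∀ x, N(x) < 1 → tr 1 (D2 u x) = G x) ∧ ∀ x, N(x) ≤ 1 - 1 / ((k:ℝ) + 1) → G x = g x := by
    intro k
    have hk : (0:ℝ) < (k:ℝ) + 1 := by positivity
    obtain ⟨G, c, hc, hG, b1, b2, b3, b4⟩ := trunc hN hg (ρ := 1 - 1 / ((k:ℝ) + 1)) (by rw [sub_nonneg, div_le_one hk]; linarith [(Nat.cast_nonneg k : (0:ℝ) ≤ k)])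
      (by have : 0 < 1 / ((k:ℝ) + 1) := by positivity
          linarith)
    obtain ⟨p, p1, p2, p3⟩ := landau b1 b2 b3
    choose q hq using fun m => poly_sol hd (p m)
    have hu : ∀ m, ∀ x, N(x) < 1 → tr 1 (D2 (ev (pW * q m)) x) = ev (p m) x := fun m x hx => by rw [lap_ev, hq]
    have hX : ∀ m, WX (A * c) (ev (pW * q m)) := fun m => by
      obtain ⟨M, hM⟩ := WX_smooth (ev_fd (q m)).1
      have e : (fun x : EE => (1 - N(x) ^ 2) * ev (q m) x) = ev (pW * q m) := funext fun x => (ev_W _ x).symm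
      rw [e] at hM
      refine E' _ _ M c hM hc ⟨fun x hx => ?_, fun x y hx hy => ?_⟩ (hu m)
      · have := mul_le_mul (p1 m x hx.le) (pow_le_one₀ (n := 3) (dl_nonneg x) (dl_le x)) (pow_nonneg (dl_nonneg x) 3) hc.le
        linarith
      · have := mul_le_mul (p2 m y x (dl_near hx hy).1.le hx.le) (pow_le_one₀ (n := 4) (dl_nonneg x) (dl_le x)) (pow_nonneg (dl_nonneg x) 4) pv
        linarith
    obtain ⟨w, hw, hwe⟩ := lim _ _ G _ hX hu fun x hx => p3 x hx.le
    exact ⟨w, G, E' _ _ _ _ hw hN hG hwe, hwe, b4⟩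
  choose u G h1 h2 h3 using step
  refine lim u G g _ h1 h2 fun x hx => tendsto_const_nhds.congr' ?_
  have : Tendsto (fun k : ℕ => 1 - 1 / ((k:ℝ) + 1)) atTop (𝓝 (1 - 0)) := tendsto_const_nhds.sub tendsto_one_div_add_atTop_nhds_zero_nat
  filter_upwards [this.eventually_const_lt (show N(x) < 1 - 0 by simpa using hx)] with k hk
  exact (h3 k x hk.le).symm
end
section
lemma lip0 {G : ℝ} {u : EE → ℝ} (hc : ContDiffOn ℝ 2 u (ball 0 1)) (hg : ∀ x, N(x) < 1 → N(Df u x) * dl x ≤ G) {x y : EE} (hx : N(x) < 1)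
    (hy : N(y - x) ≤ dl x ^ 2 / 2) : |u y - u x| * dl x ≤ 2 * G * N(y - x) := by
  have hp := dl_pos hx
  have := (convex_closedBall x (dl x ^ 2 / 2)).norm_image_sub_le_of_norm_fderiv_le (f := u) (C := 2 * G / dl x)
    (fun z hz => (hc.contDiffAt (nb (dl_near hx (by simpa [dist_eq_norm] using hz)).1)).differentiableAt nnu)
    (fun z hz => by
      obtain ⟨h1, h2, h3⟩ := dl_near hx (by simpa [dist_eq_norm] using hz)
      rw [ldi hp]
      have := mll h2 (norm_nonneg (Df u z))
      have h0 := mul_nonneg (norm_nonneg (Df u z)) (dl_nonneg z)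
      linarith only [this, h0, hg, h1, hg z h1]) (by simp; positivity : x ∈ _) (by simpa [dist_eq_norm] using hy : y ∈ _)
  rw [div_mul_eq_mul_div, ldi hp] at this
  exact this
lemma sq_near {x y : EE} (hy : N(y - x) ≤ dl x ^ 2 / 2) : N(y - x) ≤ dl x * √N(y - x) := by
  have hp := dl_nonneg x
  have w : √N(y - x) ≤ dl x := by rw [Real.sqrt_le_iff]; exact ⟨hp, by nlinarith only [hy]⟩
  calc N(y - x) = √N(y - x) * √N(y - x) := (Real.mul_self_sqrt (norm_nonneg _)).symm
    _ ≤ _ := mlr w (Real.sqrt_nonneg _)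
lemma dlp (x : EE) (n : ℕ) : 0 ≤ dl x ^ n ∧ dl x ^ n ≤ 1 := ⟨pow_nonneg (dl_nonneg x) n, pow_le_one₀ (dl_nonneg x) (dl_le x)⟩
lemma toWY {M : ℝ} {u : EE → ℝ} (hM : 0 ≤ M) (hc : ContDiffOn ℝ 2 u (ball 0 1)) (hs : ∀ x, N(x) ≤ 1 → |u x| ≤ M * dl x)
    (hg : ∀ x, N(x) < 1 → N(Df u x) * dl x ≤ M) : WY (2 * M) u := by
  refine ⟨fun x hx => ?_, fun x y hx hy => ?_⟩
  · have h1 := hs x hx.le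
    have h2 : M * dl x ≤ M * 1 := mll (dl_le x) hM
    have := mul_le_mul (h1.trans h2) (dlp x 3).2 (dlp x 3).1 lna
    linarith
  · have h1 := lip0 hc hg hx hy
    have h3 : N(y - x) ≤ √N(y - x) := (sq_near hy).trans (mul_le_of_le_one_left (Real.sqrt_nonneg _) (dl_le x))
    have h2 := mll h3 (by positivity : 0 ≤ 2 * M)
    have := mul_le_mul (h1.trans h2) (dlp x 3).2 (dlp x 3).1 pv
    calc _ = |u y - u x| * dl x * dl x ^ 3 := by ring
      _ ≤ _ := by linarith
lemma WX.toWY {M : ℝ} {u : EE → ℝ} (h : WX M u) : WY (2 * M) u := DPE.toWY h.nonneg h.cd h.sup h.grad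
lemma WY.nonneg {M : ℝ} {u : EE → ℝ} (h : WY M u) : 0 ≤ M :=
  (mul_nonneg (abs_nonneg _) (dlp 0 3).1).trans (h.sup 0 smp)
lemma WY.lin {N M : ℝ} {f g : EE → ℝ} (hf : WY N f) (hg : WY M g) (c : ℝ) : WY (N + |c| * M) (fun y => f y + c * g y) := by
  refine ⟨fun x hx => ?_, fun x y hx hy => ?_⟩
  · have h1 := mlr (abs_add_le (f x) (c * g x)) (dlp x 3).1
    have h2 := mll (hg.sup x hx) (abs_nonneg c)
    rw [abs_mul] at h1
    linarith [hf.sup x hx]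
  · have h1 := mlr (abs_add_le (f y - f x) (c * (g y - g x))) (dlp x 4).1
    have h2 := mll (hg.hol x y hx hy) (abs_nonneg c)
    rw [abs_mul] at h1
    have e : f y + c * g y - (f x + c * g x) = f y - f x + c * (g y - g x) := by ring
    rw [e]
    linarith [hf.hol x y hx hy]
lemma WX.tr {a : EE → MM} {K C M : ℝ} (ha : Coef a K C) {u : EE → ℝ} (h : WX M u) :
    WY ((4 * d ^ 2 * K + d * C) * M) (fun x => DPE.tr (a x) (D2 u x)) := by
  have hM := h.nonneg
  have hK := ha.hK
  have hC : 0 ≤ C := by linarith [ha.hC]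
  have q1 : 0 ≤ 4 * d ^ 2 * K * M := by positivity
  refine ⟨fun x hx => ?_, fun x y hx hy => ?_⟩
  · have h1 := mlr (ha.tr_bd x (D2 u x)) (dlp x 3).1
    have h2 := mll (h.hess x hx) (by positivity : 0 ≤ d * C)
    linarith
  · have e : DPE.tr (a y) (D2 u y) - DPE.tr (a x) (D2 u x) = DPE.tr (a y - a x) (D2 u y) + DPE.tr (a x) (D2 u y - D2 u x) := by
      rw [tr_sub', tr_sub]; ring
    have p := dl_pos hx
    have h1 := DPE.tr_bd (A := a y - a x) (fun i j => ha.lip y x i j) (D2 u y)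
    have h2 := ha.tr_bd x (D2 u y - D2 u x)
    have h3 := h.hess' hx hy
    rw [ldi pv] at h3
    have h4 := mll (h.hol x y hx hy) (by positivity : 0 ≤ d * C)
    have h5 := sq_near hy
    have h6 : (d:ℝ) ^ 2 * (K * N(y - x)) * N(D2 u y) * dl x ^ 4 ≤ 4 * d ^ 2 * K * M * √N(y - x) := by
      have i1 : N(D2 u y) * dl x ^ 4 ≤ 4 * M := by
        have := mul_le_mul h3 (dl_le x) (dl_nonneg x) pv
        calc _ = N(D2 u y) * dl x ^ 3 * dl x := by ring
          _ ≤ _ := by linarith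
      have i2 : N(y - x) ≤ √N(y - x) := h5.trans (mul_le_of_le_one_left (Real.sqrt_nonneg _) (dl_le x))
      calc _ = d ^ 2 * K * (N(y - x) * (N(D2 u y) * dl x ^ 4)) := by ring
        _ ≤ d ^ 2 * K * (√N(y - x) * (4 * M)) := by clear * - i2 i1 p hK; gcongr
        _ = _ := by ring
    rw [e]
    have h7 := mlr ((abs_add_le (DPE.tr (a y - a x) (D2 u y)) (DPE.tr (a x) (D2 u y - D2 u x))).trans (add_le_add h1 h2)) (dlp x 4).1
    linarith
lemma iter_lim {B : ℝ} (u : ℕ → EE → ℝ) (hu : ∀ k, WX B (u k)) (hc : ∀ x, N(x) < 1 → Tendsto (fun k => u (k + 1) x - u k x) atTop (𝓝 0)) :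
    ∃ w, WX B w ∧ ∀ j ≤ 1, ∀ x, N(x) < 1 →
    Tendsto (fun k => u (k + j) x) (hyperfilter ℕ : Filter ℕ) (𝓝 (w x)) ∧
    Tendsto (fun k => Df (u (k + j)) x) (hyperfilter ℕ : Filter ℕ) (𝓝 (Df w x)) ∧
    Tendsto (fun k => D2 (u (k + j)) x) (hyperfilter ℕ : Filter ℕ) (𝓝 (D2 w x)) := by
  obtain ⟨w, hw, h0⟩ := CL u hu
  obtain ⟨w', hw', h1⟩ := CL (fun k => u (k + 1)) fun k => hu _
  have e : ∀ x : EE, N(x) < 1 → w' x = w x := fun x hx => by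
    have := tendsto_nhds_unique ((h1 x hx).1.sub (h0 x hx).1) (hyp_of (hc x hx))
    linarith
  refine ⟨w, hw, fun j hj x hx => ?_⟩
  interval_cases j
  · exact h0 x hx
  · have e1 : w' =ᶠ[𝓝 x] w := mem_of_superset (nb hx) fun y hy => e y (by simpa using hy)
    have := h1 x hx
    rwa [e1.self_of_nhds, e1.fderiv_eq, D2_congr e1] at this
lemma cont_ind {P : ℝ → Prop} {δ : ℝ} (hδ : 0 < δ) (h0 : P 0) (hs : ∀ τ ε, 0 ≤ τ → 0 < ε → ε ≤ δ → τ + ε ≤ 1 → P τ → P (τ + ε)) : P 1 := by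
  obtain ⟨n, hn⟩ := exists_nat_one_div_lt hδ
  have hk : (0:ℝ) < (n:ℝ) + 1 := by positivity
  have : ∀ k : ℕ, k ≤ n + 1 → P (k / ((n:ℝ) + 1)) := by
    intro k
    induction k with
    | zero => intro _; simpa using h0
    | succ k ih =>
      intro hkn
      have h := hs (k / ((n:ℝ) + 1)) (1 / ((n:ℝ) + 1)) pv pv hn.le (by
        rw [← add_div, div_le_one hk]; exact_mod_cast hkn) (ih (by omega))
      rw [← add_div] at h
      simpa using h
  have := this (n + 1) le_rfl
  push_cast at this
  rwa [div_self hk.ne'] at this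
lemma Coef.conv {a : EE → MM} {K C τ : ℝ} (ha : Coef a K C) (h0 : 0 ≤ τ) (h1 : τ ≤ 1) :
    Coef (fun x => (1 - τ) • (1 : MM) + τ • a x) K C := by
  have hC := ha.hC
  refine ⟨hC, ha.hK, fun x y i j => ?_, fun x => ?_, fun x z => ?_⟩
  · simp only [Matrix.add_apply, Matrix.smul_apply, smul_eq_mul]
    have e : (1 - τ) * (1 : MM) i j + τ * a x i j - ((1 - τ) * (1 : MM) i j + τ * a y i j) = τ * (a x i j - a y i j) := by ring
    rw [e, abs_mul, abs_of_nonneg h0]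
    exact (mul_le_of_le_one_left (abs_nonneg _) h1).trans (ha.lip x y i j)
  · exact (Matrix.isSymm_one.smul _).add ((ha.symm x).smul _)
  · have e : quadForm ((1 - τ) • (1 : MM) + τ • a x) z = (1 - τ) * N(z) ^ 2 + τ * quadForm (a x) z := by
      have := (coef_one (d := d)).ell 0 z
      have e1 : quadForm (1 : MM) z = N(z) ^ 2 := by simp at this; linarith
      rw [← e1]
      simp only [quad_tr, tr_add', tr_smul']
    rw [e]
    obtain ⟨e1, e2⟩ := ha.ell x z
    have i1 : C⁻¹ ≤ 1 := inv_le_one_of_one_le₀ hC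
    have i2 := mlr i1 (sq_nonneg N(z))
    have i3 := mlr hC (sq_nonneg N(z))
    constructor <;> nlinarith only [h0, e1, h1, i2, e2, i3]
lemma nz0 {E F : Type*} [NormedAddCommGroup E] [NormedSpace ℝ E] [NormedAddCommGroup F] [NormedSpace ℝ F] (M : F →L[ℝ] E) : N((0 : F →L[ℝ] E)) = 0 ∧ N(M - M) = 0 := by simp
lemma WX.zero : WX 0 (fun _ : EE => (0:ℝ)) := by
  have e : Df (fun _ : EE => (0:ℝ)) = fun _ => 0 := by ext x; simp
  have e2 : ∀ x, D2 (fun _ : EE => (0:ℝ)) x = 0 := fun x => by unfold D2; rw [e]; simp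
  exact ⟨contDiffOn_const, fun x hx => by simp, fun x hx => by simp [e], fun x hx => by rw [e2, (nz0 0).1]; simp, fun x y hx hy => by rw [e2, e2, (nz0 0).2]; simp⟩
lemma lin_sol (hd : 1 ≤ d) {a : EE → MM} {K C s : ℝ} (ha : Coef a K C) (hs : 0 ≤ s) :
    ∃ A, 0 ≤ A ∧ ∀ (g : EE → ℝ) (N : ℝ), 0 < N → WY N g → ∃ u, WX (A * N) u ∧ ∀ x, N(x) < 1 → tr (a x) (D2 u x) - s * u x = g x := by
  obtain ⟨A, hA, E⟩ := E1 hd ha.hK ha.hC hs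
  obtain ⟨A0, hA0, L0⟩ := lap_sol hd
  have hK := ha.hK
  have hC := ha.hC
  obtain ⟨c, hc⟩ : ∃ c : ℝ, c = (4 * d ^ 2 * K + d * C) + |-1| * ((4 * d ^ 2 * 0 + d * 1)) + |-s| * 2 := ⟨_, rfl⟩
  have hc0 : 0 < c := by rw [hc]; have : (1:ℝ) ≤ d := by exact_mod_cast hd
                         positivity
  have hR : ∀ (u : EE → ℝ) M, WX M u → WY (c * M) (fun x => tr (a x) (D2 u x) + (-1) * tr 1 (D2 u x) + (-s) * u x) := fun u M hu => by
    have := ((hu.tr ha).lin (hu.tr coef_one) (-1)).lin hu.toWY (-s)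
    refine this.mono (le_of_eq ?_)
    rw [hc]; ring
  refine ⟨A, hA, ?_⟩
  have main := cont_ind (P := fun τ => ∀ (g : EE → ℝ) (N : ℝ), 0 < N → WY N g → ∃ u, WX (A * N) u ∧ ∀ x, N(x) < 1 →
    tr ((1 - τ) • (1 : MM) + τ • a x) (D2 u x) - τ * s * u x = g x) (δ := 1 / (2 * (A * c + 1))) pv ?_ ?_
  · intro g N hN hg
    obtain ⟨u, h1, h2⟩ := main g N hN hg
    exact ⟨u, h1, fun x hx => by simpa using h2 x hx⟩
  · intro g N hN hg
    obtain ⟨u, h1, h2⟩ := L0 g N hN hg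
    exact ⟨u, E _ (ha.conv le_rfl zero_le_one) u g 0 _ N le_rfl hs h1 hN hg fun x hx => by simpa using h2 x hx, fun x hx => by simpa using h2 x hx⟩
  · intro τ δ hτ hδ hδ1 h1 ih g N hN hg
    have hτ1 : τ ≤ 1 := by linarith
    have hAc : δ * (A * c) ≤ 1 / 2 := by
      rw [ldi pv] at hδ1
      linarith
    have Ap : 0 ≤ A * N := by positivity
    obtain ⟨B, hB⟩ : ∃ B : ℝ, B = 2 * (A * N) + 1 := ⟨_, rfl⟩
    have hB0 : 0 < B := by linarith
    have nx : ∀ v : {v : EE → ℝ // WX B v}, ∃ w : {v : EE → ℝ // WX B v}, ∀ x, N(x) < 1 →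
        tr ((1 - τ) • (1 : MM) + τ • a x) (D2 w.1 x) - τ * s * w.1 x = g x + (-δ) * (tr (a x) (D2 v.1 x) + (-1) * tr 1 (D2 v.1 x) + (-s) * v.1 x) := by
      rintro ⟨v, hv⟩
      obtain ⟨w, h1, h2⟩ := ih _ _ pv (hg.lin (hR v B hv) (-δ))
      refine ⟨⟨w, h1.mono ?_⟩, h2⟩
      rw [abs_neg, abs_of_pos hδ]
      have := mlr hAc hB0.le
      linarith
    choose f hf using nx
    set u : ℕ → {v : EE → ℝ // WX B v} := fun k => f^[k] ⟨_, WX.zero.mono hB0.le⟩ with hu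
    have us : ∀ k, u (k + 1) = f (u k) := fun k => Function.iterate_succ_apply' _ _ _
    have eq : ∀ k x, N(x) < 1 → tr ((1 - τ) • (1 : MM) + τ • a x) (D2 (u (k+1)).1 x) - τ * s * (u (k+1)).1 x =
        g x + (-δ) * (tr (a x) (D2 (u k).1 x) + (-1) * tr 1 (D2 (u k).1 x) + (-s) * (u k).1 x) := fun k x hx => by
      rw [us]; exact hf _ x hx
    have dif : ∀ k, WX ((B + |-1| * B) / 2 ^ k) (fun y => (u (k + 1)).1 y + (-1) * (u k).1 y) := by
      intro k
      induction k with
      | zero => simpa using (u 1).2.lin (u 0).2 (-1)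
      | succ k ih =>
        set m := (B + |-1| * B) / 2 ^ k with hm
        have hm0 : 0 < m := by positivity
        have := E _ (ha.conv hτ hτ1) _ _ (τ * s) _ (δ * (c * m)) pv (mul_le_of_le_one_left hs hτ1) ((u (k + 2)).2.lin (u (k+1)).2 (-1)) pv
          (((WX.zero.toWY).lin (hR _ _ ih) (-δ)).mono (by rw [abs_neg, abs_of_pos hδ]; simp)) ?_
        · refine this.mono ?_
          have := mlr hAc hm0.le
          have e : (B + |-1| * B) / 2 ^ (k + 1) = m / 2 := by rw [hm, pow_succ]; field_simp
          rw [e]; linarith only [this]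
        · intro x hx
          obtain ⟨-, l1⟩ := lin2 (-1) ((u (k+2)).2.cda hx) ((u (k+1)).2.cda hx)
          obtain ⟨-, l2⟩ := lin2 (-1) ((u (k+1)).2.cda hx) ((u k).2.cda hx)
          have e1 := eq (k+1) x hx
          have e2 := eq k x hx
          rw [l1, l2]
          simp only [tr_add (_ + _), tr_add (a x), tr_add 1, tr_smul] at e1 e2 ⊢
          linear_combination e1 - e2
    obtain ⟨w, hw, hl⟩ := iter_lim (fun k => (u k).1) (fun k => (u k).2) fun x hx => by
      refine squeeze_zero_norm (a := fun k : ℕ => (B + |-1| * B) * (1 / 2) ^ k) (fun k => ?_) ?_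
      · have h3 := (dif k).sup x hx.le
        have h4 := mll (dl_le x) (dif k).nonneg
        rw [nea, one_div, inv_pow, ← div_eq_mul_inv]
        have e : (u (k+1)).1 x - (u k).1 x = (u (k+1)).1 x + (-1) * (u k).1 x := by ring
        rw [e]; linarith only [h3, h4]
      · simpa using (tendsto_pow_atTop_nhds_zero_of_lt_one (r := (1/2 : ℝ)) nnu nnu).const_mul (B + |-1| * B)
    have we : ∀ x, N(x) < 1 → tr ((1 - (τ + δ)) • (1 : MM) + (τ + δ) • a x) (D2 w x) - (τ + δ) * s * w x = g x := by
      intro x hx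
      have l0 := hl 0 zero_le_one x hx
      have l1 := hl 1 le_rfl x hx
      have := tendsto_nhds_unique_of_eventuallyEq ((((tr_cont ((1 - τ) • (1 : MM) + τ • a x)).tendsto _).comp l1.2.2).sub (l1.1.const_mul (τ * s)))
        (tendsto_const_nhds.add (((((tr_cont (a x)).tendsto _).comp l0.2.2).add ((((tr_cont 1).tendsto _).comp l0.2.2).const_mul (-1))).add (l0.1.const_mul (-s)) |>.const_mul (-δ)))
        (Eventually.of_forall fun k => eq k x hx)
      simp only [tr_add', tr_smul'] at this ⊢
      linear_combination this
    exact ⟨w, E _ (ha.conv lna h1) w g _ _ N pv (mul_le_of_le_one_left hs h1) hw hN hg we, we⟩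
end
section
structure Ham (H : EE → ℝ → EL → ℝ) (L : ℝ) : Prop where
  hL : 0 ≤ L
  lip : ∀ x v v' p p', |H x v p - H x v' p'| ≤ L * (|v - v'| + N(p - p'))
  lipx : ∀ x y v p, |H x v p - H y v p| ≤ L * N(x - y) * (|v| + N(p))
  hom : ∀ x v p t, 0 ≤ t → H x (t * v) (t • p) = t * H x v p
structure X1 (G : ℝ) (u : EE → ℝ) : Prop where
  sup : ∀ x, N(x) ≤ 1 → |u x| ≤ G * dl x
  grad : ∀ x, N(x) < 1 → N(Df u x) * dl x ≤ G
lemma WX.x1 {M : ℝ} {u : EE → ℝ} (h : WX M u) : X1 M u := ⟨h.sup, h.grad⟩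
lemma X1.nonneg {M : ℝ} {u : EE → ℝ} (h : X1 M u) : 0 ≤ M :=
  (mul_nonneg (norm_nonneg _) (dl_nonneg _)).trans (h.grad 0 smp)
lemma X1.bd {M : ℝ} {u : EE → ℝ} (h : X1 M u) {x : EE} (hx : N(x) < 1) : (|u x| + N(Df u x)) * dl x ≤ 2 * M := by
  have h1 := mul_le_mul (h.sup x hx.le) (dl_le x) (dl_nonneg x) (mul_nonneg h.nonneg (dl_nonneg x))
  have h2 := mll (dl_le x) h.nonneg
  linarith [h.grad x hx]
lemma Ham.bd {H : EE → ℝ → EL → ℝ} {L : ℝ} (hH : Ham H L) (x v p) : |H x v p| ≤ L * (|v| + N(p)) := by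
  have h0 : H x 0 0 = 0 := by have := hH.hom x 0 0 0 le_rfl; simpa using this
  simpa [h0] using hH.lip x v 0 p 0
lemma HY {H : EE → ℝ → EL → ℝ} {L G M ε : ℝ} (hH : Ham H L) {u : EE → ℝ} (h : WX M u) (h1 : X1 G u) (hε : 0 < ε) (hε1 : ε ≤ 1) :
    WY (L * (7 * G / ε + 4 * ε * M)) (fun x => H x (u x) (Df u x)) := by
  have hG := h1.nonneg
  have hM := h.nonneg
  have hL := hH.hL
  have GE : G ≤ G / ε := by rw [ldi hε]; nlinarith
  have GE7 : 7 * G / ε = 7 * (G / ε) := mul_div_assoc _ _ _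
  have eM : 0 ≤ 4 * ε * M := by positivity
  refine ⟨fun x hx => ?_, fun x y hx hy => ?_⟩
  · have p := dl_pos hx
    have i1 := mlr (hH.bd x (u x) (Df u x)) (dlp x 3).1
    have i2 : (|u x| + N(Df u x)) * dl x ^ 3 ≤ 2 * G := by
      have := mul_le_mul (h1.bd hx) (dlp x 2).2 (dlp x 2).1 pv
      calc _ = (|u x| + N(Df u x)) * dl x * dl x ^ 2 := by ring
        _ ≤ _ := by linarith
    calc _ ≤ L * ((|u x| + N(Df u x)) * dl x ^ 3) := by linarith
      _ ≤ L * (7 * G / ε + 4 * ε * M) := mll lna hL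
  · have p := dl_pos hx
    have s0 := Real.sqrt_nonneg N(y - x)
    obtain ⟨n1, n2, n3⟩ := dl_near hx hy
    have hr : N(y - x) ≤ √N(y - x) := (sq_near hy).trans (mul_le_of_le_one_left s0 (dl_le x))
    have ss : √N(y - x) * √N(y - x) = N(y - x) := Real.mul_self_sqrt (norm_nonneg _)
    have t1 : N(y - x) * (|u x| + N(Df u x)) * dl x ^ 4 ≤ 2 * (G / ε) * √N(y - x) := by
      calc _ = N(y - x) * ((|u x| + N(Df u x)) * dl x) * dl x ^ 3 := by ring
        _ ≤ √N(y - x) * (2 * G) * 1 := by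
          have := h1.bd hx
          have := (dlp x 3).2
          gcongr
        _ ≤ √N(y - x) * (2 * (G / ε)) * 1 := by gcongr
        _ = _ := by ring
    have t2 : |u y - u x| * dl x ^ 4 ≤ 2 * (G / ε) * √N(y - x) := by
      calc _ = |u y - u x| * dl x * dl x ^ 3 := by ring
        _ ≤ 2 * G * N(y - x) * 1 := by
          have := lip0 h.cd h1.grad hx hy
          have := (dlp x 3).2
          gcongr
        _ ≤ 2 * (G / ε) * √N(y - x) * 1 := by clear * - GE hr hG hε; gcongr
        _ = _ := by ring
    have t3 : N(Df u y - Df u x) * dl x ^ 4 ≤ (3 * (G / ε) + 4 * ε * M) * √N(y - x) := by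
      rcases le_or_gt (√N(y - x)) (ε * dl x) with hc | hc
      · have g := h.glip hx hy (by simp; positivity : N(x - x) ≤ _)
        rw [div_mul_eq_mul_div, ldi pv, ← ss] at g
        have g2 : 4 * M * (√N(y - x) * √N(y - x)) ≤ 4 * M * (√N(y - x) * (ε * dl x)) := by clear * - hc hM; gcongr
        have g3 := mlr (g.trans g2) p.le
        have g4 : 4 * M * (√N(y - x) * (ε * dl x)) * dl x ≤ 4 * ε * M * √N(y - x) := by
          calc _ = 4 * ε * M * √N(y - x) * dl x ^ 2 := by ring
            _ ≤ _ := mul_le_of_le_one_right pv (dlp x 2).2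
        have : 0 ≤ 3 * (G / ε) * √N(y - x) := by positivity
        calc _ = N(Df u y - Df u x) * dl x ^ 3 * dl x := by ring
          _ ≤ _ := by linarith only [g3, g4, this]
      · have g1 := h1.grad x hx
        have g2 := h1.grad y n1
        have g3 := norm_sub_le (Df u y) (Df u x)
        have g4 := mll n2 (norm_nonneg (Df u y))
        have g5 : N(Df u y - Df u x) * dl x ≤ 3 * G := by
          have := mlr g3 p.le; linarith only [hG, g1, g2, g4, this]
        have g6 : dl x ^ 3 ≤ √N(y - x) / ε := by
          rw [ldi hε]
          calc dl x ^ 3 * ε = ε * dl x * dl x ^ 2 := by ring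
            _ ≤ ε * dl x := mul_le_of_le_one_right pv (dlp x 2).2
            _ ≤ _ := hc.le
        calc _ = N(Df u y - Df u x) * dl x * dl x ^ 3 := by ring
          _ ≤ 3 * G * (√N(y - x) / ε) := by gcongr
          _ = 3 * (G / ε) * √N(y - x) := by ring
          _ ≤ _ := by nlinarith only [eM, s0, mul_nonneg eM s0]
    have e : H y (u y) (Df u y) - H x (u x) (Df u x) = (H y (u y) (Df u y) - H y (u x) (Df u x)) + (H y (u x) (Df u x) - H x (u x) (Df u x)) := by ring
    have i := (abs_add_le (H y (u y) (Df u y) - H y (u x) (Df u x)) (H y (u x) (Df u x) - H x (u x) (Df u x))).trans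
      (add_le_add (hH.lip y _ _ _ _) (hH.lipx y x (u x) (Df u x)))
    rw [e]
    calc _ ≤ (L * (|u y - u x| + N(Df u y - Df u x)) + L * N(y - x) * (|u x| + N(Df u x))) * dl x ^ 4 := mlr i (dlp x 4).1
      _ = L * (|u y - u x| * dl x ^ 4 + N(Df u y - Df u x) * dl x ^ 4 + N(y - x) * (|u x| + N(Df u x)) * dl x ^ 4) := by ring
      _ ≤ L * (2 * (G / ε) * √N(y - x) + (3 * (G / ε) + 4 * ε * M) * √N(y - x) + 2 * (G / ε) * √N(y - x)) := mll (by linarith only [t1, t2, t3]) hL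
      _ = _ := by ring
lemma bq_grad {x : EE} (h : N(x) < 1) : N(Df (bq : EE → ℝ) x) ≤ 1 / bq x := by
  have hq := bq_pos h
  have h1 : HasFDerivAt (fun y : EE => 1 - N(y) ^ 2) (-(2 • innerSL ℝ x)) x := (hasStrictFDerivAt_norm_sq x).hasFDerivAt.const_sub 1
  have h2 : HasFDerivAt (bq : EE → ℝ) ((1 / (2 * bq x)) • (-(2 • innerSL ℝ x) : EL)) x := h1.sqrt (by nlinarith only [h, norm_nonneg x])
  rw [h2.fderiv, norm_smul, norm_neg, nea, abs_of_pos pv, ← Nat.cast_smul_eq_nsmul ℝ, norm_smul, innerSL_apply_norm]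
  rw [div_mul_eq_mul_div, div_le_div_iff₀ pv hq]
  norm_num
  nlinarith [mlr h.le hq.le]
lemma supL {a : EE → MM} {K C L s N : ℝ} (ha : Coef a K C) (hd : 1 ≤ d) (hL : 0 ≤ L) (hs : L + C * L ^ 2 ≤ s) (hN : 0 < N) {u : EE → ℝ}
    (h2 : ContDiffOn ℝ 2 u (ball 0 1)) (hc : ContinuousOn u (closedBall 0 1)) (hb : ∀ x, N(x) = 1 → u x = 0)
    (h : ∀ x, N(x) < 1 → -(N + L * (|u x| + N(Df u x)) * dl x ^ 3) ≤ (tr (a x) (D2 u x) - s * u x) * dl x ^ 3) : ∀ x, N(x) ≤ 1 → u x ≤ 12 * C * N * dl x := by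
  have hC := ha.hC
  intro x hx
  have key := MP ha (v := fun y => u y + (-(8 * C * N)) * bq y) (isCompact_closedBall (0 : EE) 1) (hc.add (by have := @bq_cont d; fun_prop)) ?_ x (by simpa using hx)
  · have h3 := (bq_dl hx).2.1
    have : u x ≤ 8 * C * N * bq x := by linarith
    refine this.trans ?_
    calc _ ≤ 8 * C * N * (3 / 2 * dl x) := mll h3 pv
      _ = _ := by ring
  · intro y hy hv
    have hy' : N(y) < 1 := lt_of_le_of_ne (by simpa using hy) fun e => by
      have h3 : bq y = 0 := by simp [bq, e]
      rw [h3, hb y e] at hv; simp at hv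
    have hu2 := h2.contDiffAt (nb hy')
    refine ⟨cb_nb hy', hu2.add (contDiffAt_const.mul (bq_cd hy')), fun hz => ?_⟩
    obtain ⟨l1, l2⟩ := lin2 (-(8 * C * N)) hu2 (bq_cd hy')
    rw [l1] at hz
    rw [l2, tr_add, tr_smul]
    have h3 := bq_L ha hd hy'
    have hq := bq_pos hy'
    have ht := dl_pos hy'
    have m0 : 0 < 8 * C * N := by positivity
    have gd : N(Df u y) ≤ 8 * C * N * (1 / bq y) := by
      rw [eq_neg_of_add_eq_zero_left hz, norm_neg, norm_smul, norm_neg, Real.norm_of_nonneg m0.le]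
      exact mll (bq_grad hy') m0.le
    have u0 : 8 * C * N * bq y < u y := by linarith
    have up : 0 < u y := (mul_pos m0 hq).trans u0
    have h5 : -(N / dl y ^ 3 + L * (u y + N(Df u y))) ≤ tr (a y) (D2 u y) - s * u y := by
      have := h y hy'
      rw [abs_of_pos up] at this
      rw [← mul_le_mul_iff_left₀ (pow_pos ht 3)]
      refine le_trans (le_of_eq ?_) this
      (clear * - ht hN hL up; field_simp)
    have h6 : 8 * C * N * (C⁻¹ / bq y ^ 3) ≤ (-(8 * C * N)) * tr (a y) (D2 bq y) := by
      have := mll h3 m0.le; linarith only [this]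
    have h7 : N / dl y ^ 3 < 8 * C * N * (C⁻¹ / bq y ^ 3) / 2 := by
      have e : 8 * C * N * (C⁻¹ / bq y ^ 3) / 2 = 4 * N / bq y ^ 3 := by field_simp; norm_num
      rw [e, div_lt_div_iff₀ pv pv]
      have := (bq_dl hy'.le).2.2
      nlinarith only [hN, ht, this, mul_pos hN (pow_pos ht 3)]
    have h8 : L * (1 / bq y) ≤ (C⁻¹ / bq y ^ 3) / 2 + C * L ^ 2 * bq y := by
      rw [← mul_le_mul_iff_left₀ (pow_pos hq 3)]
      have e1 : L * (1 / bq y) * bq y ^ 3 = L * bq y ^ 2 := by field_simp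
      have e2 : (C⁻¹ / bq y ^ 3 / 2 + C * L ^ 2 * bq y) * bq y ^ 3 = C⁻¹ / 2 + C * (L * bq y ^ 2) ^ 2 := by field_simp
      have e3 : C⁻¹ / 2 + C * (L * bq y ^ 2) ^ 2 - L * bq y ^ 2 = C * (L * bq y ^ 2 - C⁻¹ / 2) ^ 2 + C⁻¹ / 4 := by field_simp; ring
      rw [e1, e2]
      have : 0 ≤ C * (L * bq y ^ 2 - C⁻¹ / 2) ^ 2 + C⁻¹ / 4 := by positivity
      linarith only [e3, this]
    have h9 := mll h8 m0.le
    have h10 := mll gd hL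
    have h11 : C * L ^ 2 * (8 * C * N * bq y) ≤ (s - L) * u y := mul_le_mul (by linarith only [hs]) u0.le pv (by nlinarith only [hs, hC, sq_nonneg L])
    linarith only [h5, h6, h7, h9, h10, h11]
end
section
lemma WX.bdry {M : ℝ} {u : EE → ℝ} (h : WX M u) {x : EE} (hx : N(x) = 1) : u x = 0 := by
  have := h.sup x hx.le
  rw [dl_bd hx, mul_zero] at this
  exact abs_nonpos_iff.1 this
lemma E2 {a : EE → MM} {K C L s : ℝ} (ha : Coef a K C) (hd : 1 ≤ d) (hL : 0 ≤ L) (hs : L + C * L ^ 2 ≤ s) :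
    ∃ A, 0 ≤ A ∧ ∀ (w : EE → ℝ) (M N : ℝ), WX M w → 0 < N →
    (∀ x, N(x) < 1 → |tr (a x) (D2 w x) - s * w x| * dl x ^ 3 ≤ N + L * (|w x| + N(Df w x)) * dl x ^ 3) → X1 (A * N) w := by
  obtain ⟨A1, hA1, G1⟩ := grad_est (d := d) ha.hK ha.hC
  have hC := ha.hC
  have hs0 : 0 ≤ s := le_trans pv hs
  obtain ⟨θ, hθ⟩ : ∃ θ : ℝ, θ = 1 / (3 * A1 * L + 2) := ⟨_, rfl⟩
  have θ0 : 0 < θ := by rw [hθ]; positivity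
  have θ1 : θ * (3 * A1 * L + 2) = 1 := by rw [hθ]; field_simp
  have θ2 : θ ≤ 1 / 2 := by nlinarith only [θ1, θ0, hA1, hL, mul_nonneg θ0.le (mul_nonneg hA1 hL)]
  obtain ⟨c, hc⟩ : ∃ c : ℝ, c = A1 * (15 * C / θ + (s + L) * (15 * C) + 4) := ⟨_, rfl⟩
  have hc0 : 0 ≤ c := by rw [hc]; positivity
  refine ⟨12 * C + 2 * c, by positivity, fun w M N hw hN h => ?_⟩
  have sup : ∀ x, N(x) ≤ 1 → |w x| ≤ 12 * C * N * dl x := fun x hx => by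
    refine abs_le.2 ⟨?_, supL ha hd hL hs hN hw.cd hw.cont (fun x hx => hw.bdry hx) (fun x hx => ?_) x hx⟩
    · have := supL ha hd hL hs hN (u := fun y => - w y) hw.cd.neg hw.cont.neg (fun x hx => by rw [hw.bdry hx, neg_zero]) (fun x hx => ?_) x hx
      · linarith
      · have e : Df (fun y => - w y) x = - Df w x := fderiv_neg
        rw [D2_neg, tr_neg, e, abs_neg, norm_neg]
        have h1 := h x hx
        have h2 := mlr (le_abs_self (tr (a x) (D2 w x) - s * w x)) (dlp x 3).1
        linarith
    · have h1 := h x hx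
      have h2 := mlr (neg_abs_le (tr (a x) (D2 w x) - s * w x)) (dlp x 3).1
      linarith
  have gr := absorb (P := fun B => ∀ x : EE, N(x) < 1 → N(Df w x) * dl x ≤ B) (A := c * N) (B0 := M) pv hw.nonneg hw.grad
    (fun B hB hP x hx => ?_) (fun B B' hBB h x hx => (h x hx).trans hBB)
  · have cn : 0 ≤ c * N := by positivity
    have cn' : 0 ≤ C * N := by positivity
    refine ⟨fun x hx => (sup x hx).trans (mlr lna (dl_nonneg x)), fun x hx => ?_⟩
    have := le_of_eps (X := N(Df w x) * dl x) (A := 2 * (c * N)) (S := 1) fun ε hε => by simpa using gr ε hε x hx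
    linarith
  · have p := dl_pos hx
    have p1 := dl_le x
    have near : ∀ y ∈ ball x (θ * dl x ^ 2), N(y - x) ≤ dl x ^ 2 / 2 := fun y hy => by
      have : N(y - x) < θ * dl x ^ 2 := by simpa [dist_eq_norm] using hy
      nlinarith only [this, θ2, sq_nonneg (dl x)]
    have wb : ∀ y ∈ ball x (θ * dl x ^ 2), |w y| ≤ 15 * C * N * dl x := fun y hy => by
      obtain ⟨n1, n2, n3⟩ := dl_near hx (near y hy)
      have := mll n3 (by positivity : 0 ≤ 12 * C * N)
      linarith only [this, sup, n1, sup y n1.le]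
    have := G1 a ha w x (θ * dl x ^ 2) (15 * C * N * dl x) ((s + L) * (15 * C * N * dl x) + 4 * N / dl x ^ 3 + L * (3 / 2 * B / dl x)) pv
      (by nlinarith only [θ0, θ2, (dlp x 2).2, (dlp x 2).1]) (hw.cd.mono fun y hy => by simpa using (dl_near hx (near y hy)).1) wb fun y hy => ?_
    · have := mlr this p.le
      refine this.trans ?_
      have e : A1 * (15 * C * N * dl x / (θ * dl x ^ 2) + θ * dl x ^ 2 * ((s + L) * (15 * C * N * dl x) + 4 * N / dl x ^ 3 + L * (3 / 2 * B / dl x))) * dl x =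
          A1 * (15 * C / θ * N + (s + L) * (15 * C) * N * (θ * dl x ^ 4) + 4 * N * θ) + A1 * θ * L * (3 / 2) * (B * dl x ^ 2) := by field_simp; ring
      rw [e]
      have i1 : θ * dl x ^ 4 ≤ 1 := mul_le_one₀ (by linarith only [θ0, θ2]) (dlp x 4).1 (dlp x 4).2
      have i2 : A1 * (15 * C / θ * N + (s + L) * (15 * C) * N * (θ * dl x ^ 4) + 4 * N * θ) ≤ A1 * (15 * C / θ * N + (s + L) * (15 * C) * N * 1 + 4 * N * 1) := by
        have : θ ≤ 1 := by linarith only [θ0, θ2]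
        (clear * - i1 hs0 hL hC hN this hA1; gcongr)
      have i3 : A1 * θ * L * (3 / 2) * (B * dl x ^ 2) ≤ 1 / 2 * (B * 1) := by
        have := (dlp x 2).2
        have : A1 * θ * L * (3 / 2) ≤ 1 / 2 := by nlinarith only [θ0, θ1]
        gcongr
      rw [hc]
      linarith only [i2, i3]
    · obtain ⟨n1, n2, n3⟩ := dl_near hx (near y hy)
      have py := dl_pos n1
      have h1 : |tr (a y) (D2 w y) - s * w y| ≤ N / dl y ^ 3 + L * (|w y| + N(Df w y)) := by
        rw [← mul_le_mul_iff_left₀ (pow_pos py 3)]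
        refine (h y n1).trans (le_of_eq ?_)
        (clear * - py hN hL; field_simp)
      have h2 : N / dl y ^ 3 ≤ 4 * N / dl x ^ 3 := by
        rw [div_le_div_iff₀ pv pv]
        have : dl x ^ 3 ≤ 4 * dl y ^ 3 := (pow_le_pow_left₀ p.le n2 3).trans (by rw [mul_pow]; nlinarith only [py, pow_pos py 3])
        nlinarith only [θ0, θ2, hN, this]
      have h3 : N(Df w y) ≤ 3 / 2 * B / dl x := by
        rw [ldi p]
        have := mll n2 (norm_nonneg (Df w y))
        linarith only [this, hP, n1, hP y n1]
      have h4 := mll (wb y hy) (by positivity : 0 ≤ s + L)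
      have h5 := mll h3 hL
      have h6 := abs_add_le (tr (a y) (D2 w y) - s * w y) (s * w y)
      rw [sub_add_cancel, abs_mul, abs_of_nonneg hs0] at h6
      linarith only [h1, h2, h4, h5, h6]
lemma E4 {a : EE → MM} {K C L s : ℝ} (ha : Coef a K C) (hd : 1 ≤ d) (hL : 0 ≤ L) (hs : L + C * L ^ 2 ≤ s) :
    ∃ c, 0 ≤ c ∧ ∀ H, Ham H L → ∀ (u f : EE → ℝ) (M N : ℝ), WX M u → 0 < N → WY N f →
    (∀ x, N(x) < 1 → tr (a x) (D2 u x) - s * u x + H x (u x) (Df u x) = f x) → WX (c * N) u := by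
  have hC := ha.hC
  have hs0 : 0 ≤ s := le_trans pv hs
  obtain ⟨A, hA, e2⟩ := E2 ha hd hL hs
  obtain ⟨A', hA', e1⟩ := E1 hd ha.hK ha.hC hs0
  obtain ⟨ε, hε⟩ : ∃ ε : ℝ, ε = 1 / (8 * (A' * L) + 1) := ⟨_, rfl⟩
  have ε0 : 0 < ε := by rw [hε]; positivity
  have ε2 : ε * (8 * (A' * L) + 1) = 1 := by rw [hε]; field_simp
  have ε1 : ε ≤ 1 := by nlinarith only [ε2, ε0, hA', hL, mul_nonneg ε0.le (mul_nonneg hA' hL)]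
  refine ⟨2 * (A' * (1 + L * (7 * A / ε))) + 1, by positivity, fun H hH u f M N hu hN hf he => ?_⟩
  have hx1 : X1 (A * N) u := e2 u M N hu hN fun x hx => by
    have h1 : tr (a x) (D2 u x) - s * u x = f x - H x (u x) (Df u x) := by rw [← he x hx]; ring
    rw [h1]
    have h2 := mlr ((abs_sub _ _).trans (add_le_add (le_refl |f x|) (hH.bd x (u x) (Df u x)))) (dlp x 3).1
    linarith [hf.sup x hx]
  have := absorb (P := fun B => WX B u) (A := A' * (1 + L * (7 * A / ε)) * N) (B0 := M) pv hu.nonneg hu (fun B hB hP => ?_) (fun B B' hBB h => h.mono hBB) N hN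
  · exact this.mono lna
  · have := e1 a ha u _ s B (N + |-1| * (L * (7 * (A * N) / ε + 4 * ε * B))) hs0 le_rfl hP (by clear * - hN hL hA ε0 hB; positivity) (hf.lin (HY hH hP hx1 ε0 ε1) (-1))
      fun x hx => by rw [← he x hx]; ring
    refine this.mono ?_
    rw [abs_neg, abs_one, one_mul]
    have e : A' * (N + L * (7 * (A * N) / ε + 4 * ε * B)) = A' * (1 + L * (7 * A / ε)) * N + B / 2 * (ε * (8 * (A' * L))) := by ring
    rw [e]
    nlinarith only [ε0, hB, ε2]
lemma Ham.smul {H : EE → ℝ → EL → ℝ} {L τ : ℝ} (hH : Ham H L) (h0 : 0 ≤ τ) (h1 : τ ≤ 1) : Ham (fun x v p => τ * H x v p) L := by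
  have hL := hH.hL
  refine ⟨hL, fun x v v' p p' => ?_, fun x y v p => ?_, fun x v p t ht => by rw [hH.hom x v p t ht]; ring⟩
  · rw [← mul_sub, abs_mul, abs_of_nonneg h0]
    exact (mul_le_of_le_one_left (abs_nonneg _) h1).trans (hH.lip _ _ _ _ _)
  · rw [← mul_sub, abs_mul, abs_of_nonneg h0]
    exact (mul_le_of_le_one_left (abs_nonneg _) h1).trans (hH.lipx _ _ _ _)
lemma Ham.cont {H : EE → ℝ → EL → ℝ} {L : ℝ} (hH : Ham H L) (x : EE) {F : Filter ℕ} {v : ℕ → ℝ} {p : ℕ → EL} {v0 p0}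
    (hv : Tendsto v F (𝓝 v0)) (hp : Tendsto p F (𝓝 p0)) : Tendsto (fun k => H x (v k) (p k)) F (𝓝 (H x v0 p0)) := by
  rw [tendsto_iff_norm_sub_tendsto_zero] at hv hp ⊢
  refine squeeze_zero (fun k => norm_nonneg _) (fun k => hH.lip x _ _ _ _) ?_
  simpa using (hv.add hp).const_mul L
lemma nl_sol {a : EE → MM} {K C L s : ℝ} {H : EE → ℝ → EL → ℝ} (ha : Coef a K C) (hd : 1 ≤ d) (hH : Ham H L) (hs : L + C * L ^ 2 ≤ s)
    (f : EE → ℝ) (N : ℝ) (hN : 0 < N) (hf : WY N f) : ∃ u M, WX M u ∧ ∀ x, N(x) < 1 → tr (a x) (D2 u x) - s * u x + H x (u x) (Df u x) = f x := by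
  have hC := ha.hC
  have hL := hH.hL
  have hs0 : 0 ≤ s := le_trans pv hs
  obtain ⟨A, hA, e2⟩ := E2 ha hd hL hs
  obtain ⟨c, hc, e4⟩ := E4 ha hd hL hs
  obtain ⟨A0, hA0, l0⟩ := lin_sol hd ha hs0
  have main := cont_ind (P := fun τ => ∀ (f : EE → ℝ) (N : ℝ), 0 < N → WY N f → ∃ u M, WX M u ∧ ∀ x, N(x) < 1 →
    tr (a x) (D2 u x) - s * u x + τ * H x (u x) (Df u x) = f x) (δ := 1 / (22 * (c * L) + 8 * (A * L) + 1)) pv ?_ ?_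
  · obtain ⟨u, M, h1, h2⟩ := main f N hN hf
    exact ⟨u, M, h1, fun x hx => by simpa using h2 x hx⟩
  · intro f N hN hf
    obtain ⟨u, h1, h2⟩ := l0 f N hN hf
    exact ⟨u, _, h1, fun x hx => by simpa using h2 x hx⟩
  · intro τ δ hτ hδ hδ1 h1 ih f N hN hf
    have hτ1 : τ ≤ 1 := by linarith
    rw [ldi pv] at hδ1
    have q1 : 0 ≤ δ * (c * L) := by positivity
    have q2 : 0 ≤ δ * (A * L) := by positivity
    have Ap : 0 ≤ c * N := by positivity
    obtain ⟨B, hB⟩ : ∃ B : ℝ, B = 2 * (c * N) + 1 := ⟨_, rfl⟩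
    have hB0 : 0 < B := by linarith
    have nx : ∀ v : {v : EE → ℝ // WX B v}, ∃ w : {v : EE → ℝ // WX B v}, ∀ x, N(x) < 1 →
        tr (a x) (D2 w.1 x) - s * w.1 x + τ * H x (w.1 x) (Df w.1 x) = f x + (-δ) * H x (v.1 x) (Df v.1 x) := by
      rintro ⟨v, hv⟩
      have hy := hf.lin (HY hH hv hv.x1 one_pos le_rfl) (-δ)
      have hp : 0 < N + |-δ| * (L * (7 * B / 1 + 4 * 1 * B)) := by positivity
      obtain ⟨w, M, h1, h2⟩ := ih _ _ hp hy
      refine ⟨⟨w, (e4 _ (hH.smul hτ hτ1) w _ M _ h1 hp hy h2).mono ?_⟩, h2⟩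
      rw [abs_neg, abs_of_pos hδ]
      nlinarith only [hδ, hδ1, q2, hB, Ap, q1]
    choose g hg using nx
    set u : ℕ → {v : EE → ℝ // WX B v} := fun k => g^[k] ⟨_, WX.zero.mono hB0.le⟩ with hu
    have us : ∀ k, u (k + 1) = g (u k) := fun k => Function.iterate_succ_apply' _ _ _
    have eq : ∀ k x, N(x) < 1 → tr (a x) (D2 (u (k+1)).1 x) - s * (u (k+1)).1 x + τ * H x ((u (k+1)).1 x) (Df (u (k+1)).1 x) =
        f x + (-δ) * H x ((u k).1 x) (Df (u k).1 x) := fun k x hx => by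
      rw [us]; exact hg _ x hx
    have dif : ∀ k, X1 ((B + |-1| * B) / 2 ^ k) (fun y => (u (k + 1)).1 y + (-1) * (u k).1 y) := by
      intro k
      induction k with
      | zero => simpa using ((u 1).2.lin (u 0).2 (-1)).x1
      | succ k ih =>
        set m := (B + |-1| * B) / 2 ^ k with hm
        have hm0 : 0 < m := by positivity
        obtain ⟨m1, hm1⟩ : ∃ m1, m1 = 2 * (δ * L) * m := ⟨_, rfl⟩
        have m10 : 0 ≤ m1 := by rw [hm1]; positivity
        have key := fun η (hη : 0 < η) => e2 _ _ (m1 + η) ((u (k + 2)).2.lin (u (k+1)).2 (-1)) pv ?_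
        · have e : (B + |-1| * B) / 2 ^ (k + 1) = m / 2 := by rw [hm, pow_succ]; field_simp
          rw [e]
          have hη : 0 < m / 4 / (A + 1) := by positivity
          have h3 := key _ hη
          have h4 : A * (m1 + m / 4 / (A + 1)) ≤ m / 2 := by
            have i1 : A * (m / 4 / (A + 1)) ≤ m / 4 := by
              rw [← mul_div_assoc, div_le_iff₀ pv]; nlinarith only [hm0]
            have i2 : A * m1 ≤ m / 4 := by
              rw [hm1]
              have : 2 * (δ * (A * L)) ≤ 1 / 4 := by linarith only [hδ, hδ1, q1]
              nlinarith only [hc, hm1, m10, hδ, hm0, hδ1]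
            linarith only [i1, i2]
          exact ⟨fun x hx => (h3.sup x hx).trans (mlr h4 (dl_nonneg x)), fun x hx => (h3.grad x hx).trans h4⟩
        · intro x hx
          obtain ⟨l1, l1'⟩ := lin2 (-1) ((u (k+2)).2.cda hx) ((u (k+1)).2.cda hx)
          obtain ⟨l2, l2'⟩ := lin2 (-1) ((u (k+1)).2.cda hx) ((u k).2.cda hx)
          have e1 := eq (k+1) x hx
          have e2 := eq k x hx
          have i1 := hH.lip x ((u (k+2)).1 x) ((u (k+1)).1 x) (Df (u (k+2)).1 x) (Df (u (k+1)).1 x)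
          have i2 := hH.lip x ((u (k+1)).1 x) ((u k).1 x) (Df (u (k+1)).1 x) (Df (u k).1 x)
          have i3 := ih.bd hx
          rw [l2] at i3
          simp only [neg_one_mul, neg_one_smul, ← sub_eq_add_neg] at i3
          rw [l1, l1', tr_add, tr_smul]
          simp only [neg_one_mul, neg_one_smul, ← sub_eq_add_neg]
          have e3 : tr (a x) (D2 (u (k+2)).1 x) - tr (a x) (D2 (u (k+1)).1 x) - s * ((u (k+2)).1 x - (u (k+1)).1 x) =
            -(τ * (H x ((u (k+2)).1 x) (Df (u (k+2)).1 x) - H x ((u (k+1)).1 x) (Df (u (k+1)).1 x))) - δ * (H x ((u (k+1)).1 x) (Df (u (k+1)).1 x) - H x ((u k).1 x) (Df (u k).1 x)) := by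
            linear_combination e1 - e2
          rw [e3]
          have i4 := abs_sub (-(τ * (H x ((u (k+2)).1 x) (Df (u (k+2)).1 x) - H x ((u (k+1)).1 x) (Df (u (k+1)).1 x)))) (δ * (H x ((u (k+1)).1 x) (Df (u (k+1)).1 x) - H x ((u k).1 x) (Df (u k).1 x)))
          rw [abs_neg, abs_mul, abs_mul, abs_of_nonneg hτ, abs_of_pos hδ] at i4
          have i5 := (mul_le_of_le_one_left (abs_nonneg _) hτ1).trans i1
          have i6 := mll i2 hδ.le
          have i7 := mlr (i4.trans (add_le_add i5 i6)) (dlp x 3).1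
          have i8 : (|(u (k+1)).1 x - (u k).1 x| + N(Df (u (k+1)).1 x - Df (u k).1 x)) * dl x ^ 3 ≤ 2 * m := by
            have := mul_le_mul i3 (dlp x 2).2 (dlp x 2).1 pv
            calc _ = (|(u (k+1)).1 x - (u k).1 x| + N(Df (u (k+1)).1 x - Df (u k).1 x)) * dl x * dl x ^ 2 := by ring
              _ ≤ _ := by linarith only [this]
          have i9 := mll i8 (by positivity : 0 ≤ δ * L)
          linarith only [hm1, hη, i7, i9]
    obtain ⟨w, hw, hl⟩ := iter_lim (fun k => (u k).1) (fun k => (u k).2) fun x hx => by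
      refine squeeze_zero_norm (a := fun k : ℕ => (B + |-1| * B) * (1 / 2) ^ k) (fun k => ?_) ?_
      · have h3 := (dif k).sup x hx.le
        have h4 := mll (dl_le x) (dif k).nonneg
        rw [nea, one_div, inv_pow, ← div_eq_mul_inv]
        have e : (u (k+1)).1 x - (u k).1 x = (u (k+1)).1 x + (-1) * (u k).1 x := by ring
        rw [e]; linarith only [h3, h4]
      · simpa using (tendsto_pow_atTop_nhds_zero_of_lt_one (r := (1/2 : ℝ)) nnu nnu).const_mul (B + |-1| * B)
    refine ⟨w, B, hw, fun x hx => ?_⟩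
    have l0 := hl 0 zero_le_one x hx
    have l1 := hl 1 le_rfl x hx
    have := tendsto_nhds_unique_of_eventuallyEq (((((tr_cont (a x)).tendsto _).comp l1.2.2).sub (l1.1.const_mul s)).add ((hH.cont x l1.1 l1.2.1).const_mul τ))
      (tendsto_const_nhds.add ((hH.cont x l0.1 l0.2.1).const_mul (-δ)))
      (Eventually.of_forall fun k => eq k x hx)
    linear_combination this
end
section
lemma hopf0 {a : EE → MM} {K C k : ℝ} (ha : Coef a K C) (hd : 1 ≤ d) (hk : 0 ≤ k) {w : EE → ℝ}
    (h2 : ContDiffOn ℝ 2 w (ball 0 1)) (hc : ContinuousOn w (closedBall 0 1)) (h0 : ∀ x, N(x) ≤ 1 → 0 ≤ w x)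
    (hw : ∀ x, N(x) < 1 → tr (a x) (D2 w x) ≤ k * (w x + N(Df w x))) {y : EE} {r : ℝ} (hr : 0 < r) (hy : N(y) + r ≤ 1) (hp : 0 < w y) :
    ∃ ε, 0 < ε ∧ ∀ x, N(x - y) ≤ r → ε * (r ^ 2 - N(x - y) ^ 2) ≤ w x := by
  have hC := ha.hC
  have hCp : 0 < C := by linarith
  have r1 : r ≤ 1 := by linarith [norm_nonneg y]
  have tri : ∀ x : EE, N(x) ≤ N(y) + N(x - y) := fun x => by simpa using norm_add_le y (x - y)
  have hy1 : N(y) < 1 := by linarith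
  obtain ⟨ρ0, hρ0, hρm⟩ := Metric.eventually_nhds_iff_ball.1 ((h2.contDiffAt (nb hy1)).continuousAt.eventually_const_lt (half_lt_self hp))
  obtain ⟨ρ, hρ⟩ : ∃ ρ : ℝ, ρ = min ρ0 r / 2 := ⟨_, rfl⟩
  have hρp : 0 < ρ := by rw [hρ]; have := lt_min hρ0 hr; linarith
  have hρ1 : ρ < ρ0 := by have := min_le_left ρ0 r; linarith
  have hρ2 : ρ < r := by have := min_le_right ρ0 r; linarith
  obtain ⟨m, hm⟩ : ∃ m, m = w y / 2 := ⟨_, rfl⟩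
  have hm0 : 0 < m := by rw [hm]; linarith
  have hin : ∀ x : EE, N(x - y) ≤ ρ → m ≤ w x := fun x hx => by
    rw [hm]; exact (hρm x (by rw [mem_ball, dist_eq_norm]; linarith)).le
  obtain ⟨γ, hγ⟩ : ∃ γ : ℝ, γ = 1 + C * (2 * (d * C) + 3 * k) / ρ ^ 2 := ⟨_, rfl⟩
  have hγ1 : 1 ≤ γ := by rw [hγ]; have : 0 ≤ C * (2 * (d * C) + 3 * k) / ρ ^ 2 := by positivity
                         linarith
  have hγ2 : 2 * (d * C) + 3 * k < 4 * γ * (C⁻¹ * ρ ^ 2) := by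
    have : γ * (C⁻¹ * ρ ^ 2) = C⁻¹ * ρ ^ 2 + (2 * (d * C) + 3 * k) := by rw [hγ]; field_simp
    have p1 : 0 < C⁻¹ * ρ ^ 2 := by positivity
    have p2 : 0 ≤ 2 * (d * C) + 3 * k := by positivity
    linarith
  set h : EE → ℝ := fun x => Real.exp (-γ * N(x - y) ^ 2) - Real.exp (-γ * r ^ 2) with hh
  have hcd : ContDiff ℝ 2 h := by
    have : ContDiff ℝ 2 fun x : EE => N(x - y) ^ 2 := (contDiff_id.sub contDiff_const).norm_sq ℝ
    exact (Real.contDiff_exp.comp (contDiff_const.mul this)).sub contDiff_const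
  have key : ∀ x ∈ closedBall y r \ ball y ρ, h x + (-m⁻¹) * w x ≤ 0 := by
    have sub : closedBall y r ⊆ closedBall 0 1 := fun x hx => by
      rw [mem_closedBall, dist_eq_norm] at hx
      rw [mem_closedBall_zero_iff]; linarith [tri x]
    refine MP ha ((isCompact_closedBall y r).diff isOpen_ball) (hcd.continuous.continuousOn.add (continuousOn_const.mul (hc.mono (sdiff_subset.trans sub)))) ?_
    intro x hx hv
    have e1 : N(x - y) ≤ r := by simpa [dist_eq_norm] using hx.1
    have e2 : ρ ≤ N(x - y) := by simpa [dist_eq_norm] using hx.2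
    have w0 := h0 x (by linarith [tri x])
    have e3 : N(x - y) < r := lt_of_le_of_ne e1 fun e => by
      have : h x = 0 := by simp [hh, e]
      have : 0 ≤ m⁻¹ * w x := by positivity
      linarith
    have hle : h x < Real.exp (-γ * N(x - y) ^ 2) := by have := Real.exp_pos (-γ * r ^ 2); simp only [hh]; linarith
    have e4 : ρ < N(x - y) := lt_of_le_of_ne e2 fun e => by
      have i1 : Real.exp (-γ * N(x - y) ^ 2) ≤ 1 := Real.exp_le_one_iff.2 (by nlinarith only [hγ1, sq_nonneg N(x - y)])
      have i2 : m⁻¹ * m ≤ m⁻¹ * w x := mll (hin x e.ge) pv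
      rw [inv_mul_cancel₀ hm0.ne'] at i2
      linarith
    have hx1 : N(x) < 1 := by linarith [tri x]
    have hwx := h2.contDiffAt (nb hx1)
    refine ⟨mem_of_superset ((isOpen_ball.inter isClosed_closedBall.isOpen_compl).mem_nhds (⟨by simpa [dist_eq_norm] using e3, by simpa [dist_eq_norm] using e4⟩ : x ∈ ball y r ∩ (closedBall y ρ)ᶜ))
      (fun z hz => ⟨ball_subset_closedBall hz.1, fun hz' => hz.2 (ball_subset_closedBall hz')⟩), hcd.contDiffAt.add (contDiffAt_const.mul hwx), fun hz => ?_⟩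
    obtain ⟨l1, l2⟩ := lin2 (-m⁻¹) (hcd.contDiffAt (x := x)) hwx
    rw [l1] at hz
    rw [l2, tr_add, tr_smul]
    have D : ∀ t : ℝ, HasDerivAt (fun t => Real.exp (-γ * t)) (-γ * Real.exp (-γ * t)) t := fun t => by
      have := ((hasDerivAt_id t).const_mul (-γ)).exp
      simpa [mul_comm] using this
    obtain ⟨r1', r2⟩ := D2_rad (F := fun t => Real.exp (-γ * t) - Real.exp (-γ * r ^ 2)) (F1 := fun t => -γ * Real.exp (-γ * t)) y x
      (Eventually.of_forall fun t => (D t).sub_const _) ((D _).const_mul (-γ))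
    change Df h x = _ at r1'
    change D2 h x = _ at r2
    have E0 := Real.exp_pos (-γ * N(x - y) ^ 2)
    set E := Real.exp (-γ * N(x - y) ^ 2) with hE
    have n1 : N(Df h x) ≤ 2 * γ * E := by
      have : N(ip (x - y)) ≤ 1 := by rw [show ip (x - y) = innerSL ℝ (x - y) from rfl, innerSL_apply_norm]; linarith
      rw [r1', norm_smul, nea, show 2 * (-γ * E) = -(2 * γ * E) by ring, abs_neg, abs_of_pos pv]
      exact mul_le_of_le_one_right pv this
    have n2 : m⁻¹ * N(Df w x) = N(Df h x) := by
      rw [eq_neg_of_add_eq_zero_left hz, neg_smul, neg_neg, norm_smul, nea, abs_of_pos pv]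
    have n3 := mll (hw x hx1) (by positivity : 0 ≤ m⁻¹)
    have n4 : k * (m⁻¹ * w x + m⁻¹ * N(Df w x)) ≤ k * (E + 2 * γ * E) := mll (by linarith only [hv, hle, n1, n2]) hk
    have t1 := (tr_ip ha hd x).2
    have t2 := (ha.ell x (x - y)).1
    rw [quad_tr] at t2
    have t3 : C⁻¹ * ρ ^ 2 ≤ C⁻¹ * N(x - y) ^ 2 := by clear * - hρp e2 hC; gcongr
    rw [r2, tr_add, tr_smul, tr_smul]
    have t4 : γ * E * tr (a x) ip ≤ γ * E * (d * C) := by gcongr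
    have t5 : γ * E * (4 * γ * (C⁻¹ * ρ ^ 2)) ≤ γ * E * (4 * γ * tr (a x) (oz (x - y))) := by gcongr; linarith only [t2, t3]
    have t6 := mul_lt_mul_of_pos_left hγ2 (by positivity : 0 < γ * E)
    have t7 : k * E ≤ γ * (k * E) := le_mul_of_one_le_left pv hγ1
    linarith only [n3, n4, t4, t5, t6, t7]
  obtain ⟨q, hq⟩ : ∃ q, q = Real.exp (-γ * r ^ 2) := ⟨_, rfl⟩
  have hq0 : 0 < q := hq ▸ Real.exp_pos _
  have hq1 : q ≤ 1 := hq ▸ Real.exp_le_one_iff.2 (by nlinarith only [hγ1, sq_nonneg r])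
  refine ⟨m * q, by positivity, fun x hx => ?_⟩
  have rr : 0 ≤ r ^ 2 - N(x - y) ^ 2 := by nlinarith only [hr, hx, r1, hρp, hρ2, norm_nonneg (x - y)]
  rcases le_or_gt N(x - y) ρ with hl | hl
  · refine le_trans ?_ (hin x hl)
    have : q * (r ^ 2 - N(x - y) ^ 2) ≤ 1 := mul_le_one₀ hq1 rr (by nlinarith only [r1, hr, norm_nonneg (x - y)])
    nlinarith only [hp, this, r1, hρp, hρ2, hm]
  · have := key x ⟨by simpa [dist_eq_norm] using hx, by simpa [dist_eq_norm] using hl.le⟩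
    have e : Real.exp (-γ * N(x - y) ^ 2) = q * Real.exp (γ * (r ^ 2 - N(x - y) ^ 2)) := by rw [hq, ← Real.exp_add]; congr 1; ring
    have e1 := Real.add_one_le_exp (γ * (r ^ 2 - N(x - y) ^ 2))
    have e2 : r ^ 2 - N(x - y) ^ 2 ≤ γ * (r ^ 2 - N(x - y) ^ 2) := le_mul_of_one_le_left rr hγ1
    have e3 : q * (r ^ 2 - N(x - y) ^ 2) ≤ h x := by simp only [hh]; rw [e, ← hq]; nlinarith only [r1, hρp, hρ2, hq0, e1, e2]
    have e4 : m * h x ≤ w x := by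
      have := mll this hm0.le
      have e5 : m * (m⁻¹ * w x) = w x := by field_simp
      linarith
    nlinarith only [e4, hp, e3, r1, hρp, hρ2, hm]
lemma hopf {a : EE → MM} {K C k : ℝ} (ha : Coef a K C) (hd : 1 ≤ d) (hk : 0 ≤ k) {w : EE → ℝ}
    (h2 : ContDiffOn ℝ 2 w (ball 0 1)) (hc : ContinuousOn w (closedBall 0 1)) (h0 : ∀ x, N(x) ≤ 1 → 0 ≤ w x)
    (hw : ∀ x, N(x) < 1 → tr (a x) (D2 w x) ≤ k * (w x + N(Df w x))) {y : EE} (hy : N(y) < 1) (hp : 0 < w y) :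
    ∃ ε, 0 < ε ∧ ∀ x, N(x) ≤ 1 → ε * (1 - N(x) ^ 2) ≤ w x := by
  have h1 := cont_ind (P := fun τ => 0 < w ((1 - τ) • y)) (δ := 1 - N(y)) lna (by simpa using hp) fun τ ε hτ hε hε1 hle hP => by
    obtain ⟨η, η0, hη⟩ := hopf0 ha hd hk h2 hc h0 hw (r := 1 - N(y)) lna (by
      rw [norm_smul, nea, abs_of_nonneg lna]; nlinarith only [hτ, norm_nonneg y]) hP
    have e : (1 - (τ + ε)) • y - (1 - τ) • y = -(ε • y) := by module
    have e1 : N((1 - (τ + ε)) • y - (1 - τ) • y) = ε * N(y) := by rw [e, norm_neg, norm_smul, nea, abs_of_pos hε]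
    have e2 : ε * N(y) < 1 - N(y) := by nlinarith only [hε1, hy, hε, norm_nonneg y]
    have := hη _ (e1.trans_le e2.le)
    rw [e1] at this
    refine lt_of_lt_of_le (mul_pos η0 ?_) this
    have : 0 ≤ ε * N(y) := by positivity
    nlinarith only [hy, e2, this]
  obtain ⟨ε, e0, he⟩ := hopf0 ha hd hk h2 hc h0 hw (y := 0) (r := 1) one_pos smp (by simpa using h1)
  exact ⟨ε, e0, fun x hx => by simpa using he x (by simpa using hx)⟩
structure Ctx (a : EE → MM) (H : EE → ℝ → EL → ℝ) (K C L s : ℝ) : Prop where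
  ha : Coef a K C
  hd : 1 ≤ d
  hH : Ham H L
  hs : L + C * L ^ 2 ≤ s
  lt : L < s
noncomputable def Qo (a : EE → MM) (H : EE → ℝ → EL → ℝ) (s : ℝ) (u : EE → ℝ) (x : EE) : ℝ :=
  tr (a x) (D2 u x) - s * u x + H x (u x) (Df u x)
lemma Ctx.cmp {a : EE → MM} {H : EE → ℝ → EL → ℝ} {K C L s : ℝ} (X : Ctx a H K C L s) {u v : EE → ℝ}
    (hu : ContDiffOn ℝ 2 u (ball 0 1)) (hv : ContDiffOn ℝ 2 v (ball 0 1)) (cu : ContinuousOn u (closedBall 0 1)) (cv : ContinuousOn v (closedBall 0 1))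
    (hb : ∀ x, N(x) = 1 → u x ≤ v x) (h : ∀ x, N(x) < 1 → Qo a H s v x ≤ Qo a H s u x) : ∀ x, N(x) ≤ 1 → u x ≤ v x := by
  intro x hx
  have key := MP X.ha (v := fun y => u y + (-1) * v y) (isCompact_closedBall (0 : EE) 1) (cu.add (continuousOn_const.mul cv)) (fun y hy hp => ?_) x (by simpa using hx)
  · linarith
  · have hy' : N(y) < 1 := lt_of_le_of_ne (by simpa using hy) fun e => by linarith [hb y e]
    have hu := hu.contDiffAt (nb hy')
    have hv := hv.contDiffAt (nb hy')
    refine ⟨cb_nb hy', hu.add (contDiffAt_const.mul hv), fun hz => ?_⟩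
    obtain ⟨l1, l2⟩ := lin2 (-1) hu hv
    rw [l1, neg_one_smul, ← sub_eq_add_neg] at hz
    rw [l2, tr_add, tr_smul]
    have h1 := h y hy'
    have h3 := X.hH.lip y (u y) (v y) (Df u y) (Df v y)
    have hp' : 0 < u y - v y := by linarith
    rw [hz, norm_zero, add_zero, abs_of_pos hp'] at h3
    have h4 := (abs_le.1 h3).2
    unfold Qo at h1
    nlinarith only [h1, h4, hp, X, X.lt]
lemma Qo_smul {a : EE → MM} {H : EE → ℝ → EL → ℝ} {L s t : ℝ} (hH : Ham H L) {u : EE → ℝ} {x : EE} (hu : ContDiffAt ℝ 2 u x)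
    (ht : 0 ≤ t) : Qo a H s (fun y => 0 + t * u y) x = t * Qo a H s u x := by
  obtain ⟨l1, l2⟩ := lin2 t (contDiffAt_const (c := (0:ℝ)) (x := x)) hu
  have e : Df (fun _ : EE => (0:ℝ)) = fun _ => 0 := by ext x; simp
  have e2 : D2 (fun _ : EE => (0:ℝ)) x = 0 := by unfold D2; rw [e]; simp
  unfold Qo
  rw [l1, l2, e, e2, tr_add, show tr (a x) 0 = 0 by simp [tr], show ((fun _ => 0 : EE → EL) x + t • Df u x) = t • Df u x from zero_add _, tr_smul]
  simp only [zero_add]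
  rw [hH.hom x _ _ t ht]
  ring
lemma Ctx.upper {a : EE → MM} {H : EE → ℝ → EL → ℝ} {K C L s : ℝ} (X : Ctx a H K C L s) :
    ∃ c, 0 < c ∧ ∀ (u : EE → ℝ) (N : ℝ), 0 ≤ N → ContDiffOn ℝ 2 u (ball 0 1) → ContinuousOn u (closedBall 0 1) → (∀ x, N(x) = 1 → u x ≤ 0) →
    (∀ x, N(x) < 1 → -N ≤ Qo a H s u x) → ∀ x, N(x) ≤ 1 → u x ≤ c * N * (1 - N(x) ^ 2) := by
  have hC := X.ha.hC
  have hCp : 0 < C := by linarith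
  have hL := X.hH.hL
  obtain ⟨κ, hκ⟩ : ∃ κ : ℝ, κ = C ^ 2 * L ^ 2 + 1 := ⟨_, rfl⟩
  have κ0 : 0 < κ := by rw [hκ]; positivity
  set h : EE → ℝ := fun x => 1 - Real.exp (-κ * (1 - N(x - 0) ^ 2)) with hh
  have hcd : ContDiff ℝ 2 h := by
    have : ContDiff ℝ 2 fun x : EE => N(x - 0) ^ 2 := (contDiff_id.sub contDiff_const).norm_sq ℝ
    exact contDiff_const.sub (Real.contDiff_exp.comp (contDiff_const.mul (contDiff_const.sub this)))
  obtain ⟨q, hq⟩ : ∃ q, q = Real.exp (-κ) := ⟨_, rfl⟩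
  have hq0 : 0 < q := hq ▸ Real.exp_pos _
  have hQ : ∀ x, N(x) < 1 → Qo a H s h x ≤ -(κ * q * C⁻¹) := fun x hx => by
    have D : ∀ t : ℝ, HasDerivAt (fun t => Real.exp (-κ * (1 - t))) (κ * Real.exp (-κ * (1 - t))) t := fun t => by
      have := (((hasDerivAt_id t).const_sub 1).const_mul (-κ)).exp
      simpa [mul_comm] using this
    obtain ⟨r1, r2⟩ := D2_rad (F := fun t => 1 - Real.exp (-κ * (1 - t))) (F1 := fun t => -(κ * Real.exp (-κ * (1 - t)))) 0 x
      (Eventually.of_forall fun t => (D t).const_sub _) ((D _).const_mul κ).neg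
    change Df h x = _ at r1
    change D2 h x = _ at r2
    have E0 := Real.exp_pos (-κ * (1 - N(x - 0) ^ 2))
    have x2 : N(x - 0) ^ 2 ≤ 1 := by rw [sub_zero]; nlinarith only [hx, norm_nonneg x]
    have E1 : q ≤ Real.exp (-κ * (1 - N(x - 0) ^ 2)) := hq ▸ Real.exp_le_exp.2 (by nlinarith only [κ0, sq_nonneg N(x - 0)])
    have E2 : Real.exp (-κ * (1 - N(x - 0) ^ 2)) ≤ 1 := Real.exp_le_one_iff.2 (by nlinarith only [κ0, x2])
    have hx0 : h x = 1 - Real.exp (-κ * (1 - N(x - 0) ^ 2)) := rfl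
    set E := Real.exp (-κ * (1 - N(x - 0) ^ 2)) with hE
    have n1 : N(Df h x) = 2 * κ * E * N(x) := by
      rw [r1, show ip (x - 0) = innerSL ℝ (x - 0) from rfl, norm_smul, nea, show 2 * (-(κ * E)) = -(2 * κ * E) by ring, abs_neg, abs_of_pos pv, innerSL_apply_norm, sub_zero]
    have t1 := (tr_ip X.ha X.hd x).1
    have t2 := (X.ha.ell x (x - 0)).1
    rw [quad_tr] at t2
    have hb := (abs_le.1 (X.hH.bd x (h x) (Df h x))).2
    have h0 : 0 ≤ h x := by rw [hx0]; linarith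
    rw [abs_of_nonneg h0, n1] at hb
    have sh : L * h x ≤ s * h x := mlr X.lt.le h0
    unfold Qo
    rw [r2, tr_add, tr_smul, tr_smul]
    have a1 : κ * E * C⁻¹ ≤ κ * E * tr (a x) ip := by gcongr
    have a2 : κ * E * (κ * (C⁻¹ * N(x) ^ 2)) ≤ κ * E * (κ * tr (a x) (oz (x - 0))) := by rw [sub_zero] at t2 ⊢; (clear * - t2 κ0; gcongr)
    have a3 : 2 * L * N(x) ≤ C⁻¹ + κ * (C⁻¹ * N(x) ^ 2) := by
      have e : C⁻¹ + κ * (C⁻¹ * N(x) ^ 2) - 2 * L * N(x) = C⁻¹ * ((1 - C * L * N(x)) ^ 2 + N(x) ^ 2) := by rw [hκ]; field_simp; ring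
      have : 0 ≤ C⁻¹ * ((1 - C * L * N(x)) ^ 2 + N(x) ^ 2) := by clear * - hC; positivity
      linarith only [e, this]
    have a4 := mll a3 (by positivity : 0 ≤ κ * E)
    have a5 : κ * q * C⁻¹ ≤ κ * E * C⁻¹ := by clear * - E1 κ0 hC; gcongr
    have a6 : 0 ≤ κ * E * (κ * (C⁻¹ * N(x) ^ 2)) := by positivity
    linarith only [hb, sh, a1, a2, a4, a5, a6]
  refine ⟨C / q, by positivity, fun u N hN h2 hc hb hu x hx => ?_⟩
  have ht : 0 ≤ N * C / (κ * q) := by positivity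
  have := X.cmp h2 (v := fun y => 0 + N * C / (κ * q) * h y) (contDiff_const.add (contDiff_const.mul hcd)).contDiffOn hc
    (contDiff_const.add (contDiff_const.mul hcd)).continuous.continuousOn (fun y hy => ?_) (fun y hy => ?_) x hx
  · refine this.trans ?_
    have e1 := Real.add_one_le_exp (-κ * (1 - N(x - 0) ^ 2))
    have : h x ≤ κ * (1 - N(x) ^ 2) := by simp only [hh]; rw [sub_zero] at e1 ⊢; linarith
    have := mll this ht
    rw [zero_add]
    refine this.trans (le_of_eq ?_)
    (clear * - κ0 hq0 hC; field_simp)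
  · have : h y = 0 := by simp [hh, hy]
    rw [this]; simpa using hb y hy
  · rw [Qo_smul X.hH hcd.contDiffAt ht]
    have := mll (hQ y hy) ht
    have e : N * C / (κ * q) * -(κ * q * C⁻¹) = -N := by field_simp
    linarith [hu y hy]
end
section
variable {a : EuclideanSpace ℝ (Fin d) → Matrix (Fin d) (Fin d) ℝ} {H : EuclideanSpace ℝ (Fin d) → ℝ → (EuclideanSpace ℝ (Fin d) →L[ℝ] ℝ) → ℝ} {K C L s : ℝ}
def Rg (u : EE → ℝ) : Prop := ContDiffOn ℝ 2 u (ball 0 1) ∧ ContinuousOn u (closedBall 0 1)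
def BX (u : EE → ℝ) : Prop := ∃ M, WX M u
lemma Rg.smul {u : EE → ℝ} (h : Rg u) (t : ℝ) : Rg (fun y => 0 + t * u y) :=
  ⟨contDiffOn_const.add (contDiffOn_const.mul h.1), continuousOn_const.add (continuousOn_const.mul h.2)⟩
lemma BX.rg {u : EE → ℝ} (h : BX u) : Rg u := let ⟨_, h⟩ := h; ⟨h.cd, h.cont⟩
lemma BX.bdry {u : EE → ℝ} (h : BX u) {x : EE} (hx : N(x) = 1) : u x = 0 := let ⟨_, h⟩ := h; h.bdry hx
lemma BX.smul {u : EE → ℝ} (h : BX u) (t : ℝ) : BX (fun y => 0 + t * u y) := let ⟨_, h⟩ := h; ⟨_, WX.zero.lin h t⟩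
lemma Ctx.strong (X : Ctx a H K C L s) {u v : EE → ℝ} (hu : Rg u) (hv : Rg v) (hle : ∀ x, N(x) ≤ 1 → v x ≤ u x) {k : ℝ} (hk : 0 ≤ k)
    (hQ : ∀ x, N(x) < 1 → Qo a H s u x ≤ Qo a H s v x + k * (u x - v x)) {y : EE} (hy : N(y) < 1) (hlt : v y < u y) :
    ∃ ε, 0 < ε ∧ ∀ x, N(x) ≤ 1 → v x + ε * (1 - N(x) ^ 2) ≤ u x := by
  have hL := X.hH.hL
  have hsL := X.lt
  have key := hopf (w := fun y => u y + (-1) * v y) (k := k + s + L) X.ha X.hd lna (hu.1.add (contDiffOn_const.mul hv.1))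
    (hu.2.add (continuousOn_const.mul hv.2)) (fun x hx => by linarith [hle x hx]) (fun x hx => ?_) hy lna
  · obtain ⟨ε, e0, he⟩ := key
    exact ⟨ε, e0, fun x hx => by linarith [he x hx]⟩
  · obtain ⟨l1, l2⟩ := lin2 (-1) (hu.1.contDiffAt (nb hx)) (hv.1.contDiffAt (nb hx))
    rw [l1, l2, tr_add, tr_smul, neg_one_smul, ← sub_eq_add_neg]
    have h1 := hQ x hx
    unfold Qo at h1
    have h2 := (abs_le.1 (X.hH.lip x (u x) (v x) (Df u x) (Df v x))).1
    have h3 := hle x hx.le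
    rw [abs_of_nonneg lna] at h2
    have h4 : 0 ≤ (k + s) * N(Df u x - Df v x) := mul_nonneg lna (norm_nonneg _)
    linarith
lemma Ctx.unif (X : Ctx a H K C L s) : ∃ A, 0 ≤ A ∧ ∀ u v w f : EE → ℝ, BX u → BX v → BX w → (∀ x, N(x) < 1 → |f x| ≤ 1) →
    (∀ x, N(x) < 1 → Qo a H s u x = - f x) → (∀ x, N(x) < 1 → Qo a H s v x = - u x) → (∀ x, N(x) < 1 → Qo a H s w x = - v x) → WX A v ∧ WX A w := by
  obtain ⟨A, hA, e2⟩ := E2 X.ha X.hd X.hH.hL X.hs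
  obtain ⟨c, hc, e4⟩ := E4 X.ha X.hd X.hH.hL X.hs
  have e5 : ∀ u v N, BX v → WY N u → (∀ x, N(x) < 1 → Qo a H s v x = - u x) → WX (c * (N + 1)) v := fun u v N ⟨M, hv⟩ hu h => by
    have := WX.zero.toWY.lin hu (-1)
    refine e4 H X.hH v _ M _ hv (by linarith [hu.nonneg]) (this.mono smp) fun x hx => ?_
    have := h x hx
    unfold Qo at this
    linarith
  obtain ⟨A', h'⟩ : ∃ A', A' = c * (2 * A + 1) := ⟨_, rfl⟩
  have h0 : 0 ≤ A' := by rw [h']; positivity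
  have h1 : 0 ≤ c * (2 * A' + 1) := by positivity
  refine ⟨A' + c * (2 * A' + 1), by positivity, fun u v w f ⟨M, hu⟩ hv hw hf q1 q2 q3 => ?_⟩
  have x1 := e2 u M 1 hu one_pos fun x hx => by
    have h2 : tr (a x) (D2 u x) - s * u x = -f x - H x (u x) (Df u x) := by rw [← q1 x hx]; unfold Qo; ring
    rw [h2]
    have h3 := (abs_sub (-f x) (H x (u x) (Df u x))).trans (add_le_add (le_refl |-f x|) (X.hH.bd x (u x) (Df u x)))
    rw [abs_neg] at h3
    have h2 := mlr (h3.trans (add_le_add_left (hf x hx) _)) (dlp x 3).1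
    linarith [(dlp x 3).2]
  rw [mul_one] at x1
  have hv' := h' ▸ e5 u v _ hv (toWY hA hu.cd x1.sup x1.grad) q2
  exact ⟨hv'.mono lna, (e5 v w _ hw hv'.toWY q3).mono lna⟩
lemma Ctx.eig (X : Ctx a H K C L s) : ∃ (μ : ℝ) (g : EE → ℝ), 0 < μ ∧ BX g ∧ (∀ x, N(x) < 1 → 0 < g x) ∧
    (∃ c, 0 < c ∧ ∀ x, N(x) ≤ 1 → g x ≤ c * (1 - N(x) ^ 2)) ∧ ∀ x, N(x) < 1 → μ * Qo a H s g x = - g x := by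
  have hT : ∀ f, ∃ u, BX f → BX u ∧ ∀ x, N(x) < 1 → Qo a H s u x = - f x := fun f => by
    by_cases hf : BX f
    · obtain ⟨M, hM⟩ := hf
      have := (WX.zero.lin hM (-1)).toWY
      obtain ⟨u, M', h1, h2⟩ := nl_sol X.ha X.hd X.hH X.hs _ (2 * (0 + |-1| * M) + 1) (by linarith [this.nonneg]) (this.mono lna)
      exact ⟨u, fun _ => ⟨⟨M', h1⟩, fun x hx => by unfold Qo; rw [h2 x hx]; ring⟩⟩
    · exact ⟨f, fun h => absurd h hf⟩
  choose T hT using hT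
  obtain ⟨c, c0, hc⟩ := X.upper
  obtain ⟨A, hA, hun⟩ := X.unif
  have mono : ∀ f f', BX f → BX f' → (∀ x, N(x) < 1 → f x ≤ f' x) → ∀ x, N(x) ≤ 1 → T f x ≤ T f' x := fun f f' hf hf' h => by
    obtain ⟨b1, q1⟩ := hT f hf
    obtain ⟨b2, q2⟩ := hT f' hf'
    exact X.cmp b1.rg.1 b2.rg.1 b1.rg.2 b2.rg.2 (fun x hx => by rw [b1.bdry hx, b2.bdry hx]) fun x hx => by rw [q1 x hx, q2 x hx]; linarith [h x hx]
  have uni : ∀ f u, BX f → BX u → (∀ x, N(x) < 1 → Qo a H s u x = - f x) → ∀ x, N(x) ≤ 1 → T f x = u x := fun f u hf b2 q2 x hx => by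
    obtain ⟨b1, q1⟩ := hT f hf
    exact le_antisymm (X.cmp b1.rg.1 b2.rg.1 b1.rg.2 b2.rg.2 (fun x hx => by rw [b1.bdry hx, b2.bdry hx]) (fun x hx => by rw [q1 x hx, q2 x hx]) x hx)
      (X.cmp b2.rg.1 b1.rg.1 b2.rg.2 b1.rg.2 (fun x hx => by rw [b1.bdry hx, b2.bdry hx]) (fun x hx => by rw [q1 x hx, q2 x hx]) x hx)
  have hom : ∀ f t, BX f → 0 ≤ t → ∀ x, N(x) ≤ 1 → T (fun y => 0 + t * f y) x = t * T f x := fun f t hf ht x hx => by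
    obtain ⟨b1, q1⟩ := hT f hf
    rw [uni _ _ (hf.smul t) (b1.smul t) (fun x hx => ?_) x hx]
    · ring
    · rw [Qo_smul X.hH (b1.rg.1.contDiffAt (nb hx)) ht, q1 x hx]; ring
  have str : ∀ f f', BX f → BX f' → (∀ x, N(x) < 1 → f x ≤ f' x) → ∀ y, N(y) < 1 → f y < f' y → ∃ ε, 0 < ε ∧ ∀ x, N(x) ≤ 1 → T f x + ε * (1 - N(x) ^ 2) ≤ T f' x := by
    intro f f' hf hf' h y hy hlt
    have hm := mono f f' hf hf' h
    obtain ⟨b1, q1⟩ := hT f hf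
    obtain ⟨b2, q2⟩ := hT f' hf'
    by_cases hz : ∃ z, N(z) < 1 ∧ T f z < T f' z
    · obtain ⟨z, hz, hz'⟩ := hz
      exact X.strong b2.rg b1.rg hm le_rfl (fun x hx => by rw [q1 x hx, q2 x hx]; linarith [h x hx]) hz hz'
    · push Not at hz
      have e : T f =ᶠ[𝓝 y] T f' := by
        filter_upwards [nb hy] with z hz'
        have : N(z) < 1 := by simpa using hz'
        exact le_antisymm (hm z this.le) (hz z this)
      have e1 := q1 y hy
      have e2 := q2 y hy
      unfold Qo at e1 e2
      rw [D2_congr e, e.fderiv_eq, e.eq_of_nhds] at e1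
      linarith
  have hφ : BX (fun x : EE => (1 - N(x) ^ 2) * 1) := WX_smooth contDiff_const
  have φ0 : ∀ x : EE, N(x) ≤ 1 → 0 ≤ 1 - N(x) ^ 2 := fun x hx => by nlinarith only [hx, norm_nonneg x]
  have up : ∀ f N, BX f → 0 ≤ N → (∀ x, N(x) < 1 → f x ≤ N) → ∀ x, N(x) ≤ 1 → T f x ≤ c * N * (1 - N(x) ^ 2) := fun f N hf hN h => by
    obtain ⟨b1, q1⟩ := hT f hf
    exact hc _ N hN b1.rg.1 b1.rg.2 (fun x hx => (b1.bdry hx).le) fun x hx => by rw [q1 x hx]; linarith [h x hx]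
  have bdd : ∀ f, BX f → (∀ x, N(x) ≤ 1 → 0 ≤ f x) → ∃ x0 : EE, N(x0) ≤ 1 ∧ ∀ x, N(x) ≤ 1 → f x ≤ f x0 := fun f hf h => by
    obtain ⟨x0, h0, hm⟩ := (isCompact_closedBall (0 : EE) 1).exists_isMaxOn ⟨0, by simp⟩ hf.rg.2
    exact ⟨x0, by simpa using h0, fun x hx => hm (by simpa using hx)⟩
  set Λ : Set ℝ := {l | 0 ≤ l ∧ ∃ f, BX f ∧ (∀ x, N(x) ≤ 1 → 0 ≤ f x) ∧ (∃ x, N(x) ≤ 1 ∧ 0 < f x) ∧ ∀ x, N(x) ≤ 1 → l * f x ≤ T f x} with hΛ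
  have Λb : BddAbove Λ := by
    refine ⟨c, fun l ⟨hl, f, bf, f0, ⟨x1, hx1, fp⟩, hf⟩ => ?_⟩
    obtain ⟨x0, hx0, hm⟩ := bdd f bf f0
    have p : 0 < f x0 := fp.trans_le (hm x1 hx1)
    have h1 := (hf x0 hx0).trans (up f (f x0) bf p.le (fun x hx => hm x hx.le) x0 hx0)
    have h2 : c * f x0 * (1 - N(x0) ^ 2) ≤ c * f x0 * 1 := mll (by linarith [sq_nonneg N(x0)]) pv
    rw [mul_one] at h2
    exact le_of_mul_le_mul_right (h1.trans h2) p
  obtain ⟨ε1, ε10, hε1⟩ : ∃ ε, 0 < ε ∧ ε ∈ Λ := by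
    obtain ⟨ε, e0, he⟩ := str _ _ (hφ.smul 0) hφ (fun x hx => by linarith [φ0 x hx.le]) 0 smp smp
    refine ⟨ε, e0, e0.le, _, hφ, fun x hx => by linarith [φ0 x hx], ⟨0, by simp, by simp⟩, fun x hx => ?_⟩
    have := he x hx
    rw [hom _ 0 hφ le_rfl x hx] at this
    linarith
  set μ := sSup Λ with hμ
  have μ0 : 0 < μ := ε10.trans_le (le_csSup Λb hε1)
  have good : ∀ l ∈ Λ, ∃ g h : EE → ℝ, WX A g ∧ WX A h ∧ (∀ x, N(x) < 1 → Qo a H s h x = - g x) ∧ (∀ x, N(x) ≤ 1 → 0 ≤ g x) ∧ (∀ x, N(x) ≤ 1 → l * g x ≤ h x) ∧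
      ∃ x, N(x) ≤ 1 ∧ l ^ 2 ≤ g x := by
    rintro l ⟨hl, f, bf, f0, ⟨x1, hx1, fp⟩, hf⟩
    obtain ⟨x0, hx0, hm⟩ := bdd f bf f0
    have p : 0 < f x0 := fp.trans_le (hm x1 hx1)
    have ip : 0 ≤ (f x0)⁻¹ := by positivity
    obtain ⟨f1, hf1⟩ : ∃ f1 : EE → ℝ, f1 = fun y => 0 + (f x0)⁻¹ * f y := ⟨_, rfl⟩
    have b1 : BX f1 := hf1 ▸ bf.smul _
    have f10 : ∀ x, N(x) ≤ 1 → 0 ≤ f1 x := fun x hx => by rw [hf1]; have := mul_nonneg ip (f0 x hx); linarith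
    have f11 : ∀ x, N(x) ≤ 1 → f1 x ≤ 1 := fun x hx => by
      have := mll (hm x hx) ip
      rw [inv_mul_cancel₀ p.ne'] at this
      rw [hf1]; linarith
    have f12 : f1 x0 = 1 := by rw [hf1]; simp [p.ne']
    have u1 : ∀ x, N(x) ≤ 1 → l * f1 x ≤ T f1 x := fun x hx => by
      have := mll (hf x hx) ip
      rw [hf1, hom f _ bf ip x hx]; linarith
    obtain ⟨b2, q2⟩ := hT _ b1
    obtain ⟨b3, q3⟩ := hT _ b2
    obtain ⟨b4, q4⟩ := hT _ b3
    have u2 : ∀ x, N(x) ≤ 1 → l * T f1 x ≤ T (T f1) x := fun x hx => by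
      rw [← hom _ l b1 hl x hx]
      exact mono _ _ (b1.smul l) b2 (fun x hx => by linarith [u1 x hx.le]) x hx
    have u3 : ∀ x, N(x) ≤ 1 → l * T (T f1) x ≤ T (T (T f1)) x := fun x hx => by
      rw [← hom _ l b2 hl x hx]
      exact mono _ _ (b2.smul l) b3 (fun x hx => by linarith [u2 x hx.le]) x hx
    have n1 : ∀ x, N(x) ≤ 1 → l ^ 2 * f1 x ≤ T (T f1) x := fun x hx => by
      have := mll (u1 x hx) hl
      linarith [u2 x hx]
    obtain ⟨w1, w2⟩ := hun _ _ _ _ b2 b3 b4 (fun x hx => abs_le.2 ⟨by linarith [f10 x hx.le], f11 x hx.le⟩) q2 q3 q4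
    refine ⟨_, _, w1, w2, q4, fun x hx => (mul_nonneg (sq_nonneg l) (f10 x hx)).trans (n1 x hx), u3, x0, hx0, ?_⟩
    have := n1 x0 hx0
    rwa [f12, mul_one] at this
  have seq : ∀ k : ℕ, ∃ (g h : EE → ℝ) (x : EE), WX A g ∧ WX A h ∧ (∀ x, N(x) < 1 → Qo a H s h x = - g x) ∧ (∀ x, N(x) ≤ 1 → 0 ≤ g x) ∧
      (∀ x, N(x) ≤ 1 → (μ - 1 / ((k:ℝ) + 1)) * g x ≤ h x) ∧ N(x) ≤ 1 ∧ (μ / 2) ^ 2 ≤ g x := fun k => by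
    have hk : (0:ℝ) < 1 / ((k:ℝ) + 1) := by positivity
    obtain ⟨l, hl, hlt⟩ := exists_lt_of_lt_csSup ⟨_, hε1⟩ (show max (μ / 2) (μ - 1 / ((k:ℝ) + 1)) < sSup Λ from max_lt lna lna)
    obtain ⟨g, h, h1, h2, h3, h4, h5, x, hx, h6⟩ := good l hl
    refine ⟨g, h, x, h1, h2, h3, h4, fun x hx => (mlr ((le_max_right _ _).trans hlt.le) (h4 x hx)).trans (h5 x hx), hx, le_trans ?_ h6⟩
    exact pow_le_pow_left₀ pv ((le_max_left _ _).trans hlt.le) 2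
  choose gk hk xk w1 w2 q4 g0 gh xk1 gx using seq
  obtain ⟨m, hm⟩ : ∃ m, m = (μ / 2) ^ 2 := ⟨_, rfl⟩
  have m0 : 0 < m := by rw [hm]; positivity
  obtain ⟨g, wg, lg⟩ := CL gk w1
  obtain ⟨h, wh, lh⟩ := CL hk w2
  have bg : BX g := ⟨A, wg⟩
  have bh : BX h := ⟨A, wh⟩
  have gnn : ∀ x, N(x) ≤ 1 → 0 ≤ g x := fun x hx => by
    rcases hx.lt_or_eq with h1 | h1
    · exact ge_of_tendsto' (lg x h1).1 fun k => g0 k x hx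
    · rw [bg.bdry h1]
  have hge : ∀ x, N(x) ≤ 1 → μ * g x ≤ h x := fun x hx => by
    rcases hx.lt_or_eq with h1 | h1
    · have t1 := (tendsto_const_nhds (x := μ)).sub (hyp_of (tendsto_one_div_add_atTop_nhds_zero_nat (𝕜 := ℝ)))
      have := le_of_tendsto_of_tendsto' (t1.mul (lg x h1).1) (lh x h1).1 fun k => gh k x hx
      rwa [sub_zero] at this
    · rw [bg.bdry h1, bh.bdry h1, mul_zero]
  have hq : ∀ x, N(x) < 1 → Qo a H s h x = - g x := fun x hx => by
    have l1 := lh x hx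
    exact tendsto_nhds_unique_of_eventuallyEq (((((tr_cont (a x)).tendsto _).comp l1.2.2).sub (l1.1.const_mul s)).add (X.hH.cont x l1.1 l1.2.1))
      (lg x hx).1.neg (Eventually.of_forall fun k => q4 k x hx)
  have Th : ∀ x, N(x) ≤ 1 → T g x = h x := uni g h bg bh hq
  obtain ⟨x0, hx0, gp⟩ : ∃ x0, N(x0) < 1 ∧ 0 < g x0 := by
    obtain ⟨x0, hl⟩ := hyp_lim xk xk1
    have Ap : 0 < A := by
      by_contra h
      have h1 := (abs_le.1 ((w1 0).sup (xk 0) (xk1 0))).2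
      have h2 : A * dl (xk 0) ≤ 0 := mul_nonpos_of_nonpos_of_nonneg lna (dl_nonneg _)
      linarith [gx 0]
    have hd : ∀ k, m / A ≤ dl (xk k) := fun k => by
      rw [div_le_iff₀' Ap, hm]
      exact (gx k).trans ((le_abs_self _).trans ((w1 k).sup _ (xk1 k)))
    have hd0 : m / A ≤ dl x0 := ge_of_tendsto' ((cont_dl.tendsto x0).comp hl) hd
    have hd1 : 0 < dl x0 := lt_of_lt_of_le pv hd0
    have hx0 : N(x0) < 1 := by
      by_contra h
      have : dl x0 = 0 := Real.sqrt_eq_zero_of_nonpos lna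
      linarith
    refine ⟨x0, hx0, ?_⟩
    have hn : Tendsto (fun k => N(xk k - x0)) (hyperfilter ℕ : Filter ℕ) (𝓝 0) := tendsto_iff_norm_sub_tendsto_zero.1 hl
    have lim := (((lg x0 hx0).1.mul_const (dl x0)).add (hn.const_mul (2 * A)))
    have := ge_of_tendsto lim ((hn.eventually_lt_const (by positivity : 0 < dl x0 ^ 2 / 2)).mono fun k hk => show m * dl x0 ≤ _ by
      have h1 := lip0 (w1 k).cd (w1 k).grad hx0 hk.le
      have h2 := mlr (le_abs_self (gk k (xk k) - gk k x0)) hd1.le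
      have h3 := mlr (hm ▸ gx k) hd1.le
      linarith)
    rw [mul_zero, add_zero] at this
    exact m0.trans_le (le_of_mul_le_mul_right this hd1)
  obtain ⟨y1, hy1, hgm⟩ := bdd g bg gnn
  have gm : 0 < g y1 := gp.trans_le (hgm x0 hx0.le)
  have hup := up g (g y1) bg gm.le fun x hx => hgm x hx.le
  have fix : ∀ x, N(x) < 1 → h x = μ * g x := by
    by_contra hne
    push Not at hne
    obtain ⟨z, hz, hzn⟩ := hne
    obtain ⟨bT, -⟩ := hT g bg
    obtain ⟨ε, e0, he⟩ := str _ _ (bg.smul μ) bT (fun x hx => by rw [Th x hx.le, zero_add]; exact hge x hx.le) z hz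
      (by rw [Th z hz.le, zero_add]; exact lt_of_le_of_ne (hge z hz.le) hzn.symm)
    have : μ + ε / (c * g y1) ∈ Λ := by
      refine ⟨by positivity, T g, bT, fun x hx => ?_, ⟨x0, hx0.le, ?_⟩, fun x hx => ?_⟩
      · rw [Th x hx]; exact (mul_nonneg μ0.le (gnn x hx)).trans (hge x hx)
      · rw [Th x0 hx0.le]; exact (mul_pos μ0 gp).trans_le (hge x0 hx0.le)
      · have h1 := he x hx
        rw [hom g μ bg μ0.le x hx] at h1
        have h2 := mll (hup x hx) (by positivity : 0 ≤ ε / (c * g y1))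
        have h3 : ε / (c * g y1) * (c * g y1 * (1 - N(x) ^ 2)) = ε * (1 - N(x) ^ 2) := by clear * - c0 gm e0; field_simp
        linarith only [h1, h2, h3]
    have h1 := le_csSup Λb this
    have h2 : 0 < ε / (c * g y1) := by positivity
    linarith
  have eqn : ∀ x, N(x) < 1 → μ * Qo a H s g x = - g x := fun x hx => by
    rw [← hq x hx, ← Qo_smul X.hH (wg.cda hx) μ0.le]
    have e : (fun y => 0 + μ * g y) =ᶠ[𝓝 x] h := by
      filter_upwards [nb hx] with z hz
      rw [fix z (by simpa using hz), zero_add]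
    unfold Qo
    rw [D2_congr e, e.fderiv_eq]
    simp only [e.eq_of_nhds]
  refine ⟨μ, g, μ0, bg, fun x hx => ?_, ⟨c * g y1 / μ, by positivity, fun x hx => ?_⟩, eqn⟩
  · obtain ⟨ε, e0, he⟩ := X.strong bh.rg (bg.smul 0).rg (fun x hx => by have := (mul_nonneg μ0.le (gnn x hx)).trans (hge x hx); linarith) le_rfl
      (fun x hx => by
        rw [Qo_smul X.hH (wg.cda hx) le_rfl, hq x hx]
        have := gnn x hx.le; linarith) hx0 (by have := (mul_pos μ0 gp).trans_le (hge x0 hx0.le); linarith)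
    have h1 := he x hx.le
    rw [fix x hx] at h1
    have : 0 < ε * (1 - N(x) ^ 2) := mul_pos e0 (by nlinarith only [hx, norm_nonneg x])
    by_contra hn
    nlinarith only [hn, μ0, h1, this]
  · have h1 := (hge x hx).trans ((Th x hx).symm.le.trans (hup x hx))
    rw [div_mul_eq_mul_div, ldi μ0]
    linarith
end
section
theorem unit_main {a : EE → MM} {H : EE → ℝ → EL → ℝ} {K C L : ℝ}
    (ha : Coef a K C) (hd : 1 ≤ d) (hH : Ham H L) :
    ∃ (lam : ℝ) (g : EE → ℝ), Rg g ∧ (∀ x : EE, N(x) < 1 → 0 < g x) ∧ (∀ x : EE, N(x) = 1 → g x = 0) ∧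
      (∀ x : EE, N(x) < 1 → tr (a x) (D2 g x) + H x (g x) (Df g x) = lam * g x) ∧
      ∀ p : EE → ℝ, Rg p → (∀ x : EE, N(x) < 1 → 0 < p x) → (∀ x : EE, N(x) = 1 → p x = 0) →
        (∀ x : EE, N(x) < 1 → tr (a x) (D2 p x) + H x (p x) (Df p x) = lam * p x) →
        ∃ t, 0 < t ∧ ∀ x : EE, N(x) ≤ 1 → p x = t * g x := by
  have hL := hH.hL
  have hC := ha.hC
  have hCL : 0 ≤ C * L ^ 2 := mul_nonneg lna (sq_nonneg L)
  have X : Ctx a H K C L (L + C * L ^ 2 + 1) := ⟨ha, hd, hH, by linarith, by linarith⟩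
  generalize L + C * L ^ 2 + 1 = s at X
  obtain ⟨μ, g, μ0, bg, gp, ⟨c, c0, gc⟩, ge⟩ := X.eig
  have gb : ∀ x : EE, N(x) = 1 → g x = 0 := fun x hx => bg.bdry hx
  have gQ : ∀ x : EE, N(x) < 1 → Qo a H s g x = -μ⁻¹ * g x := fun x hx => by
    have h := ge x hx
    field_simp
    linarith
  refine ⟨s - μ⁻¹, g, bg.rg, gp, gb, fun x hx => ?_, fun p hp pp pb pe => ?_⟩
  · have h := gQ x hx
    unfold Qo at h
    linarith only [h]
  have pQ : ∀ x : EE, N(x) < 1 → Qo a H s p x = -μ⁻¹ * p x := fun x hx => by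
    have h := pe x hx
    unfold Qo
    linarith
  have n0 : N((0 : EE)) < 1 := by simp
  have pnn : ∀ x : EE, N(x) ≤ 1 → 0 ≤ p x := fun x hx => by
    rcases hx.lt_or_eq with h | h
    · exact (pp x h).le
    · exact (pb x h).ge
  have step : ∀ t, 0 ≤ t → (∀ x : EE, N(x) ≤ 1 → t * g x ≤ p x) → ∀ z : EE, N(z) < 1 → t * g z < p z →
      ∃ e, 0 < e ∧ ∀ x : EE, N(x) ≤ 1 → (t + e) * g x ≤ p x := by
    intro t ht h z hz hlt
    obtain ⟨ε, e0, he⟩ := X.strong hp (bg.smul t).rg (fun x hx => by rw [zero_add]; exact h x hx) (le_refl (0:ℝ))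
      (fun x hx => by
        rw [Qo_smul X.hH (bg.rg.1.contDiffAt (isOpen_ball.mem_nhds (by simpa using hx))) ht, gQ x hx, pQ x hx]
        have h1 := mll (h x hx.le) (inv_pos.2 μ0).le
        linarith) hz (by rw [zero_add]; exact hlt)
    refine ⟨ε / c, by positivity, fun x hx => ?_⟩
    have h1 := he x hx
    have h2 := mll (gc x hx) (by positivity : 0 ≤ ε / c)
    have h3 : ε / c * (c * (1 - N(x) ^ 2)) = ε * (1 - N(x) ^ 2) := by clear * - c0 e0; field_simp
    linarith only [h1, h2, h3]
  obtain ⟨e, e0, he⟩ := step 0 le_rfl (fun x hx => by rw [zero_mul]; exact pnn x hx) 0 n0 (by rw [zero_mul]; exact pp 0 n0)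
  rw [zero_add] at he
  set S : Set ℝ := {t | ∀ x : EE, N(x) ≤ 1 → t * g x ≤ p x} with hS
  have Sb : BddAbove S := ⟨p 0 / g 0, fun t ht => (ldi (gp 0 n0)).2 (ht 0 n0.le)⟩
  have eS : e ∈ S := he
  have tpos : 0 < sSup S := e0.trans_le (le_csSup Sb eS)
  have tS : ∀ x : EE, N(x) ≤ 1 → sSup S * g x ≤ p x := fun x hx => by
    rcases hx.lt_or_eq with h | h
    · rw [← ldi (gp x h)]
      exact csSup_le ⟨e, eS⟩ fun t ht => (ldi (gp x h)).2 (ht x hx)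
    · rw [gb x h, pb x h, mul_zero]
  refine ⟨sSup S, tpos, fun x hx => ?_⟩
  rcases hx.lt_or_eq with h | h
  · by_contra hne
    obtain ⟨e', e0', he'⟩ := step _ tpos.le tS x h (lt_of_le_of_ne (tS x hx) (Ne.symm hne))
    have := le_csSup Sb he'
    linarith
  · rw [gb x h, pb x h, mul_zero]
lemma iInf_close {U : Type*} [Nonempty U] {f g : U → ℝ} {M : ℝ} (hf : BddBelow (range f)) (hg : BddBelow (range g))
    (h : ∀ u, |f u - g u| ≤ M) : |(⨅ u, f u) - ⨅ u, g u| ≤ M := by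
  rw [abs_sub_le_iff]
  constructor
  · rw [sub_le_comm]
    exact le_ciInf fun u => by have := ciInf_le hf u; have := (abs_le.1 (h u)); linarith
  · rw [sub_le_comm]
    exact le_ciInf fun u => by have := ciInf_le hg u; have := (abs_le.1 (h u)); linarith
lemma hamInf {U : Type*} [Nonempty U] {b : EE → U → EE} {r : EE → U → ℝ} {B K : ℝ} (hB : 0 ≤ B) (hK : 0 ≤ K)
    (bB : ∀ x u, N(b x u) ≤ B) (rB : ∀ x u, |r x u| ≤ B) (bK : ∀ x y u, N(b x u - b y u) ≤ K * N(x - y))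
    (rK : ∀ x y u, |r x u - r y u| ≤ K * N(x - y)) :
    Ham (fun x v (p : EL) => ⨅ u, (p (b x u) + r x u * v)) (B + K) := by
  have bd : ∀ (x : EE) (v : ℝ) (p : EL), BddBelow (range fun u => p (b x u) + r x u * v) := fun x v p => by
    refine ⟨-(N(p) * B + B * |v|), ?_⟩
    rintro _ ⟨u, rfl⟩
    have h1 := (abs_le.1 ((p.le_opNorm (b x u)).trans (mll (bB x u) (norm_nonneg p)))).1
    have h2 : |r x u * v| ≤ B * |v| := by rw [abs_mul]; exact mlr (rB x u) (abs_nonneg v)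
    have h3 := (abs_le.1 h2).1
    show _ ≤ p (b x u) + r x u * v
    linarith
  refine ⟨by linarith, fun x v v' p p' => iInf_close (bd _ _ _) (bd _ _ _) fun u => ?_,
    fun x y v p => iInf_close (bd _ _ _) (bd _ _ _) fun u => ?_, fun x v p t ht => ?_⟩
  · have e : p (b x u) + r x u * v - (p' (b x u) + r x u * v') = (p - p') (b x u) + r x u * (v - v') := by
      rw [sub_apply]; ring
    have h1 := ((p - p').le_opNorm (b x u)).trans (mll (bB x u) (norm_nonneg _))
    have h2 : |r x u * (v - v')| ≤ B * |v - v'| := by rw [abs_mul]; exact mlr (rB x u) (abs_nonneg _)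
    rw [e]
    have h3 := abs_add_le ((p - p') (b x u)) (r x u * (v - v'))
    have h4 : 0 ≤ K * (|v - v'| + N(p - p')) := by positivity
    rw [nea] at h1
    linarith
  · have e : p (b x u) + r x u * v - (p (b y u) + r y u * v) = p (b x u - b y u) + (r x u - r y u) * v := by
      rw [map_sub]; ring
    have h1 := (p.le_opNorm (b x u - b y u)).trans (mll (bK x y u) (norm_nonneg _))
    have h2 : |(r x u - r y u) * v| ≤ K * N(x - y) * |v| := by rw [abs_mul]; exact mlr (rK x y u) (abs_nonneg _)
    rw [e]
    have h3 := abs_add_le (p (b x u - b y u)) ((r x u - r y u) * v)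
    have h4 : 0 ≤ B * N(x - y) * (|v| + N(p)) := by positivity
    rw [nea] at h1
    linarith
  · show (⨅ u, ((t • p) (b x u) + r x u * (t * v))) = t * ⨅ u, (p (b x u) + r x u * v)
    rw [Real.mul_iInf_of_nonneg ht]
    congr 1
    funext u
    rw [smul_apply, smul_eq_mul]
    ring
lemma Gop_eq {U : Type*} {a : EE → MM} {b : EE → U → EE} {r : EE → U → ℝ} {ψ : EE → ℝ} {x : EE}
    (h : ContDiffAt ℝ 2 ψ x) : Gop a b r ψ x = tr (a x) (D2 ψ x) + ⨅ u, (Df ψ x (b x u) + r x u * ψ x) := by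
  unfold Gop
  congr 1
  · refine Finset.sum_congr rfl fun i _ => Finset.sum_congr rfl fun j _ => ?_
    congr 1
    unfold sdv
    rw [fderiv_clm_apply (diff1 h) (differentiableAt_const _)]
    simp [D2]
  · congr 1
    funext u
    congr 1
    rw [real_inner_comm, gradient, InnerProductSpace.toDual_symm_apply]
end
section
lemma Gop_scale {U : Type*} {a : EE → MM} {b : EE → U → EE} {r : EE → U → ℝ} {ψ : EE → ℝ} {c y : EE}
    {R : ℝ} (h : ContDiffAt ℝ 2 ψ (c + R • y)) :
    R ^ 2 * Gop a b r ψ (c + R • y) = tr (a (c + R • y)) (D2 (fun z => ψ (c + R • z)) y) +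
      ⨅ u, (Df (fun z => ψ (c + R • z)) y (R • b (c + R • y) u) + R ^ 2 * r (c + R • y) u * ψ (c + R • y)) := by
  rw [Gop_eq h, mul_add, Real.mul_iInf_of_nonneg (sq_nonneg R)]
  congr 1
  · unfold tr
    rw [Finset.mul_sum]
    refine Finset.sum_congr rfl fun i _ => ?_
    rw [Finset.mul_sum]
    refine Finset.sum_congr rfl fun j _ => ?_
    rw [D2_smul R h]
    ring
  · congr 1
    funext u
    rw [fderiv_smulx R (h.differentiableAt nnu), map_smul, smul_eq_mul]
    ring
end
end DPE

/-- **Theorem 3.1 (existence and uniqueness part), classical-solution rendering on a ball.**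
There exist a principal eigenvalue `λ_B` and a positive eigenfunction `ψ` vanishing on the
boundary, and `ψ` is unique up to multiplication by a positive scalar. -/
theorem dirichlet_principal_eigenpair_exists_unique
    {d : ℕ} (hd : 1 ≤ d) {U : Type*} [MetricSpace U] [CompactSpace U] [Nonempty U]
    (c : EuclideanSpace ℝ (Fin d)) (R : ℝ) (hR : 0 < R)
    (a : EuclideanSpace ℝ (Fin d) → Matrix (Fin d) (Fin d) ℝ)
    (b : EuclideanSpace ℝ (Fin d) → U → EuclideanSpace ℝ (Fin d))
    (r : EuclideanSpace ℝ (Fin d) → U → ℝ)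
    -- `a` is Lipschitz on the closed ball
    (ha_lip : ∃ K : NNReal, ∀ i j, LipschitzOnWith K (fun x => a x i j) (closedBall c R))
    -- each `a(x)` is symmetric
    (ha_symm : ∀ x ∈ closedBall c R, (a x).IsSymm)
    -- uniform ellipticity
    (ha_ell : ∃ C : ℝ, 1 ≤ C ∧ ∀ x ∈ closedBall c R, ∀ z : EuclideanSpace ℝ (Fin d),
      C⁻¹ * ‖z‖ ^ 2 ≤ quadForm (a x) z ∧ quadForm (a x) z ≤ C * ‖z‖ ^ 2)
    -- joint continuity of `b` and `r`
    (hb_cont : ContinuousOn (fun p : EuclideanSpace ℝ (Fin d) × U => b p.1 p.2)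
      (closedBall c R ×ˢ univ))
    (hr_cont : ContinuousOn (fun p : EuclideanSpace ℝ (Fin d) × U => r p.1 p.2)
      (closedBall c R ×ˢ univ))
    -- Lipschitz continuity in `x`, uniformly in `u`
    (hb_lip : ∃ K : NNReal, ∀ u : U, LipschitzOnWith K (fun x => b x u) (closedBall c R))
    (hr_lip : ∃ K : NNReal, ∀ u : U, LipschitzOnWith K (fun x => r x u) (closedBall c R)) :
    ∃ (lamB : ℝ) (ψ : EuclideanSpace ℝ (Fin d) → ℝ),
      ContDiffOn ℝ 2 ψ (ball c R) ∧ ContinuousOn ψ (closedBall c R) ∧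
      (∀ x ∈ ball c R, 0 < ψ x) ∧ (∀ x ∈ sphere c R, ψ x = 0) ∧
      (∀ x ∈ ball c R, Gop a b r ψ x = lamB * ψ x) ∧
      (∀ ψ' : EuclideanSpace ℝ (Fin d) → ℝ,
        ContDiffOn ℝ 2 ψ' (ball c R) → ContinuousOn ψ' (closedBall c R) →
        (∀ x ∈ ball c R, 0 < ψ' x) → (∀ x ∈ sphere c R, ψ' x = 0) →
        (∀ x ∈ ball c R, Gop a b r ψ' x = lamB * ψ' x) →
        ∃ t : ℝ, 0 < t ∧ ∀ x ∈ closedBall c R, ψ' x = t * ψ x) := by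
  classical
  obtain ⟨Ka, hKa⟩ := ha_lip
  obtain ⟨C, hC, hell⟩ := ha_ell
  obtain ⟨Kb, hKb⟩ := hb_lip
  obtain ⟨Kr, hKr⟩ := hr_lip
  have cpt : IsCompact (closedBall c R ×ˢ (univ : Set U)) := (isCompact_closedBall c R).prod isCompact_univ
  obtain ⟨Bb, hBb⟩ := cpt.exists_bound_of_continuousOn hb_cont
  obtain ⟨Br, hBr⟩ := cpt.exists_bound_of_continuousOn hr_cont
  obtain ⟨P, P1, P2, P3⟩ := DPE.exists_proj (d := d) (zero_le_one (α := ℝ))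
  have hm : ∀ y : EuclideanSpace ℝ (Fin d), c + R • P y ∈ closedBall c R := fun y => by
    rw [mem_closedBall, dist_eq_norm, add_sub_cancel_left, norm_smul, Real.norm_eq_abs, abs_of_pos hR]
    exact mul_le_of_le_one_right hR.le (P2 y)
  have hdist : ∀ x y : EuclideanSpace ℝ (Fin d), dist (c + R • P x) (c + R • P y) ≤ R * ‖x - y‖ := fun x y => by
    rw [dist_eq_norm, add_sub_add_left_eq_sub, ← smul_sub, norm_smul, Real.norm_eq_abs, abs_of_pos hR]
    exact mul_le_mul_of_nonneg_left (P1 x y) hR.le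
  have hA : DPE.Coef (fun y => a (c + R • P y)) (Ka * R) C := by
    refine ⟨hC, by positivity, fun x y i j => ?_, fun x => ha_symm _ (hm x), fun x z => hell _ (hm x) z⟩
    have h1 := (hKa i j).dist_le_mul _ (hm x) _ (hm y)
    rw [Real.dist_eq] at h1
    exact h1.trans ((mul_le_mul_of_nonneg_left (hdist x y) Ka.2).trans (by rw [mul_assoc]; exact le_rfl))
  have hbB : ∀ (x : EuclideanSpace ℝ (Fin d)) (u : U), ‖R • b (c + R • P x) u‖ ≤ R * |Bb| + R ^ 2 * |Br| := fun x u => by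
    have h1 := (hBb (c + R • P x, u) ⟨hm x, mem_univ u⟩).trans (le_abs_self Bb)
    rw [norm_smul, Real.norm_eq_abs, abs_of_pos hR]
    have h2 := mul_le_mul_of_nonneg_left h1 hR.le
    have h3 : 0 ≤ R ^ 2 * |Br| := by positivity
    exact h2.trans (le_add_of_nonneg_right h3)
  have hrB : ∀ (x : EuclideanSpace ℝ (Fin d)) (u : U), |R ^ 2 * r (c + R • P x) u| ≤ R * |Bb| + R ^ 2 * |Br| := fun x u => by
    have h1 := (hBr (c + R • P x, u) ⟨hm x, mem_univ u⟩).trans (le_abs_self Br)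
    rw [abs_mul, abs_of_nonneg (sq_nonneg R)]
    have h2 := mul_le_mul_of_nonneg_left h1 (sq_nonneg R)
    have h3 : 0 ≤ R * |Bb| := by positivity
    exact h2.trans (le_add_of_nonneg_left h3)
  have hbK : ∀ (x y : EuclideanSpace ℝ (Fin d)) (u : U), ‖R • b (c + R • P x) u - R • b (c + R • P y) u‖ ≤ (R * (Kb * R) + R ^ 2 * (Kr * R)) * ‖x - y‖ := fun x y u => by
    have h1 := (hKb u).dist_le_mul _ (hm x) _ (hm y)
    rw [dist_eq_norm] at h1
    have h2 := mul_le_mul_of_nonneg_left (h1.trans (mul_le_mul_of_nonneg_left (hdist x y) Kb.2)) hR.le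
    rw [← smul_sub, norm_smul, Real.norm_eq_abs, abs_of_pos hR]
    have h3 : 0 ≤ R ^ 2 * (Kr * R) * ‖x - y‖ := by positivity
    refine h2.trans ?_
    rw [add_mul]
    refine le_trans (le_of_eq ?_) (le_add_of_nonneg_right h3)
    ring
  have hrK : ∀ (x y : EuclideanSpace ℝ (Fin d)) (u : U), |R ^ 2 * r (c + R • P x) u - R ^ 2 * r (c + R • P y) u| ≤ (R * (Kb * R) + R ^ 2 * (Kr * R)) * ‖x - y‖ := fun x y u => by
    have h1 := (hKr u).dist_le_mul _ (hm x) _ (hm y)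
    rw [Real.dist_eq] at h1
    have h2 := mul_le_mul_of_nonneg_left (h1.trans (mul_le_mul_of_nonneg_left (hdist x y) Kr.2)) (sq_nonneg R)
    rw [← mul_sub, abs_mul, abs_of_nonneg (sq_nonneg R)]
    have h3 : 0 ≤ R * (Kb * R) * ‖x - y‖ := by positivity
    refine h2.trans ?_
    rw [add_mul]
    refine le_trans (le_of_eq ?_) (le_add_of_nonneg_left h3)
    ring
  have hHm := DPE.hamInf (by clear * - hR; positivity) (by clear * - hR; positivity) hbB hrB hbK hrK
  obtain ⟨lam, g, gR, gp, gb, ge, gu⟩ := DPE.unit_main hA hd hHm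
  have R0 : R ≠ 0 := hR.ne'
  have inv1 : ∀ y : EuclideanSpace ℝ (Fin d), R⁻¹ • (c + R • y - c) = y := fun y => by
    rw [add_sub_cancel_left, smul_smul, inv_mul_cancel₀ R0, one_smul]
  have inv2 : ∀ x : EuclideanSpace ℝ (Fin d), c + R • (R⁻¹ • (x - c)) = x := fun x => by
    rw [smul_smul, mul_inv_cancel₀ R0, one_smul, add_sub_cancel]
  have nrm : ∀ x : EuclideanSpace ℝ (Fin d), ‖R⁻¹ • (x - c)‖ = dist x c / R := fun x => by
    rw [norm_smul, Real.norm_eq_abs, abs_of_pos (inv_pos.2 hR), dist_eq_norm, div_eq_inv_mul]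
  have nrm2 : ∀ y : EuclideanSpace ℝ (Fin d), dist (c + R • y) c = R * ‖y‖ := fun y => by
    rw [dist_eq_norm, add_sub_cancel_left, norm_smul, Real.norm_eq_abs, abs_of_pos hR]
  have mb : ∀ x ∈ ball c R, ‖R⁻¹ • (x - c)‖ < 1 := fun x hx => by rw [nrm, div_lt_one hR]; exact hx
  have mcb : ∀ x ∈ closedBall c R, ‖R⁻¹ • (x - c)‖ ≤ 1 := fun x hx => by rw [nrm, div_le_one hR]; exact hx
  have ms : ∀ x ∈ sphere c R, ‖R⁻¹ • (x - c)‖ = 1 := fun x hx => by rw [nrm, div_eq_one_iff_eq R0]; exact hx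
  have mb' : ∀ y : EuclideanSpace ℝ (Fin d), ‖y‖ < 1 → c + R • y ∈ ball c R := fun y hy => by
    rw [mem_ball, nrm2]; exact mul_lt_of_lt_one_right hR hy
  have mcb' : ∀ y : EuclideanSpace ℝ (Fin d), ‖y‖ ≤ 1 → c + R • y ∈ closedBall c R := fun y hy => by
    rw [mem_closedBall, nrm2]; exact mul_le_of_le_one_right hR.le hy
  have ms' : ∀ y : EuclideanSpace ℝ (Fin d), ‖y‖ = 1 → c + R • y ∈ sphere c R := fun y hy => by
    rw [mem_sphere, nrm2, hy, mul_one]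
  have sc : ∀ ψ : EuclideanSpace ℝ (Fin d) → ℝ, ContDiffOn ℝ 2 ψ (ball c R) → ∀ y : EuclideanSpace ℝ (Fin d), ‖y‖ < 1 →
      R ^ 2 * Gop a b r ψ (c + R • y) = DPE.tr (a (c + R • P y)) (DPE.D2 (fun z => ψ (c + R • z)) y) +
      ⨅ u, (fderiv ℝ (fun z => ψ (c + R • z)) y (R • b (c + R • P y) u) + R ^ 2 * r (c + R • P y) u * ψ (c + R • y)) := by
    intro ψ h y hy
    rw [P3 y hy.le]
    exact DPE.Gop_scale (h.contDiffAt (isOpen_ball.mem_nhds (mb' y hy)))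
  have cd : ContDiffOn ℝ 2 (fun x => g (R⁻¹ • (x - c))) (ball c R) :=
    gR.1.comp (by fun_prop : ContDiff ℝ 2 fun x : EuclideanSpace ℝ (Fin d) => R⁻¹ • (x - c)).contDiffOn fun x hx => by
      rw [mem_ball_zero_iff]; exact mb x hx
  have eg : (fun z => g (R⁻¹ • (c + R • z - c))) = g := funext fun z => by rw [inv1]
  refine ⟨lam / R ^ 2, fun x => g (R⁻¹ • (x - c)), cd, ?_, fun x hx => gp _ (mb x hx), fun x hx => gb _ (ms x hx),
    fun x hx => ?_, fun p p1 p2 p3 p4 p5 => ?_⟩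
  · exact gR.2.comp (by fun_prop) fun x hx => by
      rw [mem_closedBall_zero_iff]; exact mcb x hx
  · have h1 := sc _ cd _ (mb x hx)
    simp only [eg, inv2] at h1
    have h2 := ge _ (mb x hx)
    have h3 := h1.trans h2
    show Gop a b r (fun x => g (R⁻¹ • (x - c))) x = lam / R ^ 2 * g (R⁻¹ • (x - c))
    rw [div_mul_eq_mul_div, eq_div_iff (pow_ne_zero 2 R0), ← h3]
    ring
  · have q1 : DPE.Rg fun y => p (c + R • y) := by
      refine ⟨p1.comp (by fun_prop : ContDiff ℝ 2 fun x : EuclideanSpace ℝ (Fin d) => c + R • x).contDiffOn fun y hy => ?_, p2.comp (by fun_prop) fun y hy => ?_⟩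
      · exact mb' y (by simpa using hy)
      · exact mcb' y (by simpa using hy)
    obtain ⟨t, t0, ht⟩ := gu _ q1 (fun y hy => p3 _ (mb' y hy)) (fun y hy => p4 _ (ms' y hy)) fun y hy => by
      have h1 := sc p p1 y hy
      rw [p5 _ (mb' y hy)] at h1
      refine h1.symm.trans ?_
      (clear * - R0; field_simp)
    refine ⟨t, t0, fun x hx => ?_⟩
    have := ht _ (mcb x hx)
    simp only [inv2] at this
    exact this
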